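/- Let L ⊂ ℝ^2 be a two-dimensional lattice. There exists a real number F with N_L(x)·√(log x)/x → F as x → ∞ if and only if L is arithmetic, i.e., there exist a basis v_1, v_2 of L and a real λ > 0 such that λ·⟨v_i, v_j⟩ is rational for all i, j ∈ {1, 2} (equivalently, the quadratic form associated to L is a positive real multiple of a binary quadratic form with integer coefficients). -/

import Mathlib

open Filter Real
open scoped RealInnerProductSpace

/-- The lattice (set of all integral linear combinations) spanned by `v₁` and `v₂`. -/
def latticeOf (v₁ v₂ : EuclideanSpace ℝ (Fin 2)) : Set (EuclideanSpace ℝ (Fin 2)) :=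
  {v | ∃ m n : ℤ, v = m • v₁ + n • v₂}

/-- `NL Λ x` is the number of distinct values `0 < r ≤ x` taken by the squared Euclidean
norm on the lattice `Λ`. -/
noncomputable def NL (Λ : Set (EuclideanSpace ℝ (Fin 2))) (x : ℝ) : ℕ :=
  Set.ncard {r : ℝ | 0 < r ∧ r ≤ x ∧ ∃ v ∈ Λ, ‖v‖ ^ 2 = r}

lemma exists_rat_of_three_reps {a b c : ℝ} (ha : 0 < a) (hd : b ^ 2 < a * c)
    {i₀ j₀ i₁ j₁ i₂ j₂ : ℕ}
    (h₁ : a * i₁ ^ 2 + 2 * b * (i₁ * j₁) + c * j₁ ^ 2 = a * i₀ ^ 2 + 2 * b * (i₀ * j₀) + c * j₀ ^ 2)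
    (h₂ : a * i₂ ^ 2 + 2 * b * (i₂ * j₂) + c * j₂ ^ 2 = a * i₀ ^ 2 + 2 * b * (i₀ * j₀) + c * j₀ ^ 2)
    (h01 : (i₀, j₀) ≠ (i₁, j₁)) (h02 : (i₀, j₀) ≠ (i₂, j₂)) (h12 : (i₁, j₁) ≠ (i₂, j₂)) :
    ∃ lam : ℝ, 0 < lam ∧ (∃ q : ℚ, lam * a = q) ∧ (∃ q : ℚ, lam * b = q) ∧
      (∃ q : ℚ, lam * c = q) := by
  set x₁ : ℤ := i₁ ^ 2 - i₀ ^ 2 with hx₁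
  set y₁ : ℤ := i₁ * j₁ - i₀ * j₀ with hy₁
  set z₁ : ℤ := j₁ ^ 2 - j₀ ^ 2 with hz₁
  set x₂ : ℤ := i₂ ^ 2 - i₀ ^ 2 with hx₂
  set y₂ : ℤ := i₂ * j₂ - i₀ * j₀ with hy₂
  set z₂ : ℤ := j₂ ^ 2 - j₀ ^ 2 with hz₂
  have e₁ : a * x₁ + 2 * b * y₁ + c * z₁ = 0 := by simp only [hx₁, hy₁, hz₁]; push_cast; linarith
  have e₂ : a * x₂ + 2 * b * y₂ + c * z₂ = 0 := by simp only [hx₂, hy₂, hz₂]; push_cast; linarith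
  by_cases hE : y₁ * z₂ - z₁ * y₂ = 0
  · exfalso
    have hER : (y₁ : ℝ) * z₂ - z₁ * y₂ = 0 := by exact_mod_cast hE
    have hE2 : (z₁ : ℝ) * x₂ - x₁ * z₂ = 0 := by
      have : a * ((z₁ : ℝ) * x₂ - x₁ * z₂) = 2 * b * (y₁ * z₂ - z₁ * y₂) := by
        linear_combination z₁ * e₂ - z₂ * e₁
      rw [hER, mul_zero] at this
      exact (mul_eq_zero.mp this).resolve_left ha.ne'
    have hE3 : (x₁ : ℝ) * y₂ - y₁ * x₂ = 0 := by
      have : a * ((x₁ : ℝ) * y₂ - y₁ * x₂) = c * (y₁ * z₂ - z₁ * y₂) := by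
        linear_combination y₂ * e₁ - y₁ * e₂
      rw [hER, mul_zero] at this
      exact (mul_eq_zero.mp this).resolve_left ha.ne'
    have nonneg_pair : ∀ {i j i' j' : ℕ}, (i : ℤ) ^ 2 - i' ^ 2 = 0 → (j : ℤ) ^ 2 - j' ^ 2 = 0 →
        (i', j') = (i, j) := by
      intro i j i' j' h h'
      have h1 : i ^ 2 = i' ^ 2 := by exact_mod_cast sub_eq_zero.mp h
      have h2 : j ^ 2 = j' ^ 2 := by exact_mod_cast sub_eq_zero.mp h'
      rw [Nat.pow_left_injective two_ne_zero h1, Nat.pow_left_injective two_ne_zero h2]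
    have key : (x₁ : ℝ) * z₁ - y₁ ^ 2 = 0 → False := by
      intro hq
      have hx : (a * x₁ + b * y₁) ^ 2 + (a * c - b ^ 2) * y₁ ^ 2 = 0 := by
        linear_combination a * x₁ * e₁ - a * c * hq
      have hy0 : (y₁ : ℝ) = 0 := by
        have : (y₁ : ℝ) ^ 2 = 0 := by
          by_contra hne
          have : 0 < (y₁ : ℝ) ^ 2 := by positivity
          nlinarith [sq_nonneg (a * x₁ + b * y₁), mul_pos (sub_pos.mpr hd) this]
        exact pow_eq_zero_iff two_ne_zero |>.mp this
      rw [hy0] at hx e₁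
      have hx0 : (x₁ : ℝ) = 0 := by
        have : (a * x₁) ^ 2 = 0 := by linarith
        exact (mul_eq_zero.mp (pow_eq_zero_iff two_ne_zero |>.mp this)).resolve_left ha.ne'
      have hc : 0 < c := by nlinarith [sq_nonneg b]
      rw [hx0] at e₁
      have hz0 : (z₁ : ℝ) = 0 := by
        have : c * z₁ = 0 := by linarith
        exact (mul_eq_zero.mp this).resolve_left hc.ne'
      exact h01 (nonneg_pair (Int.cast_eq_zero.mp hx0) (Int.cast_eq_zero.mp hz0))
    -- the line through the three points meets the cone three times
    have cone₁ : (x₁ : ℝ) * z₁ - y₁ ^ 2 + (x₁ * j₀ ^ 2 + i₀ ^ 2 * z₁ - 2 * i₀ * j₀ * y₁) = 0 := by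
      simp only [hx₁, hy₁, hz₁]; push_cast; ring
    have cone₂ : (x₂ : ℝ) * z₂ - y₂ ^ 2 + (x₂ * j₀ ^ 2 + i₀ ^ 2 * z₂ - 2 * i₀ * j₀ * y₂) = 0 := by
      simp only [hx₂, hy₂, hz₂]; push_cast; ring
    obtain ⟨t, ht⟩ : ∃ t : ℝ, (x₂ : ℝ) = t * x₁ ∧ (y₂ : ℝ) = t * y₁ ∧ (z₂ : ℝ) = t * z₁ := by
      by_cases hx0 : (x₁ : ℝ) = 0
      · have hz0 : (z₁ : ℝ) ≠ 0 := fun hz0 ↦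
          h01 (nonneg_pair (Int.cast_eq_zero.mp hx0) (Int.cast_eq_zero.mp hz0))
        refine ⟨z₂ / z₁, ?_, ?_, ?_⟩ <;> field_simp <;> linarith
      · refine ⟨x₂ / x₁, ?_, ?_, ?_⟩ <;> field_simp <;> linarith
    obtain ⟨t1, t2, t3⟩ := ht
    have ht0 : t ≠ 0 := by
      rintro rfl
      refine h02 (nonneg_pair (i := i₂) (j := j₂) ?_ ?_)
      · exact Int.cast_eq_zero.mp (by simpa using t1 : (x₂ : ℝ) = 0)
      · exact Int.cast_eq_zero.mp (by simpa using t3 : (z₂ : ℝ) = 0)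
    have ht1 : t ≠ 1 := by
      rintro rfl
      have q1 : x₂ = x₁ := by exact_mod_cast (by simpa using t1 : (x₂ : ℝ) = x₁)
      have q3 : z₂ = z₁ := by exact_mod_cast (by simpa using t3 : (z₂ : ℝ) = z₁)
      refine h12 (nonneg_pair (i := i₂) (j := j₂) (i' := i₁) (j' := j₁) ?_ ?_) <;> omega
    rw [t1, t2, t3] at cone₂
    apply key
    have : t * (t - 1) * ((x₁ : ℝ) * z₁ - y₁ ^ 2) = 0 := by linear_combination cone₂ - t * cone₁
    exact (mul_eq_zero.mp this).resolve_left (mul_ne_zero ht0 (sub_ne_zero.mpr ht1))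
  · have hER : ((y₁ : ℝ) * z₂ - z₁ * y₂) ≠ 0 := by exact_mod_cast hE
    refine ⟨1 / a, by positivity, ⟨1, by field_simp; norm_num⟩,
      ⟨(z₁ * x₂ - x₁ * z₂) / (2 * (y₁ * z₂ - z₁ * y₂)), ?_⟩,
      ⟨(x₁ * y₂ - y₁ * x₂) / (y₁ * z₂ - z₁ * y₂), ?_⟩⟩
    · push_cast
      rw [one_div, inv_mul_eq_div, div_eq_div_iff ha.ne' (mul_ne_zero two_ne_zero hER)]
      linear_combination z₂ * e₁ - z₁ * e₂
    · push_cast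
      rw [one_div, inv_mul_eq_div, div_eq_div_iff ha.ne' hER]
      linear_combination y₁ * e₂ - y₂ * e₁

lemma card_le_of_not_rational {a b c : ℝ} (ha : 0 < a) (hd : b ^ 2 < a * c)
    (hn : ¬ ∃ lam : ℝ, 0 < lam ∧ (∃ q : ℚ, lam * a = q) ∧ (∃ q : ℚ, lam * b = q) ∧
      (∃ q : ℚ, lam * c = q)) (M : ℕ) (S : Finset ℝ)
    (hS : ∀ i ∈ Finset.Icc 1 M, ∀ j ∈ Finset.Icc 1 M,
      a * (i : ℝ) ^ 2 + 2 * b * (i * j) + c * (j : ℝ) ^ 2 ∈ S) :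
    M ^ 2 ≤ 2 * S.card := by
  classical
  have := Finset.card_le_mul_card_image_of_maps_to
    (s := Finset.Icc 1 M ×ˢ Finset.Icc 1 M) (t := S)
    (f := fun p : ℕ × ℕ ↦ a * (p.1 : ℝ) ^ 2 + 2 * b * (p.1 * p.2) + c * (p.2 : ℝ) ^ 2)
    (fun p hp ↦ hS _ (Finset.mem_product.mp hp).1 _ (Finset.mem_product.mp hp).2) 2 ?_
  · simpa [pow_two] using this
  intro r _
  by_contra! hlt
  obtain ⟨p, q, s, hp, hq, hs, hpq, hps, hqs⟩ := Finset.two_lt_card_iff.mp hlt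
  simp only [Finset.mem_filter] at hp hq hs
  exact hn (exists_rat_of_three_reps ha hd (hq.2.trans hp.2.symm) (hs.2.trans hp.2.symm)
    hpq hps hqs)

lemma not_tendsto_of_not_rational {a b c : ℝ} (ha : 0 < a) (hd : b ^ 2 < a * c)
    (hn : ¬ ∃ lam : ℝ, 0 < lam ∧ (∃ q : ℚ, lam * a = q) ∧ (∃ q : ℚ, lam * b = q) ∧
      (∃ q : ℚ, lam * c = q)) (N : ℝ → ℕ)
    (hN : ∀ x, ∃ S : Finset ℝ, S.card = N x ∧ ∀ i j : ℕ, 1 ≤ i → 1 ≤ j →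
      a * (i : ℝ) ^ 2 + 2 * b * (i * j) + c * (j : ℝ) ^ 2 ≤ x →
      a * (i : ℝ) ^ 2 + 2 * b * (i * j) + c * (j : ℝ) ^ 2 ∈ S) (F : ℝ) :
    ¬ Tendsto (fun x : ℝ ↦ (N x : ℝ) * √(log x) / x) atTop (nhds F) := by
  intro hF
  set s : ℝ := a + 2 * |b| + c with hs
  have hc : 0 < c := by nlinarith [sq_nonneg b]
  have hs0 : 0 < s := by positivity
  have hlow : ∀ x, 4 * s ≤ x → x / (8 * s) ≤ N x := by
    intro x hx
    obtain ⟨S, hS, hmem⟩ := hN x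
    set M := ⌊√(x / s)⌋₊ with hM
    have hxs : 0 ≤ x / s := by have : 0 ≤ x := by linarith
                               positivity
    have hM1 : (M : ℝ) ≤ √(x / s) := Nat.floor_le (sqrt_nonneg _)
    have hM2 : √(x / s) < M + 1 := Nat.lt_floor_add_one _
    have hM3 : 2 ≤ √(x / s) := by
      apply le_sqrt_of_sq_le
      rw [le_div_iff₀ hs0]; linarith
    have hsq : √(x / s) ^ 2 = x / s := sq_sqrt hxs
    have h1 := card_le_of_not_rational ha hd hn M S (by
      intro i hi j hj
      rw [Finset.mem_Icc] at hi hj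
      refine hmem i j hi.1 hj.1 ?_
      have hi2 : (i : ℝ) ≤ M := by exact_mod_cast hi.2
      have hj2 : (j : ℝ) ≤ M := by exact_mod_cast hj.2
      have hii : (i : ℝ) ^ 2 ≤ M ^ 2 := by gcongr
      have hjj : (j : ℝ) ^ 2 ≤ M ^ 2 := by gcongr
      have hij : (i : ℝ) * j ≤ M ^ 2 := by rw [pow_two]; gcongr
      have hb : b * (i * j) ≤ |b| * M ^ 2 := by
        calc b * (i * j) ≤ |b| * (i * j) := by gcongr; exact le_abs_self b
          _ ≤ _ := by gcongr
      have hMs : s * (M : ℝ) ^ 2 ≤ x := by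
        calc s * (M : ℝ) ^ 2 ≤ s * √(x / s) ^ 2 := by gcongr
          _ = x := by rw [hsq]; field_simp
      have : a * (i : ℝ) ^ 2 ≤ a * M ^ 2 := by gcongr
      have : c * (j : ℝ) ^ 2 ≤ c * M ^ 2 := by gcongr
      rw [hs] at hMs
      nlinarith)
    have h2 : (M : ℝ) ^ 2 ≤ 2 * N x := by rw [← hS]; exact_mod_cast h1
    have h3 : √(x / s) / 2 ≤ M := by linarith
    have h4 : (√(x / s) / 2) ^ 2 ≤ (M : ℝ) ^ 2 := by gcongr
    have h5 : (√(x / s) / 2) ^ 2 = x / s / 4 := by rw [div_pow, hsq]; norm_num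
    have h6 : x / (8 * s) = x / s / 4 / 2 := by field_simp; ring
    rw [h6]; linarith
  have htop : Tendsto (fun x : ℝ ↦ (1 / (8 * s)) * √(log x)) atTop atTop :=
    (tendsto_sqrt_atTop.comp tendsto_log_atTop).const_mul_atTop (by positivity)
  refine not_tendsto_atTop_of_tendsto_nhds hF (tendsto_atTop_mono' _ ?_ htop)
  filter_upwards [eventually_ge_atTop (4 * s), eventually_gt_atTop 0] with x hx hx0
  rw [le_div_iff₀ hx0]
  calc 1 / (8 * s) * √(log x) * x = (x / (8 * s)) * √(log x) := by ring
    _ ≤ _ := by gcongr; exact hlow x hx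

section Fejer
open MeasureTheory

/-- The Fejér kernel, as the Fourier transform of the triangle function. -/
noncomputable def fejer (y : ℝ) : ℝ := 2 * ∫ t in (0:ℝ)..1, (1 - t) * Real.cos (t * y)

lemma fejer_zero : fejer 0 = 1 := by
  have : ∫ t in (0:ℝ)..1, (1 - t) = 1 / 2 := by
    rw [intervalIntegral.integral_sub (by simp) (by simp)]
    simp
    norm_num
  simp [fejer, this]

lemma sq_mul_fejer (y : ℝ) : y ^ 2 * fejer y = 2 * (1 - Real.cos y) := by
  rcases eq_or_ne y 0 with rfl | hy
  · simp
  have hd : ∀ t ∈ Set.uIcc (0:ℝ) 1, HasDerivAt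
      (fun t => (1 - t) * Real.sin (t * y) / y - Real.cos (t * y) / y ^ 2)
      ((1 - t) * Real.cos (t * y)) t := by
    intro t _
    have h1 : HasDerivAt (fun t : ℝ => t * y) y t := by
      simpa using (hasDerivAt_id t).mul_const y
    have h2 : HasDerivAt (fun t : ℝ => 1 - t) (-1) t := by
      simpa using (hasDerivAt_id t).const_sub 1
    have := ((h2.mul h1.sin).div_const y).sub (h1.cos.div_const (y ^ 2))
    refine this.congr_deriv ?_
    field_simp
    ring
  have := intervalIntegral.integral_eq_sub_of_hasDerivAt hd
    (Continuous.intervalIntegrable (by fun_prop) _ _)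
  rw [fejer, this]
  simp
  field_simp
  ring

lemma fejer_nonneg (y : ℝ) : 0 ≤ fejer y := by
  rcases eq_or_ne y 0 with rfl | hy
  · simp [fejer_zero]
  have h := sq_mul_fejer y
  have := Real.cos_le_one y
  have h2 : 0 < y ^ 2 := by positivity
  nlinarith [h]

lemma fejer_continuous : Continuous fejer := by
  unfold fejer
  refine continuous_const.mul ?_
  exact intervalIntegral.continuous_parametric_intervalIntegral_of_continuous' (by fun_prop) 0 1

lemma fejer_le (y : ℝ) : fejer y ≤ 5 * (1 + y ^ 2)⁻¹ := by
  have h := sq_mul_fejer y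
  have h1 := Real.neg_one_le_cos y
  have h2 : fejer y ≤ 1 := by
    have : ∫ t in (0:ℝ)..1, (1 - t) * Real.cos (t * y) ≤ ∫ t in (0:ℝ)..1, (1 - t) := by
      refine intervalIntegral.integral_mono_on (by norm_num)
        (Continuous.intervalIntegrable (by fun_prop) _ _)
        (Continuous.intervalIntegrable (by fun_prop) _ _) ?_
      intro t ht
      nlinarith [ht.1, ht.2, Real.cos_le_one (t * y)]
    have h0 := fejer_zero
    simp only [fejer, mul_zero, Real.cos_zero, mul_one] at h0
    simp only [fejer]
    linarith
  rw [← div_eq_mul_inv, le_div_iff₀ (by positivity)]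
  nlinarith

lemma fejer_integrable : Integrable fejer := by
  refine Integrable.mono' (integrable_inv_one_add_sq.const_mul 5)
    fejer_continuous.aestronglyMeasurable (ae_of_all _ fun y => ?_)
  rw [Real.norm_of_nonneg (fejer_nonneg y)]
  exact fejer_le y

lemma fejer_integral_pos : 0 < ∫ y, fejer y := by
  refine (integral_pos_iff_support_of_nonneg fejer_nonneg fejer_integrable).2 ?_
  refine (fejer_continuous.isOpen_support).measure_pos volume ⟨0, ?_⟩
  simp [fejer_zero]

lemma fejer_complex (y : ℝ) :
    ∫ t in (-1:ℝ)..1, ((1 - |t| : ℝ) : ℂ) * Complex.exp (Complex.I * t * y) = fejer y := by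
  have hc : Continuous fun t : ℝ => ((1 - |t| : ℝ) : ℂ) * Complex.exp (Complex.I * t * y) := by
    fun_prop
  rw [← intervalIntegral.integral_add_adjacent_intervals (hc.intervalIntegrable (-1) 0)
    (hc.intervalIntegrable 0 1)]
  have h1 : ∫ t in (-1:ℝ)..0, ((1 - |t| : ℝ) : ℂ) * Complex.exp (Complex.I * t * y) =
      ∫ t in (0:ℝ)..1, ((1 - |t| : ℝ) : ℂ) * Complex.exp (-(Complex.I * t * y)) := by
    have := intervalIntegral.integral_comp_neg (a := 0) (b := 1)
      (fun t : ℝ => ((1 - |t| : ℝ) : ℂ) * Complex.exp (Complex.I * t * y))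
    simp only [neg_zero, abs_neg] at this
    rw [← this]
    congr 1
    ext t
    push_cast
    ring_nf
  rw [h1, ← intervalIntegral.integral_add (Continuous.intervalIntegrable (by fun_prop) _ _)
    (hc.intervalIntegrable 0 1)]
  unfold fejer
  push_cast
  rw [← intervalIntegral.integral_ofReal, ← intervalIntegral.integral_const_mul]
  refine intervalIntegral.integral_congr ?_
  intro t ht
  rw [Set.uIcc_of_le (by norm_num)] at ht
  simp only
  rw [abs_of_nonneg ht.1]
  push_cast
  rw [Complex.cos]
  ring_nf

end Fejer

section FejerSmoothing
open MeasureTheory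

lemma fejer_smoothing (g : ℝ → ℝ) (hg : IntegrableOn g (Set.Ioi 0)) (T u : ℝ) :
    ∫ s in (-1:ℝ)..1, ((1 - |s| : ℝ) : ℂ) * Complex.exp (Complex.I * s * (T * u)) *
      (∫ v in Set.Ioi (0:ℝ), (g v : ℂ) * Complex.exp (-(Complex.I * (T * s) * v))) =
    ((∫ v in Set.Ioi (0:ℝ), g v * fejer (T * (u - v)) : ℝ) : ℂ) := by
  rw [intervalIntegral.integral_of_le (by norm_num)]
  simp_rw [← integral_const_mul]
  rw [integral_integral_swap]
  · rw [← integral_complex_ofReal]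
    refine integral_congr_ae (ae_of_all _ fun v => ?_)
    simp only
    rw [← intervalIntegral.integral_of_le (by norm_num)]
    push_cast
    rw [← fejer_complex, ← intervalIntegral.integral_const_mul]
    refine intervalIntegral.integral_congr fun s _ => ?_
    have : Complex.exp (Complex.I * s * ((T * (u - v) : ℝ) : ℂ)) =
      Complex.exp (Complex.I * s * (T * u)) * Complex.exp (-(Complex.I * (T * s) * v)) := by
      rw [← Complex.exp_add]
      push_cast
      ring_nf
    rw [this]
    push_cast
    ring
  · have h1 : Integrable (fun s : ℝ => ((1 - |s| : ℝ) : ℂ)) (volume.restrict (Set.Ioc (-1) 1)) :=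
      ((Continuous.integrableOn_Icc (by fun_prop)).mono_set Set.Ioc_subset_Icc_self)
    have h2 := h1.mul_prod (hg.ofReal (𝕜 := ℂ))
    have h3 := h2.bdd_mul (c := 1) (f := fun z : ℝ × ℝ =>
      Complex.exp (Complex.I * (z.1 * (T * u) - T * z.1 * z.2 : ℝ)))
      (Continuous.aestronglyMeasurable (by fun_prop))
      (ae_of_all _ fun z => by rw [mul_comm, Complex.norm_exp_ofReal_mul_I])
    refine h3.congr (ae_of_all _ fun z => ?_)
    simp only [Function.uncurry]
    have : Complex.exp (Complex.I * (z.1 * (T * u) - T * z.1 * z.2 : ℝ)) =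
      Complex.exp (Complex.I * z.1 * (T * u)) * Complex.exp (-(Complex.I * (T * z.1) * z.2)) := by
      rw [← Complex.exp_add]
      push_cast
      ring_nf
    rw [this]
    simp only [RCLike.ofReal_eq_complex_ofReal] 
    ring

lemma fejer_smoothing_bound (g : ℝ → ℝ) (hg : IntegrableOn g (Set.Ioi 0)) {T : ℝ} (hT : 0 < T)
    (u : ℝ) {C : ℝ} (hC0 : 0 ≤ C)
    (hC : ∫⁻ t in Set.Icc (-T) T,
      ‖∫ v in Set.Ioi (0:ℝ), (g v : ℂ) * Complex.exp (-(Complex.I * t * v))‖ₑ ≤ ENNReal.ofReal C) :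
    |∫ v in Set.Ioi (0:ℝ), g v * fejer (T * (u - v))| * T ≤ C := by
  have h := fejer_smoothing g hg T u
  have h2 := intervalIntegral.integral_comp_mul_left (a := -1) (b := 1)
    (fun t : ℝ => ((1 - |t / T| : ℝ) : ℂ) * Complex.exp (Complex.I * t * u) *
      (∫ v in Set.Ioi (0:ℝ), (g v : ℂ) * Complex.exp (-(Complex.I * t * v)))) hT.ne'
  have h3 : ∫ s in (-1:ℝ)..1, ((1 - |s| : ℝ) : ℂ) * Complex.exp (Complex.I * s * (T * u)) *
      (∫ v in Set.Ioi (0:ℝ), (g v : ℂ) * Complex.exp (-(Complex.I * (T * s) * v))) =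
      ∫ s in (-1:ℝ)..1, (fun t : ℝ => ((1 - |t / T| : ℝ) : ℂ) * Complex.exp (Complex.I * t * u) *
      (∫ v in Set.Ioi (0:ℝ), (g v : ℂ) * Complex.exp (-(Complex.I * t * v)))) (T * s) := by
    refine intervalIntegral.integral_congr fun s _ => ?_
    simp only
    rw [mul_div_cancel_left₀ _ hT.ne']
    push_cast
    congr 3
    ring
  rw [h3, h2] at h
  have h4 : |∫ v in Set.Ioi (0:ℝ), g v * fejer (T * (u - v))| =
      ‖((∫ v in Set.Ioi (0:ℝ), g v * fejer (T * (u - v)) : ℝ) : ℂ)‖ := by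
    simp
  rw [h4, ← h, norm_smul, Real.norm_of_nonneg (by positivity), mul_comm, ← mul_assoc,
    mul_inv_cancel₀ hT.ne', one_mul, intervalIntegral.integral_of_le (by linarith)]
  rw [← ENNReal.ofReal_le_ofReal_iff hC0, ofReal_norm]
  refine (enorm_integral_le_lintegral_enorm _).trans (le_trans ?_ hC)
  have : ∫⁻ t in Set.Icc (-T) T,
      ‖∫ v in Set.Ioi (0:ℝ), (g v : ℂ) * Complex.exp (-(Complex.I * t * v))‖ₑ =
      ∫⁻ t in Set.Ioc (-T) T,
      ‖∫ v in Set.Ioi (0:ℝ), (g v : ℂ) * Complex.exp (-(Complex.I * t * v))‖ₑ :=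
    setLIntegral_congr Ioc_ae_eq_Icc.symm
  rw [this]
  have e1 : T * -1 = -T := by ring
  rw [e1, mul_one]
  refine setLIntegral_mono' measurableSet_Ioc fun t ht => ?_
  have e2 : ‖((1 - |t / T| : ℝ) : ℂ)‖ ≤ 1 := by
    rw [Complex.norm_real, Real.norm_eq_abs, abs_le]
    have : |t / T| ≤ 1 := by
      rw [abs_div, abs_of_pos hT, div_le_one hT, abs_le]
      exact ⟨ht.1.le, ht.2⟩
    constructor <;> linarith [abs_nonneg (t / T)]
  have e3 : ‖Complex.exp (Complex.I * t * u)‖ = 1 := by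
    have : Complex.I * t * u = ((t * u : ℝ) : ℂ) * Complex.I := by push_cast; ring
    rw [this, Complex.norm_exp_ofReal_mul_I]
  rw [← ofReal_norm, ← ofReal_norm]
  refine ENNReal.ofReal_le_ofReal ?_
  rw [norm_mul, norm_mul, e3, mul_one]
  exact mul_le_of_le_one_left (norm_nonneg _) e2

end FejerSmoothing

section Tauberian
open MeasureTheory Set

lemma sqrt_mul_exp_neg_le_one (y : ℝ) : √y * rexp (-y) ≤ 1 := by
  rcases le_or_gt y 0 with hy | hy
  · rw [Real.sqrt_eq_zero_of_nonpos hy]; simp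
  · have h1 : √y ≤ y + 1 := by
      nlinarith [Real.sq_sqrt hy.le, Real.sqrt_nonneg y, sq_nonneg (√y - 1)]
    have h2 := Real.add_one_le_exp y
    rw [Real.exp_neg, ← div_eq_mul_inv, div_le_one (Real.exp_pos _)]
    linarith

lemma fejer_main_term {T : ℝ} (hT : 0 < T) {u : ℝ} (hu : 0 < u) :
    T * ∫ v in Ioi (0:ℝ), √v * rexp (-(v / u)) * fejer (T * (u - v)) =
      √u * ∫ w, √(1 - w / (T * u)) * rexp (-(1 - w / (T * u))) * fejer w := by
  have h1 : ∫ v in Ioi (0:ℝ), √v * rexp (-(v / u)) * fejer (T * (u - v)) =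
      ∫ v, √v * rexp (-(v / u)) * fejer (T * (u - v)) := by
    refine setIntegral_eq_integral_of_forall_compl_eq_zero fun v hv => ?_
    rw [Real.sqrt_eq_zero_of_nonpos (by simpa using hv)]
    simp
  have h2 := integral_sub_left_eq_self (μ := volume) (fun y =>
    √u * (√(1 - (T * y) / (T * u)) * rexp (-(1 - (T * y) / (T * u))) * fejer (T * y))) u
  have h3 := Measure.integral_comp_mul_left (fun w =>
    √u * (√(1 - w / (T * u)) * rexp (-(1 - w / (T * u))) * fejer w)) T
  rw [h1, ← integral_const_mul (√u)]
  rw [h3, abs_of_pos (by positivity)] at h2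
  have h4 : ∀ v, √u * (√(1 - (T * (u - v)) / (T * u)) * rexp (-(1 - (T * (u - v)) / (T * u))) *
      fejer (T * (u - v))) = √v * rexp (-(v / u)) * fejer (T * (u - v)) := by
    intro v
    have : 1 - (T * (u - v)) / (T * u) = v / u := by field_simp; ring
    rw [this, ← mul_assoc, ← mul_assoc, ← Real.sqrt_mul hu.le, mul_div_cancel₀ _ hu.ne']
  simp_rw [h4] at h2
  rw [h2, smul_eq_mul, ← mul_assoc, mul_inv_cancel₀ hT.ne', one_mul]

lemma fejer_main_limit {T : ℝ} (hT : 0 < T) :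
    Tendsto (fun u : ℝ => ∫ w, √(1 - w / (T * u)) * rexp (-(1 - w / (T * u))) * fejer w) atTop
      (nhds (rexp (-1) * ∫ w, fejer w)) := by
  rw [← integral_const_mul]
  refine tendsto_integral_filter_of_dominated_convergence fejer ?_ ?_ fejer_integrable ?_
  · refine Eventually.of_forall fun u => Continuous.aestronglyMeasurable ?_
    have := fejer_continuous
    fun_prop
  · refine Eventually.of_forall fun u => ae_of_all _ fun w => ?_
    rw [norm_mul, Real.norm_of_nonneg (by positivity), Real.norm_of_nonneg (fejer_nonneg w)]
    exact mul_le_of_le_one_left (fejer_nonneg w) (sqrt_mul_exp_neg_le_one _)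
  · refine ae_of_all _ fun w => Tendsto.mul_const _ ?_
    have h : Tendsto (fun u : ℝ => 1 - w / (T * u)) atTop (nhds (1 - 0)) :=
      tendsto_const_nhds.sub ((tendsto_id.const_mul_atTop hT).const_div_atTop w)
    have h2 := ((Real.continuous_sqrt.tendsto _).comp h).mul
      ((Real.continuous_exp.tendsto _).comp h.neg)
    simpa using h2

lemma fejer_window {T : ℝ} (hT : 0 < T) {δ : ℝ} (hδ : 0 < δ) (u : ℝ) :
    T * ∫ v in Ioc (u - δ) (u + δ), fejer (T * (u - v)) =
      ∫ w in (-(T * δ))..(T * δ), fejer w := by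
  rw [← intervalIntegral.integral_of_le (by linarith)]
  have := intervalIntegral.integral_comp_sub_mul (a := u - δ) (b := u + δ) fejer hT.ne' (T * u)
  simp_rw [mul_sub]
  rw [this, smul_eq_mul, ← mul_assoc, mul_inv_cancel₀ hT.ne', one_mul]
  congr 1 <;> ring

lemma fejer_comp_integrable {T : ℝ} (hT : 0 < T) (u : ℝ) :
    Integrable (fun v => fejer (T * (u - v))) := by
  have := (fejer_integrable.comp_mul_left' hT.ne').comp_sub_left u
  exact this

lemma fejer_window_compl {T : ℝ} (hT : 0 < T) {δ : ℝ} (hδ : 0 < δ) (u : ℝ) :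
    T * ∫ v in (Ioc (u - δ) (u + δ))ᶜ, fejer (T * (u - v)) =
      (∫ w, fejer w) - ∫ w in (-(T * δ))..(T * δ), fejer w := by
  have h := integral_add_compl (measurableSet_Ioc (a := u - δ) (b := u + δ))
    (fejer_comp_integrable hT u)
  have h1 := fejer_window hT hδ u
  have h2 : T * ∫ v, fejer (T * (u - v)) = ∫ w, fejer w := by
    rw [integral_sub_left_eq_self (μ := volume) (fun v => fejer (T * v)) u,
      Measure.integral_comp_mul_left, abs_of_pos (by positivity), smul_eq_mul, ← mul_assoc,
      mul_inv_cancel₀ hT.ne', one_mul]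
  rw [← h1, ← h2, ← h]
  ring

variable {b : ℝ → ℝ}

lemma tauberian_integrable
    (hint : ∀ σ : ℝ, 1 < σ → IntegrableOn (fun v => b v * rexp (-(σ * v))) (Ioi 0))
    (T : ℝ) {u : ℝ} (hu : 0 < u) :
    IntegrableOn (fun v => b v * rexp (-v) * rexp (-(v / u)) * fejer (T * (u - v))) (Ioi 0) := by
  have h := hint (1 + 1 / u) (by simp [hu])
  have h2 := Integrable.mul_bdd (c := 5) h (f := fun v => b v * rexp (-((1 + 1 / u) * v)))
    (g := fun v => fejer (T * (u - v)))
    (Continuous.aestronglyMeasurable (fejer_continuous.comp (by fun_prop)))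
    (ae_of_all _ fun v => by
      rw [Real.norm_of_nonneg (fejer_nonneg _)]
      refine (fejer_le _).trans ?_
      have : (1 + (T * (u - v)) ^ 2)⁻¹ ≤ 1 := inv_le_one_of_one_le₀ (by nlinarith [sq_nonneg (T * (u - v))])
      linarith)
  refine h2.congr (ae_of_all _ fun v => ?_)
  simp only
  rw [mul_assoc (b v) (rexp (-v)), ← Real.exp_add]
  congr 3
  ring

lemma tauberian_window_le (hmono : MonotoneOn b (Ici 0)) (hnn : ∀ v, 0 ≤ v → 0 ≤ b v)
    (hint : ∀ σ : ℝ, 1 < σ → IntegrableOn (fun v => b v * rexp (-(σ * v))) (Ioi 0))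
    {T : ℝ} (hT : 0 < T) {δ : ℝ} (hδ : 0 < δ) {u : ℝ} (hu : δ < u) :
    b (u - δ) * rexp (-(u - δ)) * rexp (-(2 * δ)) * rexp (-((u + δ) / u)) *
      (∫ w in (-(T * δ))..(T * δ), fejer w) ≤
    T * ∫ v in Ioi (0:ℝ), b v * rexp (-v) * rexp (-(v / u)) * fejer (T * (u - v)) := by
  have hu0 : 0 < u := hδ.trans hu
  rw [← fejer_window hT hδ u, mul_left_comm]
  refine mul_le_mul_of_nonneg_left ?_ hT.le
  have hI := tauberian_integrable hint T hu0
  have hsub : Ioc (u - δ) (u + δ) ⊆ Ioi 0 := fun v hv => by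
    have := hv.1
    simp only [mem_Ioi]; linarith
  rw [← integral_const_mul]
  refine le_trans ?_ (setIntegral_mono_set hI ?_ hsub.eventuallyLE)
  · refine setIntegral_mono_on ((fejer_comp_integrable hT u).const_mul _).integrableOn
      (hI.mono_set hsub) measurableSet_Ioc fun v hv => ?_
    refine mul_le_mul_of_nonneg_right ?_ (fejer_nonneg _)
    have e1 : b (u - δ) ≤ b v := hmono (by simp; linarith) (by simp; linarith [hv.1]) hv.1.le
    have e0 : 0 ≤ b (u - δ) := hnn _ (by linarith)
    have e2 : rexp (-(u - δ)) * rexp (-(2 * δ)) ≤ rexp (-v) := by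
      rw [← Real.exp_add]
      exact Real.exp_le_exp.2 (by linarith [hv.2])
    have e3 : rexp (-((u + δ) / u)) ≤ rexp (-(v / u)) := by
      refine Real.exp_le_exp.2 (neg_le_neg ?_)
      exact div_le_div_of_nonneg_right hv.2 hu0.le
    rw [mul_assoc (b (u - δ))]
    have : 0 ≤ b v := e0.trans e1
    gcongr
  · refine (ae_restrict_iff' measurableSet_Ioi).2 (ae_of_all _ fun v hv => ?_)
    have := hnn v (le_of_lt hv)
    have := fejer_nonneg (T * (u - v))
    simp only [Pi.zero_apply]
    positivity

lemma tauberian_le_window (hmono : MonotoneOn b (Ici 0)) (hnn : ∀ v, 0 ≤ v → 0 ≤ b v)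
    (hint : ∀ σ : ℝ, 1 < σ → IntegrableOn (fun v => b v * rexp (-(σ * v))) (Ioi 0))
    {C₁ C₂ : ℝ} (hC₁ : 0 ≤ C₁) (hC₂ : 0 ≤ C₂)
    (hb : ∀ v, 0 ≤ v → b v * rexp (-v) ≤ C₁ + C₂ * √v)
    {T : ℝ} (hT : 0 < T) {δ : ℝ} (hδ : 0 < δ) {u : ℝ} (hu : δ < u) :
    T * ∫ v in Ioi (0:ℝ), b v * rexp (-v) * rexp (-(v / u)) * fejer (T * (u - v)) ≤
    b (u + δ) * rexp (-(u + δ)) * rexp (2 * δ) * rexp (-((u - δ) / u)) *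
      (∫ w in (-(T * δ))..(T * δ), fejer w) + (C₁ + C₂ * √u) *
        ((∫ w, fejer w) - ∫ w in (-(T * δ))..(T * δ), fejer w) := by
  have hu0 : 0 < u := hδ.trans hu
  rw [← fejer_window_compl hT hδ u, ← fejer_window hT hδ u, mul_left_comm, mul_left_comm _ T,
    ← mul_add]
  refine mul_le_mul_of_nonneg_left ?_ hT.le
  have hI := tauberian_integrable hint T hu0
  have hF := fejer_comp_integrable hT u
  have hsub : Ioc (u - δ) (u + δ) ⊆ Ioi 0 := fun v hv => by
    have := hv.1
    simp only [mem_Ioi]; linarith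
  have hsplit : Ioi (0:ℝ) = Ioc (u - δ) (u + δ) ∪ (Ioi 0 \ Ioc (u - δ) (u + δ)) := by
    rw [union_sdiff_cancel hsub]
  rw [hsplit, setIntegral_union disjoint_sdiff_right (measurableSet_Ioi.diff measurableSet_Ioc)
    (hI.mono_set hsub) (hI.mono_set sdiff_subset)]
  refine add_le_add ?_ ?_
  · rw [← integral_const_mul]
    refine setIntegral_mono_on (hI.mono_set hsub) (hF.const_mul _).integrableOn
       measurableSet_Ioc fun v hv => ?_
    refine mul_le_mul_of_nonneg_right ?_ (fejer_nonneg _)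
    have hv0 : 0 < v := hsub hv
    have e1 : b v ≤ b (u + δ) := hmono (by simp; linarith) (by simp; linarith [hv.1]) hv.2
    have e0 : 0 ≤ b v := hnn _ hv0.le
    have e2 : rexp (-v) ≤ rexp (-(u + δ)) * rexp (2 * δ) := by
      rw [← Real.exp_add]
      exact Real.exp_le_exp.2 (by linarith [hv.1])
    have e3 : rexp (-(v / u)) ≤ rexp (-((u - δ) / u)) := by
      refine Real.exp_le_exp.2 (neg_le_neg ?_)
      exact div_le_div_of_nonneg_right hv.1.le hu0.le
    rw [mul_assoc (b (u + δ))]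
    have : 0 ≤ b (u + δ) := e0.trans e1
    gcongr
  · rw [← integral_const_mul]
    refine le_trans (b := ∫ v in Ioi 0 \ Ioc (u - δ) (u + δ), (C₁ + C₂ * √u) *
      fejer (T * (u - v))) ?_ ?_
    · refine setIntegral_mono_on (hI.mono_set sdiff_subset) (hF.const_mul _).integrableOn
        (measurableSet_Ioi.diff measurableSet_Ioc) fun v hv => ?_
      refine mul_le_mul_of_nonneg_right ?_ (fejer_nonneg _)
      have hv0 : 0 < v := hv.1
      have e1 := sqrt_mul_exp_neg_le_one (v / u)
      have e2 : √v * rexp (-(v / u)) ≤ √u := by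
        have : √v = √u * √(v / u) := by
          rw [← Real.sqrt_mul hu0.le, mul_div_cancel₀ _ hu0.ne']
        rw [this, mul_assoc]
        exact mul_le_of_le_one_right (Real.sqrt_nonneg _) e1
      have e3 : rexp (-(v / u)) ≤ 1 := Real.exp_le_one_iff.2 (by simp; positivity)
      calc _ ≤ (C₁ + C₂ * √v) * rexp (-(v / u)) := by
            refine mul_le_mul_of_nonneg_right (hb v hv0.le) (Real.exp_pos _).le
        _ = C₁ * rexp (-(v / u)) + C₂ * (√v * rexp (-(v / u))) := by ring
        _ ≤ C₁ * 1 + C₂ * √u := by gcongr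
        _ = _ := by ring
    · refine setIntegral_mono_set (hF.const_mul _).integrableOn (ae_of_all _ fun v => ?_)
        (LE.le.eventuallyLE fun v hv => hv.2)
      have := fejer_nonneg (T * (u - v))
      simp only [Pi.zero_apply]
      positivity

end Tauberian

section TauberianTheorem
open MeasureTheory Set

lemma integrableOn_sqrt_mul_exp {σ : ℝ} (hσ : 0 < σ) :
    IntegrableOn (fun v => √v * rexp (-(σ * v))) (Ioi 0) := by
  have h := Real.GammaIntegral_convergent (s := 3 / 2) (by norm_num)
  have h2 := (integrableOn_Ioi_comp_mul_left_iff (fun x : ℝ => rexp (-x) * x ^ ((3:ℝ) / 2 - 1)) 0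
    hσ).2 (by simpa using h)
  have h3 : IntegrableOn (fun v => (√σ)⁻¹ * (rexp (-(σ * v)) * (σ * v) ^ ((3:ℝ) / 2 - 1))) (Ioi 0) := h2.const_mul _
  refine h3.congr (ae_of_all _ fun v => ?_)
  have : ((3:ℝ) / 2 - 1) = 1 / 2 := by norm_num
  simp only
  rw [this, ← Real.sqrt_eq_rpow, Real.sqrt_mul hσ.le]
  have : √σ ≠ 0 := (Real.sqrt_pos.2 hσ).ne'
  field_simp

lemma tauberian_smoothed {b : ℝ → ℝ}
    (hint : ∀ σ : ℝ, 1 < σ → IntegrableOn (fun v => b v * rexp (-(σ * v))) (Ioi 0))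
    {c T C : ℝ} (hC0 : 0 ≤ C) (hT : 0 < T) 
    (hC : ∀ᶠ σ : ℝ in nhdsWithin 1 (Ioi 1), ∫⁻ t in Icc (-T) T,
      ‖∫ v in Ioi (0:ℝ), (((b v - c * √v * rexp v) * rexp (-(σ * v)) : ℝ) : ℂ) *
        Complex.exp (-(Complex.I * t * v))‖ₑ ≤ ENNReal.ofReal C) :
    Tendsto (fun u => (T * ∫ v in Ioi (0:ℝ), b v * rexp (-v) * rexp (-(v / u)) *
      fejer (T * (u - v))) / √u) atTop (nhds (c * (rexp (-1) * ∫ w, fejer w))) := by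
  have hσ : Tendsto (fun u : ℝ => 1 + 1 / u) atTop (nhdsWithin 1 (Ioi 1)) := by
    refine tendsto_nhdsWithin_iff.2 ⟨?_, ?_⟩
    · have : Tendsto (fun u : ℝ => 1 + 1 / u) atTop (nhds (1 + 0)) :=
        tendsto_const_nhds.add (tendsto_id.const_div_atTop 1)
      simpa using this
    · filter_upwards [eventually_gt_atTop 0] with u hu
      simp [hu]
  have key : ∀ᶠ u : ℝ in atTop, |(T * ∫ v in Ioi (0:ℝ), b v * rexp (-v) * rexp (-(v / u)) *
      fejer (T * (u - v))) / √u - c * ∫ w, √(1 - w / (T * u)) * rexp (-(1 - w / (T * u))) *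
      fejer w| ≤ C / √u := by
    filter_upwards [hσ.eventually hC, eventually_gt_atTop 0] with u hu hu0
    have hs : 0 < √u := Real.sqrt_pos.2 hu0
    have e : ∀ v, rexp v * rexp (-((1 + 1 / u) * v)) = rexp (-(1 / u * v)) := fun v => by
      rw [← Real.exp_add]; congr 1; ring
    have hsi := integrableOn_sqrt_mul_exp (σ := 1 / u) (by positivity)
    have hg1 : IntegrableOn (fun v => c * √v * rexp v * rexp (-((1 + 1 / u) * v))) (Ioi 0) := by
      refine IntegrableOn.congr_fun (f := fun v => c * (√v * rexp (-(1 / u * v)))) ?_ ?_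
        measurableSet_Ioi
      · exact hsi.const_mul c
      · intro v _
        simp only
        rw [mul_assoc (c * √v), e]; ring
    have hg : IntegrableOn (fun v => (b v - c * √v * rexp v) * rexp (-((1 + 1 / u) * v)))
        (Ioi 0) := by
      refine ((hint (1 + 1 / u) (by simp [hu0])).sub hg1).congr (ae_of_all _ fun v => ?_)
      simp only [Pi.sub_apply]
      ring
    have hb := fejer_smoothing_bound _ hg hT u hC0 hu
    have hsplit : ∫ v in Ioi (0:ℝ), (b v - c * √v * rexp v) * rexp (-((1 + 1 / u) * v)) *
        fejer (T * (u - v)) = (∫ v in Ioi (0:ℝ), b v * rexp (-v) * rexp (-(v / u)) *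
        fejer (T * (u - v))) - c * ∫ v in Ioi (0:ℝ), √v * rexp (-(v / u)) *
        fejer (T * (u - v)) := by
      have hs2 := tauberian_integrable (b := fun v => √v * rexp v) (fun σ hσ => by
        refine IntegrableOn.congr_fun (integrableOn_sqrt_mul_exp (σ := σ - 1) (by linarith)) ?_
          measurableSet_Ioi
        intro v _
        simp only
        rw [mul_assoc, ← Real.exp_add]; congr 2; ring) T hu0
      have hs3 : ∀ v, √v * rexp v * rexp (-v) = √v := fun v => by
        rw [mul_assoc, ← Real.exp_add]; simp
      simp only [hs3] at hs2
      rw [← integral_const_mul, ← integral_sub (tauberian_integrable hint T hu0) (hs2.const_mul c)]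
      refine integral_congr_ae (ae_of_all _ fun v => ?_)
      have e1 : rexp (-((1 + 1 / u) * v)) = rexp (-v) * rexp (-(v / u)) := by
        rw [← Real.exp_add]; congr 1; ring
      have e2 : rexp v * rexp (-v) = 1 := by rw [← Real.exp_add]; simp
      simp only
      rw [e1]
      linear_combination (-(c * √v * rexp (-(v / u)) * fejer (T * (u - v)))) * e2
    have hm := fejer_main_term hT hu0
    rw [hsplit] at hb
    rw [le_div_iff₀ hs, ← abs_of_pos hs, ← abs_mul, abs_of_pos hs]
    rw [← abs_of_pos hT, ← abs_mul, abs_of_pos hT] at hb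
    refine le_trans (le_of_eq (congrArg _ ?_)) hb
    rw [sub_mul, div_mul_cancel₀ _ hs.ne']
    linear_combination c * hm
  have hlim := (fejer_main_limit hT).const_mul c
  have h0 : Tendsto (fun u : ℝ => C / √u) atTop (nhds 0) :=
    Tendsto.const_div_atTop Real.tendsto_sqrt_atTop C
  simp_rw [← Real.norm_eq_abs] at key
  have h1 := squeeze_zero_norm' key h0
  simpa using h1.add hlim

lemma tendsto_sqrt_add_div (δ : ℝ) :
    Tendsto (fun x : ℝ => √(x + δ) / √x) atTop (nhds 1) := by
  have h : Tendsto (fun x : ℝ => √(1 + δ / x)) atTop (nhds 1) := by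
    have : Tendsto (fun x : ℝ => 1 + δ / x) atTop (nhds (1 + 0)) :=
      tendsto_const_nhds.add (tendsto_id.const_div_atTop δ)
    simpa [Function.comp_def] using (Real.continuous_sqrt.tendsto _).comp this
  refine h.congr' ?_
  filter_upwards [eventually_gt_atTop 0, eventually_gt_atTop (-δ)] with x hx hx2
  rw [← Real.sqrt_div (by linarith)]
  congr 1
  field_simp

lemma fejer_window_tendsto :
    Tendsto (fun A : ℝ => ∫ w in (-A)..A, fejer w) atTop (nhds (∫ w, fejer w)) :=
  intervalIntegral_tendsto_integral fejer_integrable tendsto_neg_atTop_atBot tendsto_id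

/-- A Tauberian theorem of Wiener–Ikehara type for a singularity of order `3 / 2`. -/
theorem tauberian {b : ℝ → ℝ} (hmono : MonotoneOn b (Ici 0)) (hnn : ∀ v, 0 ≤ v → 0 ≤ b v)
    (hint : ∀ σ : ℝ, 1 < σ → IntegrableOn (fun v => b v * rexp (-(σ * v))) (Ioi 0))
    (c : ℝ)
    (hC : ∀ T : ℝ, 0 < T → ∃ C : ℝ, 0 ≤ C ∧ ∀ᶠ σ : ℝ in nhdsWithin 1 (Ioi 1),
      ∫⁻ t in Icc (-T) T,
      ‖∫ v in Ioi (0:ℝ), (((b v - c * √v * rexp v) * rexp (-(σ * v)) : ℝ) : ℂ) *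
        Complex.exp (-(Complex.I * t * v))‖ₑ ≤ ENNReal.ofReal C) :
    Tendsto (fun v => b v * rexp (-v) / √v) atTop (nhds c) := by
  set I₀ := ∫ w, fejer w with hI₀
  have hI₀pos : 0 < I₀ := fejer_integral_pos
  set k : ℝ → ℝ := fun A => ∫ w in (-A)..A, fejer w with hk
  have hklim : Tendsto k atTop (nhds I₀) := fejer_window_tendsto
  have hkle : ∀ A, k A ≤ I₀ := by
    intro A
    rcases le_or_gt 0 A with hA | hA
    · simp only [hk]
      rw [intervalIntegral.integral_of_le (by linarith)]
      exact setIntegral_le_integral fejer_integrable (ae_of_all _ fejer_nonneg)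
    · simp only [hk]
      rw [intervalIntegral.integral_of_ge (by linarith)]
      have : 0 ≤ ∫ w in Ioc A (-A), fejer w := integral_nonneg fejer_nonneg
      linarith
  set J : ℝ → ℝ → ℝ := fun T u => (T * ∫ v in Ioi (0:ℝ), b v * rexp (-v) * rexp (-(v / u)) *
      fejer (T * (u - v))) / √u with hJ
  have hJlim : ∀ T, 0 < T → Tendsto (J T) atTop (nhds (c * (rexp (-1) * I₀))) := by
    intro T hT
    obtain ⟨C, hC0, hC⟩ := hC T hT
    exact tauberian_smoothed hint hC0 hT hC
  have hid : Tendsto (fun A : ℝ => 1 / A) atTop (nhds 0) := tendsto_id.const_div_atTop 1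
  -- the upper bound
  have hup : ∀ c', c < c' → ∀ᶠ x in atTop, b x * rexp (-x) / √x ≤ c' := by
    intro c' hc'
    have h1 : Tendsto (fun A : ℝ => c * (rexp (-1) * I₀) * rexp (2 * (1 / A)) * rexp 1 / k A) atTop
        (nhds (c * (rexp (-1) * I₀) * rexp (2 * 0) * rexp 1 / I₀)) := by
      refine Tendsto.div ?_ hklim hI₀pos.ne'
      exact ((((Real.continuous_exp.tendsto _).comp (hid.const_mul 2)).const_mul _).mul_const _)
    have e1 : c * (rexp (-1) * I₀) * rexp (2 * 0) * rexp 1 / I₀ = c := by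
      rw [mul_zero, Real.exp_zero, Real.exp_neg]; field_simp
    rw [e1] at h1
    obtain ⟨A, hA1, hA0, hkA⟩ := ((h1.eventually_lt_const hc').and
      ((eventually_gt_atTop 0).and (hklim.eventually_const_lt hI₀pos))).exists
    set δ := 1 / A with hδ
    have hδ0 : 0 < δ := by positivity
    have hTδ : A ^ 2 * δ = A := by rw [hδ]; field_simp
    have hT : 0 < A ^ 2 := by positivity
    have h2 : Tendsto (fun x => J (A ^ 2) (x + δ) * (√(x + δ) / √x) * rexp (2 * δ) *
        rexp (1 + δ / (x + δ)) / k A) atTop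
        (nhds (c * (rexp (-1) * I₀) * 1 * rexp (2 * δ) * rexp (1 + 0) / k A)) := by
      have ht : Tendsto (fun x : ℝ => x + δ) atTop atTop := tendsto_atTop_add_const_right _ _ tendsto_id
      refine (((((hJlim _ hT).comp ht).mul (tendsto_sqrt_add_div δ)).mul_const _).mul
        ((Real.continuous_exp.tendsto _).comp
          (tendsto_const_nhds.add (ht.const_div_atTop δ)))).div_const _
    rw [mul_one, add_zero] at h2
    filter_upwards [h2.eventually_lt_const hA1, eventually_gt_atTop 0] with x hx hx0
    refine le_trans ?_ hx.le
    have h3 := tauberian_window_le hmono hnn hint hT hδ0 (u := x + δ) (by linarith)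
    rw [hTδ, add_sub_cancel_right] at h3
    have hs : 0 < √x := Real.sqrt_pos.2 hx0
    have hs2 : 0 < √(x + δ) := Real.sqrt_pos.2 (by linarith)
    have e2 : J (A ^ 2) (x + δ) * (√(x + δ) / √x) = (A ^ 2 * ∫ v in Ioi (0:ℝ), b v * rexp (-v) *
        rexp (-(v / (x + δ))) * fejer (A ^ 2 * (x + δ - v))) / √x := by
      simp only [hJ]
      field_simp
    rw [e2, le_div_iff₀ hkA, div_mul_eq_mul_div, div_mul_eq_mul_div, div_mul_eq_mul_div,
      div_le_div_iff_of_pos_right hs]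
    have e3 : (x + δ + δ) / (x + δ) = 1 + δ / (x + δ) := by field_simp
    rw [e3] at h3
    have e4 : rexp (-(2 * δ)) * rexp (2 * δ) = 1 := by rw [← Real.exp_add]; simp
    have e5 : rexp (-(1 + δ / (x + δ))) * rexp (1 + δ / (x + δ)) = 1 := by
      rw [← Real.exp_add]; simp
    have h4 := mul_le_mul_of_nonneg_right h3
      (mul_pos (Real.exp_pos (2 * δ)) (Real.exp_pos (1 + δ / (x + δ)))).le
    calc b x * rexp (-x) * k A = b x * rexp (-x) * k A * (rexp (-(2 * δ)) * rexp (2 * δ)) *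
          (rexp (-(1 + δ / (x + δ))) * rexp (1 + δ / (x + δ))) := by rw [e4, e5]; ring
      _ ≤ _ := by
        refine le_trans (le_of_eq ?_) (h4.trans (le_of_eq ?_))
        · simp only [hk]; ring
        · ring
  -- a global bound
  obtain ⟨C₁, C₂, hC₁, hC₂, hb⟩ : ∃ C₁ C₂ : ℝ, 0 ≤ C₁ ∧ 0 ≤ C₂ ∧
      ∀ v, 0 ≤ v → b v * rexp (-v) ≤ C₁ + C₂ * √v := by
    obtain ⟨v₀, hv₀⟩ := eventually_atTop.1 ((hup (c + 1) (by linarith)).and (eventually_gt_atTop 0))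
    refine ⟨b (max v₀ 0), |c + 1|, hnn _ (le_max_right _ _), abs_nonneg _, fun v hv => ?_⟩
    rcases le_total v₀ v with h | h
    · obtain ⟨h1, h2⟩ := hv₀ v h
      rw [div_le_iff₀ (Real.sqrt_pos.2 h2)] at h1
      have := hnn (max v₀ 0) (le_max_right _ _)
      have h3 := le_abs_self (c + 1)
      nlinarith [Real.sqrt_nonneg v]
    · have h1 : b v ≤ b (max v₀ 0) := hmono hv (le_max_right v₀ 0) (h.trans (le_max_left _ _))
      have h2 : rexp (-v) ≤ 1 := Real.exp_le_one_iff.2 (by linarith)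
      have h3 : b v * rexp (-v) ≤ b v := mul_le_of_le_one_right (hnn v hv) h2
      have : 0 ≤ |c + 1| * √v := by positivity
      linarith
  -- the lower bound
  have hlow : ∀ c', c' < c → ∀ᶠ x in atTop, c' ≤ b x * rexp (-x) / √x := by
    intro c' hc'
    have h1 : Tendsto (fun A : ℝ => (c * (rexp (-1) * I₀) - C₂ * (I₀ - k A)) *
        rexp (-(2 * (1 / A))) * rexp 1 / k A) atTop
        (nhds ((c * (rexp (-1) * I₀) - C₂ * (I₀ - I₀)) * rexp (-(2 * 0)) * rexp 1 / I₀)) := by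
      refine Tendsto.div ?_ hklim hI₀pos.ne'
      refine Tendsto.mul_const _ (Tendsto.mul ?_
        ((Real.continuous_exp.tendsto _).comp (hid.const_mul 2).neg))
      exact tendsto_const_nhds.sub ((tendsto_const_nhds.sub hklim).const_mul _)
    have e1 : (c * (rexp (-1) * I₀) - C₂ * (I₀ - I₀)) * rexp (-(2 * 0)) * rexp 1 / I₀ = c := by
      rw [mul_zero, neg_zero, Real.exp_zero, Real.exp_neg]; field_simp; ring
    rw [e1] at h1
    obtain ⟨A, hA1, hA0, hkA⟩ := ((h1.eventually_const_lt hc').and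
      ((eventually_gt_atTop 0).and (hklim.eventually_const_lt hI₀pos))).exists
    set δ := 1 / A with hδ
    have hδ0 : 0 < δ := by positivity
    have hTδ : A ^ 2 * δ = A := by rw [hδ]; field_simp
    have hT : 0 < A ^ 2 := by positivity
    have h2 : Tendsto (fun x => (J (A ^ 2) (x + -δ) - (C₁ / √(x + -δ) + C₂) * (I₀ - k A)) *
        (√(x + -δ) / √x) * rexp (-(2 * δ)) * rexp (1 - δ / (x + -δ)) / k A) atTop
        (nhds ((c * (rexp (-1) * I₀) - (0 + C₂) * (I₀ - k A)) * 1 * rexp (-(2 * δ)) *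
          rexp (1 - 0) / k A)) := by
      have ht : Tendsto (fun x : ℝ => x + -δ) atTop atTop :=
        tendsto_atTop_add_const_right _ _ tendsto_id
      have hs : Tendsto (fun x : ℝ => C₁ / √(x + -δ)) atTop (nhds 0) :=
        Tendsto.const_div_atTop (Real.tendsto_sqrt_atTop.comp ht) C₁
      refine ((((((hJlim _ hT).comp ht).sub ((hs.add_const _).mul_const _)).mul
        (tendsto_sqrt_add_div (-δ))).mul_const _).mul
        ((Real.continuous_exp.tendsto _).comp
          (tendsto_const_nhds.sub (ht.const_div_atTop δ)))).div_const _
    rw [mul_one, sub_zero, zero_add] at h2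
    filter_upwards [h2.eventually_const_lt hA1, eventually_gt_atTop (2 * δ)] with x hx hx0
    refine le_trans hx.le ?_
    have h3 := tauberian_le_window hmono hnn hint hC₁ hC₂ hb hT hδ0 (u := x + -δ) (by linarith)
    rw [hTδ, neg_add_cancel_right] at h3
    have hs : 0 < √x := Real.sqrt_pos.2 (by linarith)
    have hs2 : 0 < √(x + -δ) := Real.sqrt_pos.2 (by linarith)
    have hxδ : 0 < x + -δ := by linarith
    have e2 : (J (A ^ 2) (x + -δ) - (C₁ / √(x + -δ) + C₂) * (I₀ - k A)) * (√(x + -δ) / √x) =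
        ((A ^ 2 * ∫ v in Ioi (0:ℝ), b v * rexp (-v) *
        rexp (-(v / (x + -δ))) * fejer (A ^ 2 * (x + -δ - v))) -
        (C₁ + C₂ * √(x + -δ)) * (I₀ - k A)) / √x := by
      simp only [hJ]
      field_simp
    rw [e2, div_le_iff₀ hkA, div_mul_eq_mul_div, div_mul_eq_mul_div, div_mul_eq_mul_div,
      div_le_div_iff_of_pos_right hs]
    have e3 : (x + -δ - δ) / (x + -δ) = 1 - δ / (x + -δ) := by field_simp
    rw [e3] at h3
    have e4 : rexp (2 * δ) * rexp (-(2 * δ)) = 1 := by rw [← Real.exp_add]; simp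
    have e5 : rexp (-(1 - δ / (x + -δ))) * rexp (1 - δ / (x + -δ)) = 1 := by
      rw [← Real.exp_add]; simp
    have h4 := mul_le_mul_of_nonneg_right (sub_le_iff_le_add.2 h3)
      (mul_pos (Real.exp_pos (-(2 * δ))) (Real.exp_pos (1 - δ / (x + -δ)))).le
    calc _ ≤ _ := le_trans (le_of_eq (by ring)) h4
      _ = b x * rexp (-x) * k A * (rexp (2 * δ) * rexp (-(2 * δ))) *
          (rexp (-(1 - δ / (x + -δ))) * rexp (1 - δ / (x + -δ))) := by simp only [hk]; ring
      _ = _ := by rw [e4, e5]; ring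
  refine tendsto_order.2 ⟨fun a ha => ?_, fun a ha => ?_⟩
  · obtain ⟨d, h1, h2⟩ := exists_between ha
    filter_upwards [hlow d h2] with x hx using lt_of_lt_of_le h1 hx
  · obtain ⟨d, h1, h2⟩ := exists_between ha
    filter_upwards [hup d h1] with x hx using lt_of_le_of_lt hx h2

end TauberianTheorem

section LaplaceSqrt
open MeasureTheory Set

lemma norm_cexp_neg_mul_ofReal (z : ℂ) (v : ℝ) :
    ‖Complex.exp (-(z * v))‖ = rexp (-(z.re * v)) := by
  rw [Complex.norm_exp]; simp

lemma laplace_inv_sqrt {z : ℂ} (hz : 0 < z.re) :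
    ∫ v in Ioi (0:ℝ), ((1 / √v : ℝ) : ℂ) * Complex.exp (-(z * v)) = (π / z) ^ (1 / 2 : ℂ) := by
  have h := integral_gaussian_complex_Ioi hz
  have h2 := integral_comp_rpow_Ioi (fun v : ℝ => ((1 / √v : ℝ) : ℂ) * Complex.exp (-(z * v)))
    (p := 2) (by norm_num)
  rw [← h2]
  have : ∀ x ∈ Ioi (0:ℝ), (|(2:ℝ)| * x ^ ((2:ℝ) - 1)) • (((1 / √(x ^ (2:ℝ)) : ℝ) : ℂ) *
      Complex.exp (-(z * ((x ^ (2:ℝ) : ℝ) : ℂ)))) = 2 * Complex.exp (-z * x ^ 2) := by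
    intro x hx
    have hx : 0 < x := hx
    have e1 : x ^ ((2:ℝ) - 1) = x := by norm_num
    rw [e1, Real.rpow_two, Real.sqrt_sq hx.le, Complex.real_smul, abs_of_pos two_pos]
    have : (x : ℂ) ≠ 0 := by exact_mod_cast hx.ne'
    push_cast
    field_simp
  rw [setIntegral_congr_fun measurableSet_Ioi this, integral_const_mul, h]
  ring

lemma integrableOn_sqrt_mul_cexp {z : ℂ} (hz : 0 < z.re) :
    IntegrableOn (fun v : ℝ => ((√v : ℝ) : ℂ) * Complex.exp (-(z * v))) (Ioi 0) := by
  refine (integrableOn_sqrt_mul_exp hz).mono' (Continuous.aestronglyMeasurable (by fun_prop))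
    (ae_of_all _ fun v => ?_)
  rw [norm_mul, norm_cexp_neg_mul_ofReal, Complex.norm_real, Real.norm_of_nonneg (Real.sqrt_nonneg _)]

lemma integrableOn_inv_sqrt_mul_exp {σ : ℝ} (hσ : 0 < σ) :
    IntegrableOn (fun v => (1 / √v) * rexp (-(σ * v))) (Ioi 0) := by
  have h := Real.GammaIntegral_convergent (s := 1 / 2) (by norm_num)
  have h2 := (integrableOn_Ioi_comp_mul_left_iff (fun x : ℝ => rexp (-x) * x ^ ((1:ℝ) / 2 - 1)) 0
    hσ).2 (by simpa using h)
  have h3 : IntegrableOn (fun v => √σ * (rexp (-(σ * v)) * (σ * v) ^ ((1:ℝ) / 2 - 1))) (Ioi 0) :=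
    h2.const_mul _
  refine h3.congr_fun (fun v hv => ?_) measurableSet_Ioi
  have hv : 0 < v := hv
  have : ((1:ℝ) / 2 - 1) = -(1 / 2) := by norm_num
  simp only
  rw [this, Real.rpow_neg (by positivity), ← Real.sqrt_eq_rpow, Real.sqrt_mul hσ.le]
  have : √σ ≠ 0 := (Real.sqrt_pos.2 hσ).ne'
  have : √v ≠ 0 := (Real.sqrt_pos.2 hv).ne'
  field_simp

lemma integrableOn_inv_sqrt_mul_cexp {z : ℂ} (hz : 0 < z.re) :
    IntegrableOn (fun v : ℝ => ((1 / √v : ℝ) : ℂ) * Complex.exp (-(z * v))) (Ioi 0) := by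
  refine (integrableOn_inv_sqrt_mul_exp hz).mono' (Measurable.aestronglyMeasurable (by fun_prop))
    (ae_of_all _ fun v => ?_)
  rw [norm_mul, norm_cexp_neg_mul_ofReal, Complex.norm_real, Real.norm_of_nonneg (by positivity)]

lemma laplace_sqrt {z : ℂ} (hz : 0 < z.re) :
    ∫ v in Ioi (0:ℝ), ((√v : ℝ) : ℂ) * Complex.exp (-(z * v)) =
      (√π / 2 : ℝ) * z ^ (-(3 / 2) : ℂ) := by
  have hz0 : z ≠ 0 := by rintro rfl; simp at hz
  have hd : ∀ v ∈ Ioi (0:ℝ), HasDerivAt (fun v : ℝ => ((√v : ℝ) : ℂ) * Complex.exp (-(z * v)))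
      ((1 / 2) * (((1 / √v : ℝ) : ℂ) * Complex.exp (-(z * v))) -
        z * (((√v : ℝ) : ℂ) * Complex.exp (-(z * v)))) v := by
    intro v hv
    have h1 := (Real.hasDerivAt_sqrt (ne_of_gt hv)).ofReal_comp
    have h2 : HasDerivAt (fun v : ℝ => Complex.exp (-(z * v))) (Complex.exp (-(z * v)) * -(z * 1)) v :=
      ((Complex.ofRealCLM.hasDerivAt (x := v)).const_mul z).neg.cexp
    refine (h1.mul h2).congr_deriv ?_
    push_cast
    ring
  have hi := ((integrableOn_inv_sqrt_mul_cexp hz).const_mul (1 / 2)).sub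
    ((integrableOn_sqrt_mul_cexp hz).const_mul z)
  have hlim : Tendsto (fun v : ℝ => ((√v : ℝ) : ℂ) * Complex.exp (-(z * v))) atTop (nhds 0) := by
    rw [tendsto_zero_iff_norm_tendsto_zero]
    have h0 := tendsto_rpow_mul_exp_neg_mul_atTop_nhds_zero (1 / 2) z.re hz
    refine h0.congr fun v => ?_
    rw [norm_mul, norm_cexp_neg_mul_ofReal, Complex.norm_real,
      Real.norm_of_nonneg (Real.sqrt_nonneg _), Real.sqrt_eq_rpow]
    ring_nf
  have h := integral_Ioi_of_hasDerivAt_of_tendsto (a := 0)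
    (Continuous.continuousWithinAt (by fun_prop)) hd hi hlim
  rw [integral_sub ((integrableOn_inv_sqrt_mul_cexp hz).const_mul (1 / 2))
    ((integrableOn_sqrt_mul_cexp hz).const_mul z), integral_const_mul, integral_const_mul,
    laplace_inv_sqrt hz] at h
  simp only [Real.sqrt_zero, Complex.ofReal_zero, zero_mul, sub_zero] at h
  have harg : z.arg ≠ π := by
    intro hh
    rw [Complex.arg_eq_pi_iff] at hh
    linarith [hh.1]
  have e1 : ((π : ℂ) / z) ^ (1 / 2 : ℂ) = (√π : ℝ) * z ^ (-(1 / 2) : ℂ) := by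
    rw [div_eq_mul_inv, Complex.cpow_neg, ← Complex.inv_cpow _ _ harg, Real.sqrt_eq_rpow,
      Complex.ofReal_cpow Real.pi_pos.le]
    have hp : (π : ℂ) ≠ 0 := by exact_mod_cast Real.pi_pos.ne'
    have hz1 : z⁻¹ ≠ 0 := inv_ne_zero hz0
    rw [Complex.cpow_def_of_ne_zero (mul_ne_zero hp hz1), Complex.cpow_def_of_ne_zero hp,
      Complex.cpow_def_of_ne_zero hz1, Complex.log_ofReal_mul Real.pi_pos hz1,
      Complex.ofReal_log Real.pi_pos.le, ← Complex.exp_add]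
    congr 1
    push_cast
    ring
  have e2 : z ^ (-(1 / 2) : ℂ) = z * z ^ (-(3 / 2) : ℂ) := by
    conv_rhs => enter [1]; rw [← Complex.cpow_one z]
    rw [← Complex.cpow_add _ _ hz0]
    norm_num
  rw [e1, e2] at h
  have : z * (∫ v in Ioi (0:ℝ), ((√v : ℝ) : ℂ) * Complex.exp (-(z * v))) =
      z * ((√π / 2 : ℝ) * z ^ (-(3 / 2) : ℂ)) := by
    push_cast
    linear_combination -h
  exact mul_left_cancel₀ hz0 this

end LaplaceSqrt

section MildSingularity
open MeasureTheory Set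

/-- `R`, defined on `Re s > 1`, is `O(|s - s₀|^(-1/2))` near the boundary point `s₀`. -/
def MildAt (R : ℂ → ℂ) (s₀ : ℂ) : Prop :=
  ∃ C : ℝ, ∀ᶠ s in nhdsWithin s₀ {s : ℂ | 1 < s.re}, ‖R s‖ ≤ C / √‖s - s₀‖

lemma MildAt.add {R S : ℂ → ℂ} {s₀ : ℂ} (hR : MildAt R s₀) (hS : MildAt S s₀) :
    MildAt (fun s => R s + S s) s₀ := by
  obtain ⟨C, hC⟩ := hR
  obtain ⟨D, hD⟩ := hS
  refine ⟨C + D, ?_⟩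
  filter_upwards [hC, hD] with s h1 h2
  rw [add_div]
  exact (norm_add_le _ _).trans (add_le_add h1 h2)

lemma MildAt.mul_continuousAt {R f : ℂ → ℂ} {s₀ : ℂ} (hR : MildAt R s₀) (hf : ContinuousAt f s₀) :
    MildAt (fun s => f s * R s) s₀ := by
  obtain ⟨C, hC⟩ := hR
  refine ⟨(‖f s₀‖ + 1) * C, ?_⟩
  have : ∀ᶠ s in nhds s₀, ‖f s‖ < ‖f s₀‖ + 1 := hf.norm.eventually_lt_const (by linarith)
  filter_upwards [hC, nhdsWithin_le_nhds this] with s h1 h2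
  rw [norm_mul, mul_div_assoc]
  exact mul_le_mul h2.le h1 (norm_nonneg _) (by positivity)

lemma MildAt.const_mul {R : ℂ → ℂ} {s₀ : ℂ} (hR : MildAt R s₀) (c : ℂ) :
    MildAt (fun s => c * R s) s₀ := hR.mul_continuousAt continuousAt_const

lemma MildAt.of_continuousAt {f : ℂ → ℂ} {s₀ : ℂ} (hf : ContinuousAt f s₀) (h₀ : s₀.re ≤ 1) :
    MildAt f s₀ := by
  refine ⟨‖f s₀‖ + 1, ?_⟩
  have h1 : ∀ᶠ s in nhds s₀, ‖f s‖ < ‖f s₀‖ + 1 := hf.norm.eventually_lt_const (by linarith)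
  have h2 : ∀ᶠ s in nhds s₀, ‖s - s₀‖ < 1 := by
    have : ContinuousAt (fun s => ‖s - s₀‖) s₀ := by fun_prop
    exact this.eventually_lt_const (by simp)
  filter_upwards [nhdsWithin_le_nhds h1, nhdsWithin_le_nhds h2, self_mem_nhdsWithin] with s h1 h2 h3
  have hpos : 0 < ‖s - s₀‖ := by
    rw [norm_pos_iff, sub_ne_zero]
    rintro rfl
    have : 1 < s.re := h3
    linarith
  rw [le_div_iff₀ (Real.sqrt_pos.2 hpos)]
  have : √‖s - s₀‖ ≤ 1 := Real.sqrt_le_one.2 h2.le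
  nlinarith [norm_nonneg (f s), Real.sqrt_nonneg ‖s - s₀‖]

lemma MildAt.congr {R S : ℂ → ℂ} {s₀ : ℂ} (hR : MildAt R s₀) (h : ∀ s : ℂ, 1 < s.re → S s = R s) :
    MildAt S s₀ := by
  obtain ⟨C, hC⟩ := hR
  refine ⟨C, ?_⟩
  filter_upwards [hC, self_mem_nhdsWithin] with s h1 h2
  rw [h s h2]; exact h1

lemma lintegral_inv_sqrt_abs_lt_top (t₀ ε C : ℝ) :
    ∫⁻ t in Ioo (t₀ - ε) (t₀ + ε), ENNReal.ofReal (C / √|t - t₀|) < ⊤ := by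
  have h1 : IntegrableOn (fun t : ℝ => C / √|t|) (Ioo 0 ε) := by
    have := (intervalIntegral.intervalIntegrable_rpow' (a := 0) (b := ε) (r := -(1 / 2))
      (by norm_num)).1
    have h3 := ((this.mono_set Ioo_subset_Ioc_self).const_mul C)
    refine IntegrableOn.congr_fun h3 (fun t ht => ?_) measurableSet_Ioo
    rw [abs_of_pos ht.1, Real.sqrt_eq_rpow, Real.rpow_neg ht.1.le, ← div_eq_mul_inv]
  have h2 : IntegrableOn (fun t : ℝ => C / √|t|) (Ioo (-ε) 0) := by
    have := h1.comp_neg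
    simpa using this
  have h3 : IntegrableOn (fun t : ℝ => C / √|t|) (Ioo (-ε) ε) := by
    have := (h2.union h1).union (integrableOn_singleton (x := (0:ℝ)) (by simp) (by simp))
    refine this.mono_set fun t ht => ?_
    rcases lt_trichotomy t 0 with h | h | h
    · exact Or.inl (Or.inl ⟨ht.1, h⟩)
    · exact Or.inr h
    · exact Or.inl (Or.inr ⟨h, ht.2⟩)
  have h4 : IntegrableOn (fun t : ℝ => C / √|t - t₀|) (Ioo (t₀ - ε) (t₀ + ε)) := by
    have h5 := (measurePreserving_sub_right volume t₀).integrableOn_comp_preimage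
      (measurableEmbedding_subRight t₀) (f := fun t : ℝ => C / √|t|) (s := Ioo (-ε) ε)
    have h6 := h5.2 h3
    have : (fun x => x - t₀) ⁻¹' Ioo (-ε) ε = Ioo (t₀ - ε) (t₀ + ε) := by
      rw [Set.preimage_sub_const_Ioo]; congr 1 <;> ring
    rw [this] at h6
    exact h6
  refine lt_of_le_of_lt (lintegral_mono fun t => ?_) h4.2
  exact Real.ofReal_le_enorm _

lemma exists_bound_of_mildAt {R : ℂ → ℂ} (hR : ∀ s₀ : ℂ, s₀.re = 1 → MildAt R s₀) (T : ℝ) :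
    ∃ C : ℝ, 0 ≤ C ∧ ∀ᶠ σ : ℝ in nhdsWithin 1 (Ioi 1), ∫⁻ t in Icc (-T) T,
      ‖R (σ + t * Complex.I)‖ₑ ≤ ENNReal.ofReal C := by
  refine isCompact_Icc.induction_on (s := Icc (-T) T) (p := fun S => ∃ C : ℝ, 0 ≤ C ∧
    ∀ᶠ σ : ℝ in nhdsWithin 1 (Ioi 1), ∫⁻ t in S,
      ‖R (σ + t * Complex.I)‖ₑ ≤ ENNReal.ofReal C) ?_ ?_ ?_ ?_
  · exact ⟨0, le_rfl, by simp⟩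
  · rintro S S' hS ⟨C, hC, h⟩
    exact ⟨C, hC, h.mono fun σ hσ => (lintegral_mono_set hS).trans hσ⟩
  · rintro S S' ⟨C, hC, h⟩ ⟨C', hC', h'⟩
    refine ⟨C + C', by positivity, ?_⟩
    filter_upwards [h, h'] with σ h1 h2
    rw [ENNReal.ofReal_add hC hC']
    exact (lintegral_union_le _ _ _).trans (add_le_add h1 h2)
  · intro t₀ _
    obtain ⟨C, hC⟩ := hR (1 + t₀ * Complex.I) (by simp)
    rw [eventually_nhdsWithin_iff, Metric.eventually_nhds_iff] at hC
    obtain ⟨ε, hε, hC⟩ := hC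
    have hfin := lintegral_inv_sqrt_abs_lt_top t₀ (ε / 2) |C|
    refine ⟨Ioo (t₀ - ε / 2) (t₀ + ε / 2), mem_nhdsWithin_of_mem_nhds
      (Ioo_mem_nhds (by linarith) (by linarith)), _, ENNReal.toReal_nonneg
      (a := ∫⁻ t in Ioo (t₀ - ε / 2) (t₀ + ε / 2), ENNReal.ofReal (|C| / √|t - t₀|)), ?_⟩
    rw [ENNReal.ofReal_toReal hfin.ne]
    have : Ioo (1:ℝ) (1 + ε / 2) ∈ nhdsWithin 1 (Ioi 1) := Ioo_mem_nhdsGT (by linarith)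
    filter_upwards [this] with σ hσ
    refine lintegral_mono_ae ?_
    have hne : ∀ᵐ t : ℝ, t ≠ t₀ := by simp [ae_iff, measure_singleton]
    filter_upwards [ae_restrict_mem measurableSet_Ioo, ae_restrict_of_ae hne] with t ht htne
    rw [← ofReal_norm]
    refine ENNReal.ofReal_le_ofReal ?_
    have e1 : (σ + t * Complex.I) - (1 + t₀ * Complex.I) =
        ((σ - 1 : ℝ) : ℂ) + ((t - t₀ : ℝ) : ℂ) * Complex.I := by push_cast; ring
    have e2 : ‖(σ + t * Complex.I) - (1 + t₀ * Complex.I)‖ < ε := by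
      rw [e1]
      refine lt_of_le_of_lt (norm_add_le _ _) ?_
      rw [norm_mul, Complex.norm_I, mul_one, Complex.norm_real, Complex.norm_real,
        Real.norm_of_nonneg (by linarith [hσ.1]), Real.norm_eq_abs]
      have : |t - t₀| < ε / 2 := abs_lt.2 ⟨by linarith [ht.1], by linarith [ht.2]⟩
      linarith [hσ.2]
    have h := hC (y := σ + t * Complex.I) (by rw [dist_eq_norm]; exact e2) (by simpa using hσ.1)
    have e3 : |t - t₀| ≤ ‖(σ + t * Complex.I) - (1 + t₀ * Complex.I)‖ := by
      have := Complex.abs_im_le_norm ((σ + t * Complex.I) - (1 + t₀ * Complex.I))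
      simpa using this
    have e4 : 0 < |t - t₀| := abs_pos.2 (sub_ne_zero.2 htne)
    refine h.trans ?_
    refine (div_le_div_of_nonneg_right (le_abs_self C) (Real.sqrt_nonneg _)).trans ?_
    exact div_le_div_of_nonneg_left (abs_nonneg _) (Real.sqrt_pos.2 e4) (Real.sqrt_le_sqrt e3)

end MildSingularity

section CountAsymptotic
open MeasureTheory Set

variable {a : ℕ → ℝ}

/-- The summatory function of `a n * log n` in logarithmic scale. -/
noncomputable def logSummatory (a : ℕ → ℝ) (v : ℝ) : ℝ :=
  ∑ n ∈ Finset.Icc 1 ⌊rexp v⌋₊, a n * Real.log n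

lemma log_nonneg_of_mem {n N : ℕ} (hn : n ∈ Finset.Icc 1 N) : 0 ≤ Real.log n :=
  Real.log_nonneg (by exact_mod_cast (Finset.mem_Icc.1 hn).1)

lemma logSummatory_nonneg (h0 : ∀ n, 0 ≤ a n) (v : ℝ) : 0 ≤ logSummatory a v :=
  Finset.sum_nonneg fun n hn => mul_nonneg (h0 n) (log_nonneg_of_mem hn)

lemma logSummatory_mono (h0 : ∀ n, 0 ≤ a n) : Monotone (logSummatory a) := by
  intro v w hvw
  refine Finset.sum_le_sum_of_subset_of_nonneg ?_ fun n hn _ =>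
    mul_nonneg (h0 n) (log_nonneg_of_mem hn)
  exact Finset.Icc_subset_Icc le_rfl (Nat.floor_mono (Real.exp_le_exp.2 hvw))

lemma logSummatory_le (h1 : ∀ n, a n ≤ 1) {v : ℝ} (hv : 0 ≤ v) :
    logSummatory a v ≤ v * rexp v := by
  have : ∀ n ∈ Finset.Icc 1 ⌊rexp v⌋₊, a n * Real.log n ≤ v := by
    intro n hn
    have hl := log_nonneg_of_mem hn
    obtain ⟨hn1, hn2⟩ := Finset.mem_Icc.1 hn
    have hn0 : (0:ℝ) < n := by exact_mod_cast hn1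
    have : Real.log n ≤ v := by
      rw [Real.log_le_iff_le_exp hn0]
      exact (Nat.le_floor_iff (Real.exp_pos v).le).1 hn2
    nlinarith [h1 n]
  refine (Finset.sum_le_card_nsmul _ _ _ this).trans ?_
  rw [nsmul_eq_mul, mul_comm]
  refine mul_le_mul_of_nonneg_left ?_ hv
  simpa using Nat.floor_le (Real.exp_pos v).le

lemma logSummatory_integrable (h0 : ∀ n, 0 ≤ a n) (h1 : ∀ n, a n ≤ 1) {σ : ℝ} (hσ : 1 < σ) :
    IntegrableOn (fun v => logSummatory a v * rexp (-(σ * v))) (Ioi 0) := by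
  have h := Real.GammaIntegral_convergent (s := 2) (by norm_num)
  have h2 := (integrableOn_Ioi_comp_mul_left_iff (fun x : ℝ => rexp (-x) * x ^ ((2:ℝ) - 1)) 0
    (sub_pos.2 hσ)).2 (by simpa using h)
  have h3 := h2.const_mul (1 / (σ - 1))
  refine Integrable.mono' h3 ?_ ?_
  · exact ((logSummatory_mono h0).measurable.mul (by fun_prop)).aestronglyMeasurable
  · refine (ae_restrict_iff' measurableSet_Ioi).2 (ae_of_all _ fun v hv => ?_)
    have hv : 0 < v := hv
    rw [Real.norm_of_nonneg (mul_nonneg (logSummatory_nonneg h0 v) (Real.exp_pos _).le)]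
    have e1 : ((2:ℝ) - 1) = 1 := by norm_num
    rw [e1, Real.rpow_one]
    have e2 : 1 / (σ - 1) * (rexp (-((σ - 1) * v)) * ((σ - 1) * v)) = v * rexp v * rexp (-(σ * v)) := by
      rw [mul_assoc v, ← Real.exp_add]
      have : σ - 1 ≠ 0 := by linarith
      have e3 : v + -(σ * v) = -((σ - 1) * v) := by ring
      rw [e3]
      field_simp
    rw [e2]
    exact mul_le_mul_of_nonneg_right (logSummatory_le h1 hv.le) (Real.exp_pos _).le

lemma lseries_log_eq (h0 : ∀ n, 0 ≤ a n) (h1 : ∀ n, a n ≤ 1) {s : ℂ} (hs : 1 < s.re) :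
    LSeries (fun n => ((a n * Real.log n : ℝ) : ℂ)) s =
      s * ∫ v in Ioi (0:ℝ), (logSummatory a v : ℂ) * Complex.exp (-(s * v)) := by
  obtain ⟨r, hr1, hr2⟩ := exists_between hs
  rw [LSeries_eq_mul_integral_of_nonneg (fun n => a n * Real.log n) (r := r) (by linarith) hr2 ?_ ?_]
  · congr 1
    have himg : Real.exp '' Ioi 0 = Ioi 1 := by
      ext x
      constructor
      · rintro ⟨y, hy, rfl⟩
        exact Real.one_lt_exp_iff.2 hy
      · intro hx
        have hx : 1 < x := hx
        exact ⟨Real.log x, Real.log_pos hx, Real.exp_log (by linarith)⟩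
    rw [← himg, integral_image_eq_integral_abs_deriv_smul (f' := Real.exp) measurableSet_Ioi
      (fun x _ => (Real.hasDerivAt_exp x).hasDerivWithinAt) Real.exp_injective.injOn]
    refine setIntegral_congr_fun measurableSet_Ioi fun v _ => ?_
    rw [abs_of_pos (Real.exp_pos v), Complex.real_smul, logSummatory]
    have hne : ((rexp v : ℝ) : ℂ) ≠ 0 := by exact_mod_cast (Real.exp_pos v).ne'
    have e1 : ((rexp v : ℝ) : ℂ) ^ (-(s + 1)) = Complex.exp (-(s * v)) * Complex.exp (-v) := by
      rw [Complex.cpow_def_of_ne_zero hne, ← Complex.ofReal_log (Real.exp_pos v).le, Real.log_exp,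
        ← Complex.exp_add]
      congr 1; ring
    have e2 : ((rexp v : ℝ) : ℂ) * Complex.exp (-v) = 1 := by
      rw [Complex.ofReal_exp, ← Complex.exp_add]; simp
    rw [e1]
    push_cast at e2 ⊢
    linear_combination ((∑ n ∈ Finset.Icc 1 ⌊rexp v⌋₊, (a n : ℂ) * Complex.log n) *
      Complex.exp (-(s * v))) * e2
  · have hlog : (fun n : ℕ => Real.log n) =O[atTop] fun n : ℕ => (n:ℝ) ^ (r - 1) :=
      ((isLittleO_log_rpow_atTop (sub_pos.2 hr1)).comp_tendsto tendsto_natCast_atTop_atTop).isBigO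
    have hmul := (Asymptotics.isBigO_refl (fun n : ℕ => (n:ℝ)) atTop).mul hlog
    have : (fun n : ℕ => ∑ k ∈ Finset.Icc 1 n, a k * Real.log k) =O[atTop]
        fun n : ℕ => (n:ℝ) * Real.log n := by
      refine Asymptotics.IsBigO.of_bound 1 (Eventually.of_forall fun n => ?_)
      rw [one_mul, Real.norm_of_nonneg (Finset.sum_nonneg fun n hn =>
        mul_nonneg (h0 n) (log_nonneg_of_mem hn))]
      refine le_trans ?_ (le_abs_self _)
      have : ∀ k ∈ Finset.Icc 1 n, a k * Real.log k ≤ Real.log n := by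
        intro k hk
        have hl := log_nonneg_of_mem hk
        obtain ⟨hn1, hn2⟩ := Finset.mem_Icc.1 hk
        have : Real.log k ≤ Real.log n :=
          Real.log_le_log (by exact_mod_cast hn1) (by exact_mod_cast hn2)
        nlinarith [h1 k]
      refine (Finset.sum_le_card_nsmul _ _ _ this).trans ?_
      simp
    refine this.trans (hmul.congr' EventuallyEq.rfl ?_)
    filter_upwards [eventually_gt_atTop 0] with n hn
    have : (0:ℝ) < n := by exact_mod_cast hn
    rw [Real.rpow_sub_one this.ne']
    field_simp
  · intro n
    rcases Nat.eq_zero_or_pos n with rfl | hn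
    · simp
    · exact mul_nonneg (h0 n) (Real.log_nonneg (by exact_mod_cast hn))

lemma sum_log_div_le {x : ℝ} (hx : 1 ≤ x) (h0 : ∀ n, 0 ≤ a n) (h1 : ∀ n, a n ≤ 1) :
    (∑ n ∈ Finset.Icc 1 ⌊x⌋₊, a n) * Real.log x - ∑ n ∈ Finset.Icc 1 ⌊x⌋₊, a n * Real.log n ∈
      Icc 0 x := by
  rw [Finset.sum_mul, ← Finset.sum_sub_distrib]
  have hle : ∀ n ∈ Finset.Icc 1 ⌊x⌋₊, Real.log n ≤ Real.log x := by
    intro n hn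
    obtain ⟨hn1, hn2⟩ := Finset.mem_Icc.1 hn
    exact Real.log_le_log (by exact_mod_cast hn1) ((Nat.le_floor_iff (by linarith)).1 hn2)
  constructor
  · refine Finset.sum_nonneg fun n hn => ?_
    rw [← mul_sub]
    exact mul_nonneg (h0 n) (sub_nonneg.2 (hle n hn))
  · have h2 : ∑ n ∈ Finset.Icc 1 ⌊x⌋₊, (a n * Real.log x - a n * Real.log n) ≤
        ∑ n ∈ Finset.Icc 1 ⌊x⌋₊, (Real.log x - Real.log n) := by
      refine Finset.sum_le_sum fun n hn => ?_
      have := hle n hn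
      nlinarith [h0 n, h1 n]
    refine h2.trans ?_
    set N := ⌊x⌋₊ with hN
    have hN1 : 1 ≤ N := Nat.le_floor (by simpa using hx)
    have hN0 : (0:ℝ) < N := by exact_mod_cast hN1
    have hfac : ∀ M : ℕ, ∑ n ∈ Finset.Icc 1 M, Real.log n = Real.log (M.factorial) := by
      intro M
      induction M with
      | zero => simp
      | succ k ih =>
        rw [Finset.sum_Icc_succ_top (by omega), ih, Nat.factorial_succ, Nat.cast_mul, mul_comm,
          Real.log_mul (by positivity) (by positivity)]
    rw [Finset.sum_sub_distrib, hfac, Finset.sum_const, nsmul_eq_mul]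
    simp only [Nat.card_Icc, Nat.add_sub_cancel]
    have e1 := Real.pow_div_factorial_le_exp (N:ℝ) hN0.le N
    have e2 : (N:ℝ) * Real.log N - Real.log (N.factorial) ≤ N := by
      have hpos : 0 < (N:ℝ) ^ N / N.factorial := by positivity
      have := Real.log_le_log hpos e1
      rw [Real.log_exp, Real.log_div (by positivity) (by positivity), Real.log_pow] at this
      exact this
    have e3 : Real.log x - Real.log N ≤ x / N - 1 := by
      rw [← Real.log_div (by linarith) hN0.ne']
      exact Real.log_le_sub_one_of_pos (by positivity)
    have e4 := mul_le_mul_of_nonneg_left e3 hN0.le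
    have e5 : (N:ℝ) * (x / N - 1) = x - N := by field_simp
    linarith

lemma im_eq_zero_of_mildAt {P : ℂ → ℂ} {κ : ℂ} (hP : ∀ σ : ℝ, 1 < σ → (P σ).im = 0)
    (h : MildAt (fun s => P s - κ * (s - 1) ^ (-(3 / 2) : ℂ)) 1) : κ.im = 0 := by
  obtain ⟨C, hC⟩ := h
  have ht : Tendsto (fun σ : ℝ => (σ : ℂ)) (nhdsWithin 1 (Ioi 1)) (nhdsWithin 1 {s : ℂ | 1 < s.re}) := by
    refine tendsto_nhdsWithin_iff.2 ⟨?_, ?_⟩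
    · exact (Complex.continuous_ofReal.tendsto' 1 1 (by simp)).mono_left nhdsWithin_le_nhds
    · filter_upwards [self_mem_nhdsWithin] with σ hσ using by simpa using hσ
  have hlim : Tendsto (fun σ : ℝ => C * (σ - 1)) (nhdsWithin 1 (Ioi 1)) (nhds 0) := by
    have : Tendsto (fun σ : ℝ => C * (σ - 1)) (nhds 1) (nhds (C * (1 - 1))) :=
      Continuous.tendsto (by fun_prop) 1
    simpa using this.mono_left nhdsWithin_le_nhds
  have hb : ∀ᶠ σ : ℝ in nhdsWithin 1 (Ioi 1), |κ.im| ≤ C * (σ - 1) := by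
    filter_upwards [ht.eventually hC, self_mem_nhdsWithin] with σ h1 h2
    have h2 : 0 < σ - 1 := sub_pos.2 h2
    have e0 : (σ : ℂ) - 1 = ((σ - 1 : ℝ) : ℂ) := by push_cast; rfl
    have e1 : ((σ : ℂ) - 1) ^ (-(3 / 2) : ℂ) = (((σ - 1) ^ (-(3 / 2) : ℝ) : ℝ) : ℂ) := by
      rw [Complex.ofReal_cpow h2.le]; push_cast; rfl
    rw [e1, e0, Complex.norm_real, Real.norm_of_nonneg h2.le] at h1
    have h3 := (Complex.abs_im_le_norm _).trans h1
    rw [Complex.sub_im, hP σ (by linarith), Complex.im_mul_ofReal, zero_sub, abs_neg, abs_mul,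
      abs_of_pos (Real.rpow_pos_of_pos h2 _)] at h3
    have e2 : (σ - 1) ^ (-(3 / 2) : ℝ) = ((σ - 1) * √(σ - 1))⁻¹ := by
      rw [Real.rpow_neg h2.le]
      congr 1
      rw [Real.sqrt_eq_rpow]
      conv_rhs => enter [1]; rw [← Real.rpow_one (σ - 1)]
      rw [← Real.rpow_add h2]; norm_num
    rw [e2] at h3
    have hs : 0 < √(σ - 1) := Real.sqrt_pos.2 h2
    rw [← div_eq_mul_inv, div_le_div_iff₀ (by positivity) hs] at h3
    have : |κ.im| * √(σ - 1) ≤ (C * (σ - 1)) * √(σ - 1) := by linarith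
    exact le_of_mul_le_mul_right this hs
  have := ge_of_tendsto hlim hb
  exact abs_eq_zero.1 (le_antisymm this (abs_nonneg _))

theorem count_asymptotic (h0 : ∀ n, 0 ≤ a n) (h1 : ∀ n, a n ≤ 1) (κ : ℂ)
    (h : ∀ s₀ : ℂ, s₀.re = 1 → MildAt (fun s => LSeries (fun n => ((a n * Real.log n : ℝ) : ℂ)) s -
      κ * (s - 1) ^ (-(3 / 2) : ℂ)) s₀) :
    ∃ c : ℝ, Tendsto (fun x : ℝ => (∑ n ∈ Finset.Icc 1 ⌊x⌋₊, a n) * √(Real.log x) / x) atTop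
      (nhds c) := by
  set P : ℂ → ℂ := LSeries (fun n => ((a n * Real.log n : ℝ) : ℂ)) with hPdef
  set Q : ℂ → ℂ := fun s => ∫ v in Ioi (0:ℝ), (logSummatory a v : ℂ) * Complex.exp (-(s * v)) with hQ
  have hPQ : ∀ s : ℂ, 1 < s.re → P s = s * Q s := fun s hs => lseries_log_eq h0 h1 hs
  have him : κ.im = 0 := by
    refine im_eq_zero_of_mildAt (P := P) (fun σ hσ => ?_) (h 1 (by simp))
    rw [hPQ σ (by simpa using hσ)]
    have : Q σ = ((∫ v in Ioi (0:ℝ), logSummatory a v * rexp (-(σ * v)) : ℝ) : ℂ) := by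
      rw [← integral_complex_ofReal]
      simp only [hQ]
      push_cast
      rfl
    rw [this, ← Complex.ofReal_mul, Complex.ofReal_im]
  have hκ : κ = (κ.re : ℂ) := by
    apply Complex.ext <;> simp [him]
  set c : ℝ := κ.re * (2 / √π) with hc
  have hsq : (0:ℝ) < √π := Real.sqrt_pos.2 Real.pi_pos
  have hmild : ∀ s₀ : ℂ, s₀.re = 1 →
      MildAt (fun s => Q s - κ * (s - 1) ^ (-(3 / 2) : ℂ)) s₀ := by
    intro s₀ hs₀
    have hs0 : s₀ ≠ 0 := by rintro rfl; simp at hs₀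
    have hinv : ContinuousAt (fun s : ℂ => s⁻¹) s₀ := continuousAt_inv₀ hs0
    have m1 := (h s₀ hs₀).mul_continuousAt hinv
    have m2 : MildAt (fun s => (s⁻¹ - 1) * (s - 1) ^ (-(3 / 2) : ℂ)) s₀ := by
      rcases eq_or_ne s₀ 1 with rfl | hne
      · have hb : ∃ C : ℝ, ∀ᶠ s in nhdsWithin (1:ℂ) {s : ℂ | 1 < s.re},
            ‖(s - 1) * (s - 1) ^ (-(3 / 2) : ℂ)‖ ≤ C / √‖s - 1‖ := by
          refine ⟨1, ?_⟩
          filter_upwards [self_mem_nhdsWithin] with s hs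
          have hs : 1 < s.re := hs
          have hne : s - 1 ≠ 0 := by
            intro h0
            rw [sub_eq_zero] at h0
            rw [h0] at hs; simp at hs
          have hn : 0 < ‖s - 1‖ := norm_pos_iff.2 hne
          have e1 : (s - 1) * (s - 1) ^ (-(3 / 2) : ℂ) = (s - 1) ^ ((-(1 / 2) : ℝ) : ℂ) := by
            conv_lhs => enter [1]; rw [← Complex.cpow_one (s - 1)]
            rw [← Complex.cpow_add _ _ hne]
            congr 1
            push_cast
            norm_num
          rw [e1, Complex.norm_cpow_real, Real.rpow_neg hn.le, Real.sqrt_eq_rpow, one_div,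
            one_div]
        have m3 : MildAt (fun s => (s - 1) * (s - 1) ^ (-(3 / 2) : ℂ)) 1 := hb
        have m4 := m3.mul_continuousAt (f := fun s => -s⁻¹) hinv.neg
        refine m4.congr fun s hs => ?_
        have hs0 : s ≠ 0 := by rintro rfl; simp at hs; linarith
        field_simp
        ring
      · refine MildAt.of_continuousAt ?_ hs₀.le
        refine (hinv.sub continuousAt_const).mul ?_
        refine ContinuousAt.cpow (by fun_prop) continuousAt_const ?_
        rw [Complex.mem_slitPlane_iff]
        right
        intro h0
        apply hne
        apply Complex.ext
        · simpa using hs₀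
        · simpa using h0
    refine (m1.add (m2.const_mul κ)).congr fun s hs => ?_
    have hs0 : s ≠ 0 := by rintro rfl; simp at hs; linarith
    rw [hPQ s hs]
    field_simp
    ring
  have htaub := tauberian (b := logSummatory a) ((logSummatory_mono h0).monotoneOn _)
    (fun v _ => logSummatory_nonneg h0 v) (fun σ hσ => logSummatory_integrable h0 h1 hσ) c ?_
  · have hlog := htaub.comp Real.tendsto_log_atTop
    refine ⟨c, ?_⟩
    have hdiff : Tendsto (fun x : ℝ => (∑ n ∈ Finset.Icc 1 ⌊x⌋₊, a n) * √(Real.log x) / x -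
        logSummatory a (Real.log x) * rexp (-(Real.log x)) / √(Real.log x)) atTop (nhds 0) := by
      have hz : Tendsto (fun x : ℝ => 1 / √(Real.log x)) atTop (nhds 0) :=
        Tendsto.const_div_atTop (Real.tendsto_sqrt_atTop.comp Real.tendsto_log_atTop) 1
      have hkey : ∀ x : ℝ, 1 < x → (∑ n ∈ Finset.Icc 1 ⌊x⌋₊, a n) * √(Real.log x) / x -
          logSummatory a (Real.log x) * rexp (-(Real.log x)) / √(Real.log x) =
          ((∑ n ∈ Finset.Icc 1 ⌊x⌋₊, a n) * Real.log x -
            ∑ n ∈ Finset.Icc 1 ⌊x⌋₊, a n * Real.log n) / (x * √(Real.log x)) := by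
        intro x hx
        have hx0 : 0 < x := by linarith
        have hl := Real.log_pos hx
        have hs := Real.sqrt_pos.2 hl
        rw [logSummatory, Real.exp_neg, Real.exp_log hx0]
        field_simp
        rw [Real.sq_sqrt hl.le]
      refine squeeze_zero_norm' ?_ hz
      filter_upwards [eventually_gt_atTop 1] with x hx
      rw [hkey x hx]
      have hx0 : 0 < x := by linarith
      have hs := Real.sqrt_pos.2 (Real.log_pos hx)
      obtain ⟨b1, b2⟩ := sum_log_div_le hx.le h0 h1
      rw [Real.norm_of_nonneg (by positivity), div_le_div_iff₀ (by positivity) hs]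
      have := mul_le_mul_of_nonneg_right b2 hs.le
      linarith
    simpa using hdiff.add hlog
  · intro T hT
    obtain ⟨C, hC, hb⟩ := exists_bound_of_mildAt hmild T
    refine ⟨C, hC, ?_⟩
    filter_upwards [hb, self_mem_nhdsWithin] with σ h2 h3
    have h3 : 1 < σ := h3
    refine le_trans (le_of_eq ?_) h2
    congr 1
    ext t
    congr 1
    set s : ℂ := σ + t * Complex.I with hs
    have hsre : s.re = σ := by simp [hs]
    have i1 : IntegrableOn (fun v : ℝ => (logSummatory a v : ℂ) * Complex.exp (-(s * v))) (Ioi 0) := by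
      refine (logSummatory_integrable h0 h1 h3).mono' ?_ ?_
      · exact ((Complex.measurable_ofReal.comp (logSummatory_mono h0).measurable).mul
          (by fun_prop)).aestronglyMeasurable
      · refine ae_of_all _ fun v => ?_
        rw [norm_mul, norm_cexp_neg_mul_ofReal, Complex.norm_real,
          Real.norm_of_nonneg (logSummatory_nonneg h0 v), hsre]
    have hz : 0 < (s - 1).re := by simp [hsre]; linarith
    have i2 := (integrableOn_sqrt_mul_cexp hz).const_mul (c : ℂ)
    have e : κ * (s - 1) ^ (-(3 / 2) : ℂ) =
        ∫ v in Ioi (0:ℝ), (c : ℂ) * (((√v : ℝ) : ℂ) * Complex.exp (-((s - 1) * v))) := by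
      rw [integral_const_mul, laplace_sqrt hz, hκ, hc]
      have : (√π : ℂ) ≠ 0 := by exact_mod_cast hsq.ne'
      push_cast
      field_simp
    rw [e]
    simp only [hQ]
    rw [← integral_sub i1 i2]
    refine setIntegral_congr_fun measurableSet_Ioi fun v _ => ?_
    have e1 : Complex.exp (-(s * v)) = Complex.exp (-(σ * v)) * Complex.exp (-(Complex.I * t * v)) := by
      rw [← Complex.exp_add, hs]; ring_nf
    have e2 : Complex.exp (-((s - 1) * v)) = Complex.exp v * (Complex.exp (-(σ * v)) *
        Complex.exp (-(Complex.I * t * v))) := by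
      rw [← Complex.exp_add, ← Complex.exp_add, hs]; ring_nf
    rw [e1, e2]
    push_cast
    ring

end CountAsymptotic

section SquareRootSingularity
open Set

lemma isOpen_one_lt_re : IsOpen {s : ℂ | 1 < s.re} := isOpen_lt continuous_const Complex.continuous_re

lemma one_mem_closure_frequently {s₀ : ℂ} (h0 : s₀.re = 1) {p : ℂ → Prop}
    (h : ∀ᶠ s in nhds s₀, p s) : ∃ s, 1 < s.re ∧ p s := by
  have h1 : Tendsto (fun t : ℝ => s₀ + t) (nhdsWithin 0 (Ioi 0)) (nhds s₀) := by
    have : Tendsto (fun t : ℝ => s₀ + t) (nhds 0) (nhds (s₀ + (0 : ℝ))) :=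
      Continuous.tendsto (by fun_prop) 0
    simp only [Complex.ofReal_zero, add_zero] at this
    exact this.mono_left nhdsWithin_le_nhds
  obtain ⟨t, ht, ht'⟩ := ((h1.eventually h).and self_mem_nhdsWithin).exists
  exact ⟨_, by simp [h0]; exact ht', ht⟩

/-- If `D ^ 2 = g` with `g` analytic at a boundary point, then `D'` has a mild singularity there. -/
lemma mildAt_deriv_of_sq_analytic {D g : ℂ → ℂ} (hD : ∀ s : ℂ, 1 < s.re → DifferentiableAt ℂ D s)
    (hsq : ∀ s : ℂ, 1 < s.re → D s ^ 2 = g s) (hne : ∀ s : ℂ, 1 < s.re → D s ≠ 0) {s₀ : ℂ}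
    (h0 : s₀.re = 1) (hg : AnalyticAt ℂ g s₀) : MildAt (deriv D) s₀ := by
  obtain ⟨n, h, hh, hh0, hgh⟩ := hg.exists_eventuallyEq_pow_smul_nonzero_iff.2 (by
    intro hc
    obtain ⟨s, hs, hs'⟩ := one_mem_closure_frequently h0 hc
    exact hne s hs (by have := hsq s hs; rw [hs'] at this; simpa using this))
  simp only [smul_eq_mul] at hgh
  -- pointwise identity for the derivative
  have hder : ∀ᶠ s in nhdsWithin s₀ {s : ℂ | 1 < s.re},
      2 * D s * deriv D s = n * (s - s₀) ^ (n - 1) * h s + (s - s₀) ^ n * deriv h s := by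
    have e1 := hgh.eventually_nhds
    have e2 := hh.eventually_analyticAt
    filter_upwards [nhdsWithin_le_nhds e1, nhdsWithin_le_nhds e2, self_mem_nhdsWithin] with s h1 h2 h3
    have d1 : HasDerivAt (fun s => D s ^ 2) (2 * D s * deriv D s) s := by
      have := (hD s h3).hasDerivAt.pow 2
      simpa [Pi.pow_def] using this
    have d2 : HasDerivAt (fun s => (s - s₀) ^ n * h s)
        (n * (s - s₀) ^ (n - 1) * h s + (s - s₀) ^ n * deriv h s) s := by
      have := (((hasDerivAt_id s).sub_const s₀).pow n).mul h2.differentiableAt.hasDerivAt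
      simp only [id, mul_one] at this
      exact this
    have e3 : (fun s => D s ^ 2) =ᶠ[nhds s] fun s => (s - s₀) ^ n * h s := by
      filter_upwards [h1, isOpen_one_lt_re.mem_nhds h3] with z hz hz'
      rw [hsq z hz', hz]
    exact (d1.congr_of_eventuallyEq e3.symm).unique d2 |>.symm ▸ rfl
  have key : ∃ q : ℂ → ℂ, ContinuousAt q s₀ ∧ ∀ᶠ s in nhdsWithin s₀ {s : ℂ | 1 < s.re},
      deriv D s ^ 2 * (s - s₀) = q s := by
    have hcd : ContinuousAt (deriv h) s₀ := hh.deriv.continuousAt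
    have hc : ContinuousAt h s₀ := hh.continuousAt
    have hne' : ∀ᶠ s in nhds s₀, h s ≠ 0 := hc.eventually_ne hh0
    rcases n with _ | k
    · refine ⟨fun s => deriv h s ^ 2 * (s - s₀) / (4 * h s), ?_, ?_⟩
      · exact ((hcd.pow 2).mul (by fun_prop)).div (by fun_prop) (by simpa using hh0)
      · filter_upwards [hder, self_mem_nhdsWithin, nhdsWithin_le_nhds hgh, nhdsWithin_le_nhds hne']
          with s h1 h2 h3 h4
        rw [eq_div_iff (by simpa using h4)]
        simp only [CharP.cast_eq_zero, pow_zero, one_mul, zero_mul, zero_add] at h1 h3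
        have h5 := hsq s h2
        rw [h3] at h5
        rw [← h5, ← h1]; ring
    · refine ⟨fun s => (s - s₀) ^ k * ((k + 1) * h s + (s - s₀) * deriv h s) ^ 2 / (4 * h s), ?_, ?_⟩
      · refine ContinuousAt.div ?_ (by fun_prop) (by simpa using hh0)
        exact ContinuousAt.mul (by fun_prop) (((by fun_prop : ContinuousAt
          (fun s => (k + 1) * h s) s₀).add ((by fun_prop : ContinuousAt (fun s => s - s₀) s₀).mul hcd)).pow 2)
      · filter_upwards [hder, self_mem_nhdsWithin, nhdsWithin_le_nhds hgh, nhdsWithin_le_nhds hne']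
          with s h1 h2 h3 h4
        rw [eq_div_iff (by simpa using h4)]
        have h6 : s - s₀ ≠ 0 := by
          intro hc
          rw [sub_eq_zero.1 hc] at h2
          have : 1 < s₀.re := h2
          linarith
        have h5 := hsq s h2
        rw [h3] at h5
        simp only [Nat.add_sub_cancel] at h1
        push_cast at h1
        apply mul_left_cancel₀ (pow_ne_zero k h6)
        calc _ = deriv D s ^ 2 * (4 * ((s - s₀) ^ (k + 1) * h s)) := by ring
          _ = (2 * D s * deriv D s) ^ 2 := by rw [← h5]; ring
          _ = _ := by rw [h1]; ring
  obtain ⟨q, hq, hq'⟩ := key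
  refine ⟨√(‖q s₀‖ + 1), ?_⟩
  have h1 : ∀ᶠ s in nhds s₀, ‖q s‖ < ‖q s₀‖ + 1 := hq.norm.eventually_lt_const (by linarith)
  filter_upwards [nhdsWithin_le_nhds h1, hq', self_mem_nhdsWithin] with s h1 h2 h3
  have hpos : 0 < ‖s - s₀‖ := by
    rw [norm_pos_iff, sub_ne_zero]
    rintro rfl
    have : 1 < s.re := h3
    linarith
  rw [le_div_iff₀ (Real.sqrt_pos.2 hpos)]
  apply Real.le_sqrt_of_sq_le
  rw [mul_pow, Real.sq_sqrt hpos.le, ← norm_pow, ← norm_mul, h2]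
  exact h1.le

lemma mildAt_cpow_neg_half : MildAt (fun s => (s - 1) ^ (-(1 / 2) : ℂ)) 1 := by
  refine ⟨1, ?_⟩
  filter_upwards [self_mem_nhdsWithin] with s hs
  have hs : 1 < s.re := hs
  have hpos : s - 1 ≠ 0 := by
    rw [sub_ne_zero]; rintro rfl; simp at hs
  have : (-(1 / 2) : ℂ) = ((-(1 / 2) : ℝ) : ℂ) := by push_cast; rfl
  rw [this, Complex.norm_cpow_real, Real.rpow_neg (norm_nonneg _), ← Real.sqrt_eq_rpow, one_div]

/-- The derivative of a square root of a function with a simple pole at `1`. -/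
lemma mildAt_deriv_of_sq_pole {D G : ℂ → ℂ} (hD : ∀ s : ℂ, 1 < s.re → DifferentiableAt ℂ D s)
    (hsq : ∀ s : ℂ, 1 < s.re → D s ^ 2 = G s / (s - 1)) (hG : AnalyticAt ℂ G 1) (hG1 : G 1 ≠ 0) :
    ∃ κ : ℂ, MildAt (fun s => -deriv D s - κ * (s - 1) ^ (-(3 / 2) : ℂ)) 1 := by
  obtain ⟨r0, hr0⟩ : ∃ r0 : ℂ, r0 ^ 2 = G 1 := IsAlgClosed.exists_pow_nat_eq _ (by norm_num)
  set r : ℂ → ℂ := fun s => r0 * (G s / G 1) ^ (1 / 2 : ℂ) with hr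
  have hra : AnalyticAt ℂ r 1 := by
    refine analyticAt_const.mul (AnalyticAt.cpow (hG.div analyticAt_const hG1) analyticAt_const ?_)
    simp [hG1]
  have hr2 : ∀ s, r s ^ 2 = G s := by
    intro s
    simp only [hr, mul_pow, hr0]
    rw [← Complex.cpow_nat_mul]
    norm_num
    field_simp
  have hrne : ∀ᶠ s in nhds (1 : ℂ), r s ≠ 0 := by
    filter_upwards [hG.continuousAt.eventually_ne hG1] with s hs h
    exact hs (by rw [← hr2 s, h]; simp)
  obtain ⟨δ, hδ, hball⟩ := Metric.eventually_nhds_iff_ball.1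
    (hrne.and hra.eventually_analyticAt)
  have hslit : ∀ s : ℂ, 1 < s.re → s - 1 ∈ Complex.slitPlane := fun s hs => by
    left; simpa using hs
  have hs1 : ∀ s : ℂ, 1 < s.re → s - 1 ≠ 0 := fun s hs => Complex.slitPlane_ne_zero (hslit s hs)
  set U : Set ℂ := Metric.ball 1 δ ∩ {s | 1 < s.re}
  have hUo : IsOpen U := Metric.isOpen_ball.inter isOpen_one_lt_re
  have hconv : IsPreconnected U := by
    refine (Convex.inter (convex_ball _ _) ?_).isPreconnected
    exact convex_halfSpace_re_gt 1
  have hE := hconv.eq_or_eq_neg_of_sq_eq (f := fun s => D s * (s - 1) ^ (1 / 2 : ℂ)) (g := r)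
    (fun s hs => by
      refine ContinuousAt.continuousWithinAt ?_
      refine (hD s hs.2).continuousAt.mul (ContinuousAt.cpow (by fun_prop) (by fun_prop) (hslit s hs.2)))
    (fun s hs => (hball s hs.1).2.continuousAt.continuousWithinAt)
    (fun s hs => by
      simp only [Pi.pow_apply, hr2, mul_pow, hsq s hs.2]
      rw [← Complex.cpow_nat_mul]
      norm_num
      exact div_mul_cancel₀ _ (hs1 s hs.2))
    (fun hs => (hball _ hs.1).1)
  obtain ⟨ε, hε⟩ : ∃ ε : ℂ, ∀ s ∈ U, D s = ε * r s * (s - 1) ^ (-(1 / 2) : ℂ) := by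
    have hinv : ∀ s : ℂ, 1 < s.re → (s - 1) ^ (1 / 2 : ℂ) * (s - 1) ^ (-(1 / 2) : ℂ) = 1 := by
      intro s hs
      rw [← Complex.cpow_add _ _ (hs1 s hs)]; simp
    rcases hE with hE | hE
    · refine ⟨1, fun s hs => ?_⟩
      have h2 := hE hs
      simp only at h2
      rw [one_mul, ← h2, mul_assoc, hinv s hs.2, mul_one]
    · refine ⟨-1, fun s hs => ?_⟩
      have h2 := hE hs
      simp only [Pi.neg_apply] at h2
      rw [neg_one_mul, ← h2, mul_assoc, hinv s hs.2, mul_one]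
  have hU1 : U ∈ nhdsWithin 1 {s : ℂ | 1 < s.re} :=
    Filter.inter_mem (nhdsWithin_le_nhds (Metric.ball_mem_nhds _ hδ)) self_mem_nhdsWithin
  have hder : ∀ s ∈ U, deriv D s = ε * deriv r s * (s - 1) ^ (-(1 / 2) : ℂ)
      - (1 / 2) * ε * r s * (s - 1) ^ (-(3 / 2) : ℂ) := by
    intro s hs
    have d1 : HasDerivAt (fun s => ε * r s * (s - 1) ^ (-(1 / 2) : ℂ))
        (ε * deriv r s * (s - 1) ^ (-(1 / 2) : ℂ)
          + ε * r s * (-(1 / 2) * (s - 1) ^ (-(1 / 2) - 1 : ℂ) * 1)) s := by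
      refine HasDerivAt.mul ((hball s hs.1).2.differentiableAt.hasDerivAt.const_mul ε) ?_
      exact HasDerivAt.cpow_const ((hasDerivAt_id s).sub_const 1) (hslit s hs.2)
    have e : D =ᶠ[nhds s] fun s => ε * r s * (s - 1) ^ (-(1 / 2) : ℂ) := by
      filter_upwards [hUo.mem_nhds hs] with z hz using hε z hz
    rw [(d1.congr_of_eventuallyEq e).deriv]
    have : (-(1 / 2) - 1 : ℂ) = -(3 / 2) := by norm_num
    rw [this]; ring
  refine ⟨1 / 2 * ε * r 1, ?_⟩
  have hm : MildAt (fun s => (-ε * deriv r s + 1 / 2 * ε * dslope r 1 s)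
      * (s - 1) ^ (-(1 / 2) : ℂ)) 1 := by
    refine mildAt_cpow_neg_half.mul_continuousAt ?_
    have h1 : ContinuousAt (deriv r) 1 := hra.deriv.continuousAt
    have h2 : ContinuousAt (dslope r 1) 1 := continuousAt_dslope_same.2 hra.differentiableAt
    fun_prop
  obtain ⟨C, hC⟩ := hm
  refine ⟨C, ?_⟩
  filter_upwards [hC, hU1] with s h1 h2
  refine le_of_eq_of_le (congrArg _ ?_) h1
  rw [hder s h2]
  have hs2 : s ≠ 1 := sub_ne_zero.1 (hs1 s h2.2)
  have h3 : r s = r 1 + (s - 1) * dslope r 1 s := by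
    have := sub_smul_dslope r 1 s
    simp only [smul_eq_mul] at this
    rw [this]; ring
  have h4 : (s - 1) ^ (-(1 / 2) : ℂ) = (s - 1) * (s - 1) ^ (-(3 / 2) : ℂ) := by
    have := Complex.cpow_add (1 : ℂ) (-(3 / 2)) (hs1 s h2.2)
    rw [Complex.cpow_one] at this
    rw [← this]; norm_num
  rw [h4, h3]; ring

/-- The singular behaviour on `Re s = 1` of the derivative of a square root `D` of a function which
is analytic on the line except for at most a simple pole at `1`. -/
theorem mildAt_of_sq {D G : ℂ → ℂ} (hD : ∀ s : ℂ, 1 < s.re → DifferentiableAt ℂ D s)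
    (hsq : ∀ s : ℂ, 1 < s.re → D s ^ 2 = G s / (s - 1)) (hne : ∀ s : ℂ, 1 < s.re → D s ≠ 0)
    (hG : ∀ s : ℂ, s.re = 1 → AnalyticAt ℂ G s) :
    ∃ κ : ℂ, ∀ s₀ : ℂ, s₀.re = 1 →
      MildAt (fun s => -deriv D s - κ * (s - 1) ^ (-(3 / 2) : ℂ)) s₀ := by
  have hreg : ∀ s₀ : ℂ, s₀.re = 1 → s₀ ≠ 1 → MildAt (deriv D) s₀ := by
    intro s₀ h0 h1
    exact mildAt_deriv_of_sq_analytic hD hsq hne h0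
      ((hG s₀ h0).div (by fun_prop) (sub_ne_zero.2 h1))
  have h1 : ∃ κ : ℂ, MildAt (fun s => -deriv D s - κ * (s - 1) ^ (-(3 / 2) : ℂ)) 1 := by
    by_cases h : G 1 ≠ 0
    · exact mildAt_deriv_of_sq_pole hD hsq (hG 1 (by simp)) h
    · push Not at h
      obtain ⟨p, hp⟩ := hG 1 (by simp)
      have hg : AnalyticAt ℂ (dslope G 1) 1 := hp.has_fpower_series_dslope_fslope.analyticAt
      refine ⟨0, ?_⟩
      have := mildAt_deriv_of_sq_analytic hD (g := dslope G 1) (fun s hs => (hsq s hs).trans (by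
        have hs1 : s ≠ 1 := by rintro rfl; simp at hs
        rw [dslope_of_ne _ hs1, slope_def_field, h, sub_zero])) hne (s₀ := 1) (by simp) hg
      exact (this.const_mul (-1)).congr fun s _ => by ring
  obtain ⟨κ, hκ⟩ := h1
  refine ⟨κ, fun s₀ h0 => ?_⟩
  by_cases hs : s₀ = 1
  · rw [hs]; exact hκ
  · have hslit : s₀ - 1 ∈ Complex.slitPlane := by
      right
      intro h
      apply hs
      apply Complex.ext <;> simp_all
    have hc : MildAt (fun s => -κ * (s - 1) ^ (-(3 / 2) : ℂ)) s₀ :=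
      MildAt.of_continuousAt (by
        refine continuousAt_const.mul (ContinuousAt.cpow (by fun_prop) (by fun_prop) hslit)) h0.le
    exact (((hreg s₀ h0 hs).const_mul (-1)).add hc).congr fun s _ => by ring

end SquareRootSingularity

section Continuation
open MeasureTheory Set

/-- A Dirichlet series with nonnegative coefficients whose summatory function is `κ x + O(√x)`
extends to `Re s > 1 / 2` with at most a simple pole of residue `κ` at `1`. -/
lemma lseries_continuation {a : ℕ → ℝ} (h0 : ∀ n, 0 ≤ a n) {κ C : ℝ}
    (hA : ∀ x : ℝ, 1 ≤ x → |(∑ n ∈ Finset.Icc 1 ⌊x⌋₊, a n) - κ * x| ≤ C * √x) :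
    ∃ h : ℂ → ℂ, DifferentiableOn ℂ h {s | 1 / 2 < s.re} ∧
      ∀ s : ℂ, 1 < s.re → LSeries (fun n => (a n : ℂ)) s = h s + κ / (s - 1) := by
  set f : ℝ → ℝ := (Ioi (1 : ℝ)).indicator
    (fun t => (∑ n ∈ Finset.Icc 1 ⌊t⌋₊, a n) - κ * t) with hf
  have hfb : ∀ t, |f t| ≤ |C| * √t := by
    intro t
    by_cases ht : t ∈ Ioi (1 : ℝ)
    · rw [hf, indicator_of_mem ht]
      exact (hA t (le_of_lt ht)).trans (mul_le_mul_of_nonneg_right (le_abs_self _) (sqrt_nonneg _))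
    · rw [hf, indicator_of_notMem ht]; simp; positivity
  have hfm : Measurable f := by
    refine Measurable.indicator ?_ measurableSet_Ioi
    refine Measurable.sub ?_ (by fun_prop)
    exact (measurable_from_nat (f := fun m => ∑ n ∈ Finset.Icc 1 m, a n)).comp Nat.measurable_floor
  have hloc : LocallyIntegrable (fun t => (f t : ℂ)) := by
    have h1 : LocallyIntegrable (fun t : ℝ => |C| * √t) :=
      Continuous.locallyIntegrable (by fun_prop)
    refine h1.mono (by fun_prop) (Eventually.of_forall fun t => ?_)
    simp only [Complex.norm_real, norm_eq_abs]
    exact (hfb t).trans (le_abs_self _)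
  have hmel : ∀ s : ℂ, 1 / 2 < s.re → DifferentiableAt ℂ (mellin fun t => (f t : ℂ)) (-s) := by
    intro s hs
    refine mellin_differentiableAt_of_isBigO_rpow (a := -(1 / 2)) (b := -s.re - 1)
      (hloc.locallyIntegrableOn _) ?_ (by simp; linarith) ?_ (by simp)
    · refine Asymptotics.IsBigO.of_bound |C| (Eventually.of_forall fun t => ?_)
      simp only [Complex.norm_real, norm_eq_abs, neg_neg]
      rw [← Real.sqrt_eq_rpow]
      exact (hfb t).trans (by rw [abs_of_nonneg (sqrt_nonneg _)])
    · refine Asymptotics.IsBigO.of_bound 0 ?_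
      filter_upwards [mem_nhdsWithin_of_mem_nhds (Iio_mem_nhds (zero_lt_one' ℝ))] with t ht
      rw [hf, indicator_of_notMem (by simp; exact (le_of_lt ht))]
      simp
  refine ⟨fun s => s * mellin (fun t => (f t : ℂ)) (-s) + κ, ?_, ?_⟩
  · intro s hs
    refine DifferentiableAt.differentiableWithinAt ?_
    refine DifferentiableAt.add_const _ (differentiableAt_id.mul ?_)
    exact DifferentiableAt.comp (g := mellin fun t => (f t : ℂ)) s (hmel s hs) differentiableAt_id.neg
  · intro s hs
    have hs0 : s ≠ 0 := by rintro rfl; norm_num at hs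
    have hs1 : s - 1 ≠ 0 := by rw [sub_ne_zero]; rintro rfl; norm_num at hs
    have hO : (fun n : ℕ => ∑ k ∈ Finset.Icc 1 n, a k) =O[atTop] fun n => (n : ℝ) ^ (1 : ℝ) := by
      refine Asymptotics.IsBigO.of_bound (|κ| + |C|) ?_
      filter_upwards [eventually_ge_atTop 1] with n hn
      have hn' : (1 : ℝ) ≤ n := by exact_mod_cast hn
      have h1 := hA n hn'
      rw [Nat.floor_natCast] at h1
      rw [rpow_one, norm_eq_abs, norm_eq_abs, Nat.abs_cast]
      have h2 : √(n : ℝ) ≤ n := by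
            rw [Real.sqrt_le_left (by linarith)]; nlinarith
      have h3 : C * √(n : ℝ) ≤ |C| * n :=
        (mul_le_mul_of_nonneg_right (le_abs_self C) (sqrt_nonneg _)).trans
          (mul_le_mul_of_nonneg_left h2 (abs_nonneg C))
      calc _ = |((∑ k ∈ Finset.Icc 1 n, a k) - κ * n) + κ * n| := by ring_nf
        _ ≤ _ := abs_add_le _ _
        _ ≤ _ := by
          rw [abs_mul, Nat.abs_cast]; linarith
    rw [LSeries_eq_mul_integral_of_nonneg a zero_le_one hs hO h0]
    have e1 : ∀ t ∈ Ioi (1 : ℝ), (∑ k ∈ Finset.Icc 1 ⌊t⌋₊, (a k : ℂ)) * (t : ℂ) ^ (-(s + 1))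
        = (t : ℂ) ^ (-s - 1) • (f t : ℂ) + κ * (t : ℂ) ^ (-s) := by
      intro t ht
      have ht0 : (t : ℂ) ≠ 0 := by
        have : (0 : ℝ) < t := lt_trans one_pos ht
        exact_mod_cast this.ne'
      have : (t : ℂ) ^ (-s) = t * (t : ℂ) ^ (-s - 1) := by
        rw [Complex.cpow_sub _ _ ht0, Complex.cpow_one]; field_simp
      rw [hf, indicator_of_mem ht, this, neg_add, smul_eq_mul]
      push_cast
      ring_nf
    rw [setIntegral_congr_fun measurableSet_Ioi e1]
    have i1 : IntegrableOn (fun t : ℝ => (κ : ℂ) * (t : ℂ) ^ (-s)) (Ioi 1) :=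
      (integrableOn_Ioi_cpow_of_lt (by simp; linarith) zero_lt_one).const_mul _
    have i2 : MellinConvergent (fun t => (f t : ℂ)) (-s) := by
      refine mellinConvergent_of_isBigO_rpow (a := -(1 / 2)) (b := -s.re - 1)
        (hloc.locallyIntegrableOn _) ?_ (by simp; linarith) ?_ (by simp)
      · refine Asymptotics.IsBigO.of_bound |C| (Eventually.of_forall fun t => ?_)
        simp only [Complex.norm_real, norm_eq_abs, neg_neg]
        rw [← Real.sqrt_eq_rpow]
        exact (hfb t).trans (by rw [abs_of_nonneg (sqrt_nonneg _)])
      · refine Asymptotics.IsBigO.of_bound 0 ?_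
        filter_upwards [mem_nhdsWithin_of_mem_nhds (Iio_mem_nhds (zero_lt_one' ℝ))] with t ht
        rw [hf, indicator_of_notMem (by simp; exact (le_of_lt ht))]
        simp
    have i3 : IntegrableOn (fun t : ℝ => (t : ℂ) ^ (-s - 1) • (f t : ℂ)) (Ioi 1) :=
      IntegrableOn.mono_set i2 (Ioi_subset_Ioi zero_le_one)
    rw [integral_add i3 i1, integral_const_mul, integral_Ioi_cpow_of_lt (by simp; linarith) zero_lt_one]
    have e2 : ∫ t in Ioi (1 : ℝ), (t : ℂ) ^ (-s - 1) • (f t : ℂ) = mellin (fun t => (f t : ℂ)) (-s) := by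
      unfold mellin
      symm
      apply setIntegral_eq_of_subset_of_forall_sdiff_eq_zero measurableSet_Ioi
        (Ioi_subset_Ioi zero_le_one)
      intro t ht
      simp only [hf]
      rw [indicator_of_notMem ht.2]
      simp
    rw [e2]
    have : -s + 1 ≠ 0 := by
      intro h; apply hs1; linear_combination -h
    simp only [Complex.ofReal_one, Complex.one_cpow]
    field_simp
    ring

end Continuation

section FiberCount
variable {ι : Type*}

/-- The number of elements of `T` of norm `n`. -/
noncomputable def fiberCount (T : Set ι) (N : ι → ℕ) (n : ℕ) : ℝ := ({t ∈ T | N t = n}.ncard : ℝ)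

lemma fiberCount_nonneg (T : Set ι) (N : ι → ℕ) (n : ℕ) : 0 ≤ fiberCount T N n := Nat.cast_nonneg _

lemma sum_fiberCount {T : Set ι} {N : ι → ℕ} (hpos : ∀ t ∈ T, N t ≠ 0) {m : ℕ}
    (hfin : {t ∈ T | N t ≤ m}.Finite) :
    ∑ n ∈ Finset.Icc 1 m, fiberCount T N n = ({t ∈ T | N t ≤ m}.ncard : ℝ) := by
  classical
  unfold fiberCount
  rw [Set.ncard_eq_toFinset_card _ hfin, Finset.card_eq_sum_card_fiberwise (f := N)
    (t := Finset.Icc 1 m)]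
  · push_cast
    refine Finset.sum_congr rfl fun n hn => ?_
    rw [← Set.ncard_coe_finset]
    congr 2
    ext t
    simp only [Finset.mem_Icc] at hn
    simp only [Set.mem_ofPred_eq, Finset.coe_filter, Set.Finite.mem_toFinset]
    constructor
    · rintro ⟨h1, h2⟩; exact ⟨⟨h1, by omega⟩, h2⟩
    · rintro ⟨⟨h1, _⟩, h2⟩; exact ⟨h1, h2⟩
  · intro t ht
    simp only [Set.Finite.coe_toFinset, Set.mem_ofPred_eq] at ht
    simp only [Finset.coe_Icc, Set.mem_Icc]
    exact ⟨Nat.one_le_iff_ne_zero.2 (hpos t ht.1), ht.2⟩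

lemma hasSum_fiberCount {T : Set ι} {N : ι → ℕ} (hpos : ∀ t ∈ T, N t ≠ 0)
    (hfin : ∀ n, {t ∈ T | N t = n}.Finite) {s : ℂ}
    (hs : Summable (T.indicator fun t => (N t : ℂ) ^ (-s))) :
    HasSum (LSeries.term (fun n => (fiberCount T N n : ℂ)) s)
      (∑' t, T.indicator (fun t => (N t : ℂ) ^ (-s)) t) := by
  classical
  have h1 := hs.hasSum.tsum_fiberwise N
  suffices h : LSeries.term (fun n => (fiberCount T N n : ℂ)) s
      = fun n => ∑' b : N ⁻¹' {n}, T.indicator (fun t => (N t : ℂ) ^ (-s)) b by rw [h]; exact h1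
  funext n
  have e : ∀ b : N ⁻¹' {n}, T.indicator (fun t => (N t : ℂ) ^ (-s)) b
      = (T.indicator (fun _ => (1 : ℂ)) b) * (n : ℂ) ^ (-s) := by
    rintro ⟨b, hb⟩
    have hb : N b = n := hb
    by_cases h : b ∈ T <;> simp [Set.indicator, h, hb]
  simp_rw [e]
  rw [tsum_mul_right]
  rcases eq_or_ne n 0 with rfl | hn
  · rw [LSeries.term_zero]
    symm
    apply mul_eq_zero_of_left
    rw [← tsum_zero (α := ℂ) (β := N ⁻¹' {0})]
    congr 1
    funext ⟨b, hb⟩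
    apply Set.indicator_of_notMem
    intro h; exact hpos b h hb
  · rw [LSeries.term_of_ne_zero hn, Complex.cpow_neg, div_eq_mul_inv]
    congr 1
    have : ∑' b : N ⁻¹' {n}, T.indicator (fun _ => (1 : ℂ)) b
        = ∑' b, (N ⁻¹' {n}).indicator (T.indicator (fun _ => (1 : ℂ))) b :=
      tsum_subtype (N ⁻¹' {n}) (T.indicator (fun _ => (1 : ℂ)))
    rw [this, Set.indicator_indicator, tsum_eq_sum (s := (hfin n).toFinset)]
    · rw [Finset.sum_congr rfl (g := fun _ => (1 : ℂ))]
      · simp [fiberCount, Set.ncard_eq_toFinset_card _ (hfin n)]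
      · intro b hb
        simp only [Set.Finite.mem_toFinset, Set.mem_ofPred_eq] at hb
        exact Set.indicator_of_mem (show b ∈ N ⁻¹' {n} ∩ T from ⟨hb.2, hb.1⟩) _
    · intro b hb
      apply Set.indicator_of_notMem
      simp only [Set.Finite.mem_toFinset, Set.mem_ofPred_eq] at hb
      rintro ⟨h1, h2⟩
      exact hb ⟨h2, h1⟩

/-- Twisted sums over `T` as combinations of the Dirichlet series of the classes. -/
lemma sum_lseries_fiberCount {A : Type*} [Fintype A] {T : Set ι} {N : ι → ℕ} (cl : ι → A)
    (hpos : ∀ t ∈ T, N t ≠ 0) (hfin : ∀ n, {t ∈ T | N t = n}.Finite) {s : ℂ}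
    (hs : Summable (T.indicator fun t => (N t : ℂ) ^ (-s))) (χ : A → ℂ) :
    ∑ g, χ g * LSeries (fun n => (fiberCount {t ∈ T | cl t = g} N n : ℂ)) s
      = ∑' t, T.indicator (fun t => χ (cl t) * (N t : ℂ) ^ (-s)) t := by
  classical
  have h1 : ∀ g, HasSum (fun t => χ g * {t ∈ T | cl t = g}.indicator (fun t => (N t : ℂ) ^ (-s)) t)
      (χ g * LSeries (fun n => (fiberCount {t ∈ T | cl t = g} N n : ℂ)) s) := by
    intro g
    have hs' : Summable ({t ∈ T | cl t = g}.indicator fun t => (N t : ℂ) ^ (-s)) := by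
      have := hs.indicator {t | cl t = g}
      rw [Set.indicator_indicator] at this
      have e : {t ∈ T | cl t = g} = {t | cl t = g} ∩ T := by ext t; simp [and_comm]
      rw [e]
      exact this
    refine HasSum.mul_left _ ?_
    have := (hasSum_fiberCount (fun t ht => hpos t ht.1)
      (fun n => (hfin n).subset fun t ht => ⟨ht.1.1, ht.2⟩) hs').tsum_eq
    rw [LSeries, this]
    exact hs'.hasSum
  rw [← (hasSum_sum fun g _ => h1 g : HasSum _ (∑ g, _)).tsum_eq]
  congr 1
  funext t
  by_cases ht : t ∈ T
  · rw [Set.indicator_of_mem ht, Finset.sum_eq_single (cl t)]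
    · rw [Set.indicator_of_mem (by exact ⟨ht, rfl⟩)]
    · intro g _ hg
      rw [Set.indicator_of_notMem (fun h => hg h.2.symm), mul_zero]
    · simp
  · rw [Set.indicator_of_notMem ht]
    exact Finset.sum_eq_zero fun g _ => by
      rw [Set.indicator_of_notMem (fun h => ht h.1), mul_zero]

end FiberCount

section Twist

/-- `n` is a nonzero natural number all of whose prime factors lie in `P`. -/
def SuppOn (P : Set ℕ) (n : ℕ) : Prop := n ≠ 0 ∧ ∀ p : ℕ, Nat.Prime p → p ∣ n → p ∈ P

lemma suppOn_one (P : Set ℕ) : SuppOn P 1 :=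
  ⟨one_ne_zero, fun _ hp h => absurd (Nat.dvd_one.1 h) hp.ne_one⟩

lemma suppOn_mul_iff {P : Set ℕ} {m n : ℕ} : SuppOn P (m * n) ↔ SuppOn P m ∧ SuppOn P n := by
  constructor
  · rintro ⟨h1, h2⟩
    have h1 := mul_ne_zero_iff.1 h1
    exact ⟨⟨h1.1, fun p hp h => h2 p hp (h.mul_right _)⟩, ⟨h1.2, fun p hp h => h2 p hp (h.mul_left _)⟩⟩
  · rintro ⟨⟨h1, h2⟩, ⟨h3, h4⟩⟩
    exact ⟨mul_ne_zero h1 h3, fun p hp h => (hp.dvd_mul.1 h).elim (h2 p hp) (h4 p hp)⟩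

variable {G : Type*} [AddCommGroup G]

open Classical in
/-- The completely multiplicative function `χ(γ(n)) n ^ (-s)` supported on `P`. -/
noncomputable def twist (P : Set ℕ) {γ : ℕ → G} (hγ : ∀ m n, m ≠ 0 → n ≠ 0 → γ (m * n) = γ m + γ n)
    (χ : AddChar G ℂ) (s : ℂ) : ℕ →*₀ ℂ where
  toFun n := if SuppOn P n then χ (γ n) * (n : ℂ) ^ (-s) else 0
  map_zero' := if_neg fun h => h.1 rfl
  map_one' := by
    have : γ 1 = 0 := by simpa using hγ 1 1 one_ne_zero one_ne_zero
    simp [suppOn_one, this]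
  map_mul' m n := by
    by_cases hm : SuppOn P m
    · by_cases hn : SuppOn P n
      · rw [if_pos (suppOn_mul_iff.2 ⟨hm, hn⟩), if_pos hm, if_pos hn, hγ m n hm.1 hn.1,
          AddChar.map_add_eq_mul, Nat.cast_mul, Complex.natCast_mul_natCast_cpow]
        ring
      · rw [if_neg (fun h => hn (suppOn_mul_iff.1 h).2), if_neg hn, mul_zero]
    · rw [if_neg (fun h => hm (suppOn_mul_iff.1 h).1), if_neg hm, zero_mul]

variable {P : Set ℕ} {γ : ℕ → G} (hγ : ∀ m n, m ≠ 0 → n ≠ 0 → γ (m * n) = γ m + γ n)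
  (χ : AddChar G ℂ) {s : ℂ}

lemma twist_of_suppOn {n : ℕ} (h : SuppOn P n) : twist P hγ χ s n = χ (γ n) * (n : ℂ) ^ (-s) :=
  if_pos h

lemma twist_of_not_suppOn {n : ℕ} (h : ¬SuppOn P n) : twist P hγ χ s n = 0 := if_neg h

lemma norm_twist_le [Finite G] (n : ℕ) : ‖twist P hγ χ s n‖ ≤ (n : ℝ) ^ (-s.re) := by
  by_cases h : SuppOn P n
  · rw [twist_of_suppOn hγ χ h, norm_mul, AddChar.norm_apply, one_mul,
      Complex.norm_natCast_cpow_of_pos (Nat.pos_of_ne_zero h.1)]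
    simp
  · rw [twist_of_not_suppOn hγ χ h, norm_zero]; positivity

lemma summable_norm_twist [Finite G] (hs : 1 < s.re) : Summable fun n => ‖twist P hγ χ s n‖ :=
  Summable.of_nonneg_of_le (fun _ => norm_nonneg _) (norm_twist_le hγ χ)
    (Real.summable_nat_rpow.2 (by linarith))

lemma tsum_twist_ne_zero [Finite G] (hs : 1 < s.re) : ∑' n, twist P hγ χ s n ≠ 0 := by
  rw [← EulerProduct.exp_tsum_primes_log_eq_tsum (summable_norm_twist hγ χ hs)]
  exact Complex.exp_ne_zero _

lemma differentiable_tsum_twist [Finite G] :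
    DifferentiableOn ℂ (fun s => ∑' n, twist P hγ χ s n) {s | 1 < s.re} := by
  classical
  set f : ℕ → ℂ := fun n => if SuppOn P n then χ (γ n) else 0 with hf
  have h1 : ∀ s : ℂ, ∑' n, twist P hγ χ s n = LSeries f s := by
    intro s
    unfold LSeries
    congr 1
    funext n
    rcases eq_or_ne n 0 with rfl | hn
    · simp
    · rw [LSeries.term_of_ne_zero hn]
      by_cases h : SuppOn P n
      · rw [twist_of_suppOn hγ χ h, Complex.cpow_neg, div_eq_mul_inv]; simp [hf, h]
      · rw [twist_of_not_suppOn hγ χ h]; simp [hf, h]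
  simp_rw [h1]
  have hab : LSeries.abscissaOfAbsConv f ≤ 1 := by
    refine LSeries.abscissaOfAbsConv_le_of_le_const ⟨1, fun n hn => ?_⟩
    simp only [hf]
    split_ifs
    · rw [AddChar.norm_apply]
    · simp
  refine (LSeries_differentiableOn f).mono fun s hs => ?_
  have hs : 1 < s.re := hs
  exact lt_of_le_of_lt hab (by exact_mod_cast hs)

end Twist

section ClassData

/-- Arithmetic data of the ideals prime to a modulus in an imaginary quadratic ring:
`S` and `Q` are the split and inert primes, `G` is a ray class group, `σ` the conjugation and
`γ` the class of a chosen ideal. -/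
structure ClassData (G : Type*) [AddCommGroup G] where
  σ : G →+ G
  σσ : ∀ g, σ (σ g) = g
  S : Set ℕ
  Q : Set ℕ
  disj : Disjoint S Q
  γ : ℕ → G
  γ_mul : ∀ m n, m ≠ 0 → n ≠ 0 → γ (m * n) = γ m + γ n
  κ : ℝ
  κ_pos : 0 < κ
  C : ℝ
  count : ∀ (g : G) (x : ℝ), 1 ≤ x →
    |({t : ℕ × ℕ × ℕ | (SuppOn S t.1 ∧ SuppOn S t.2.1 ∧ SuppOn Q t.2.2) ∧
      γ t.1 + σ (γ t.2.1) + γ t.2.2 = g ∧ t.1 * t.2.1 * t.2.2 ^ 2 ≤ ⌊x⌋₊}.ncard : ℝ) - κ * x| ≤ C * √x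

namespace ClassData
variable {G : Type*} [AddCommGroup G] (D : ClassData G)

/-- Triples parametrising ideals. -/
def triples : Set (ℕ × ℕ × ℕ) := {t | SuppOn D.S t.1 ∧ SuppOn D.S t.2.1 ∧ SuppOn D.Q t.2.2}

/-- The norm of the ideal of a triple. -/
def tripleNorm (t : ℕ × ℕ × ℕ) : ℕ := t.1 * t.2.1 * t.2.2 ^ 2

/-- The class of the ideal of a triple. -/
def tripleClass (t : ℕ × ℕ × ℕ) : G := D.γ t.1 + D.σ (D.γ t.2.1) + D.γ t.2.2

/-- Pairs parametrising norms of ideals. -/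
def pairs : Set (ℕ × ℕ) := {t | SuppOn D.S t.1 ∧ SuppOn D.Q t.2}

/-- The norm of a pair. -/
def pairNorm (t : ℕ × ℕ) : ℕ := t.1 * t.2 ^ 2

lemma tripleNorm_ne_zero : ∀ t ∈ D.triples, tripleNorm t ≠ 0 := fun _ ht =>
  mul_ne_zero (mul_ne_zero ht.1.1 ht.2.1.1) (pow_ne_zero 2 ht.2.2.1)

lemma pairNorm_ne_zero : ∀ t ∈ D.pairs, pairNorm t ≠ 0 := fun _ ht =>
  mul_ne_zero ht.1.1 (pow_ne_zero 2 ht.2.1)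

lemma finite_triples (x : ℕ) : {t ∈ D.triples | tripleNorm t ≤ x}.Finite := by
  refine Set.Finite.subset ((Set.finite_Iic x).prod ((Set.finite_Iic x).prod (Set.finite_Iic x))) ?_
  rintro ⟨a, b, c⟩ ⟨⟨ha, hb, hc⟩, h⟩
  simp only [tripleNorm] at h ha hb hc
  have ha := Nat.pos_of_ne_zero ha.1
  have hb := Nat.pos_of_ne_zero hb.1
  have hc := Nat.pos_of_ne_zero hc.1
  have h1 : a ∣ a * b * c ^ 2 := ⟨b * c ^ 2, by ring⟩
  have h2 : b ∣ a * b * c ^ 2 := ⟨a * c ^ 2, by ring⟩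
  have h3 : c ∣ a * b * c ^ 2 := ⟨a * b * c, by ring⟩
  have h4 : 0 < a * b * c ^ 2 := by positivity
  exact ⟨(Nat.le_of_dvd h4 h1).trans h, (Nat.le_of_dvd h4 h2).trans h, (Nat.le_of_dvd h4 h3).trans h⟩

lemma finite_pairs (x : ℕ) : {t ∈ D.pairs | pairNorm t ≤ x}.Finite := by
  refine Set.Finite.subset ((Set.finite_Iic x).prod (Set.finite_Iic x)) ?_
  rintro ⟨a, c⟩ ⟨⟨ha, hc⟩, h⟩
  simp only [pairNorm] at h ha hc
  have ha := Nat.pos_of_ne_zero ha.1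
  have hc := Nat.pos_of_ne_zero hc.1
  have h1 : a ∣ a * c ^ 2 := ⟨c ^ 2, by ring⟩
  have h3 : c ∣ a * c ^ 2 := ⟨a * c, by ring⟩
  have h4 : 0 < a * c ^ 2 := by positivity
  exact ⟨(Nat.le_of_dvd h4 h1).trans h, (Nat.le_of_dvd h4 h3).trans h⟩

lemma pairNorm_injOn : Set.InjOn pairNorm D.pairs := by
  rintro ⟨a, c⟩ ⟨ha, hc⟩ ⟨a', c'⟩ ⟨ha', hc'⟩ h
  simp only [pairNorm] at h ha hc ha' hc'
  have hcop : ∀ {m n : ℕ}, SuppOn D.S m → SuppOn D.Q n → m.Coprime (n ^ 2) := by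
    intro m n hm hn
    refine Nat.Coprime.pow_right 2 (Nat.coprime_of_dvd fun p hp h1 h2 => ?_)
    exact Set.disjoint_left.1 D.disj (hm.2 p hp h1) (hn.2 p hp h2)
  have h1 : a ∣ a' := (hcop ha hc').dvd_of_dvd_mul_right (h ▸ dvd_mul_right a _)
  have h2 : a' ∣ a := (hcop ha' hc).dvd_of_dvd_mul_right (h ▸ dvd_mul_right a' _)
  have h3 : a = a' := Nat.dvd_antisymm h1 h2
  subst h3
  have h4 : c ^ 2 = c' ^ 2 := Nat.eq_of_mul_eq_mul_left (Nat.pos_of_ne_zero ha.1) h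
  rw [Nat.pow_left_injective two_ne_zero h4]

variable [Finite G]

/-- The factor of the L-functions coming from split primes. -/
noncomputable def U (χ : AddChar G ℂ) (s : ℂ) : ℂ := ∑' n, twist D.S D.γ_mul χ s n

/-- The factor of the L-functions coming from inert primes. -/
noncomputable def V (χ : AddChar G ℂ) (s : ℂ) : ℂ := ∑' n, twist D.Q D.γ_mul χ (2 * s) n

/-- The Dirichlet series of ideals in a class. -/
noncomputable def Z (g : G) (s : ℂ) : ℂ :=
  LSeries (fun n => (fiberCount {t ∈ D.triples | D.tripleClass t = g} tripleNorm n : ℂ)) s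

lemma V_ne_zero (χ : AddChar G ℂ) {s : ℂ} (hs : 1 / 2 < s.re) : D.V χ s ≠ 0 :=
  tsum_twist_ne_zero _ _ (by simp; linarith)

lemma U_ne_zero (χ : AddChar G ℂ) {s : ℂ} (hs : 1 < s.re) : D.U χ s ≠ 0 :=
  tsum_twist_ne_zero _ _ hs

lemma differentiableOn_V (χ : AddChar G ℂ) : DifferentiableOn ℂ (D.V χ) {s | 1 / 2 < s.re} := by
  refine DifferentiableOn.comp (differentiable_tsum_twist D.γ_mul χ (P := D.Q))
    (f := fun s => 2 * s) (by fun_prop) fun s hs => ?_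
  have hs : 1 / 2 < s.re := hs
  have : 1 < (2 * s).re := by simp; linarith
  exact this

omit [Finite G] in
lemma triple_term (χ : AddChar G ℂ) (s : ℂ) (t : ℕ × ℕ × ℕ) :
    D.triples.indicator (fun t => χ (D.tripleClass t) * (tripleNorm t : ℂ) ^ (-s)) t =
      twist D.S D.γ_mul χ s t.1 * (twist D.S D.γ_mul (χ.compAddMonoidHom D.σ) s t.2.1
        * twist D.Q D.γ_mul χ (2 * s) t.2.2) := by
  by_cases h1 : SuppOn D.S t.1
  · by_cases h2 : SuppOn D.S t.2.1
    · by_cases h3 : SuppOn D.Q t.2.2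
      · rw [Set.indicator_of_mem (show t ∈ D.triples from ⟨h1, h2, h3⟩), twist_of_suppOn _ _ h1,
          twist_of_suppOn _ _ h2, twist_of_suppOn _ _ h3, tripleClass, tripleNorm, AddChar.map_add_eq_mul,
          AddChar.map_add_eq_mul, Nat.cast_mul, Complex.natCast_mul_natCast_cpow, Nat.cast_mul,
          Complex.natCast_mul_natCast_cpow, sq, Nat.cast_mul, Complex.natCast_mul_natCast_cpow]
        have h0 : (t.2.2 : ℂ) ≠ 0 := by exact_mod_cast h3.1
        have : -(2 * s) = -s + -s := by ring
        rw [this, Complex.cpow_add _ _ h0]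
        simp only [AddChar.compAddMonoidHom_apply]
        ring
      · rw [Set.indicator_of_notMem fun h => h3 h.2.2, twist_of_not_suppOn _ _ h3, mul_zero, mul_zero]
    · rw [Set.indicator_of_notMem fun h => h2 h.2.1, twist_of_not_suppOn _ _ h2, zero_mul, mul_zero]
  · rw [Set.indicator_of_notMem fun h => h1 h.1, twist_of_not_suppOn _ _ h1, zero_mul]

/-- Factorisation of the L-function of a class group character. -/
lemma sum_Z (χ : AddChar G ℂ) {s : ℂ} (hs : 1 < s.re) [Fintype G] :
    ∑ g, χ g * D.Z g s = D.U χ s * D.U (χ.compAddMonoidHom D.σ) s * D.V χ s := by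
  have hs2 : 1 < (2 * s).re := by simp; linarith
  have hsum : ∀ χ : AddChar G ℂ, Summable fun t => ‖D.triples.indicator
      (fun t => χ (D.tripleClass t) * (tripleNorm t : ℂ) ^ (-s)) t‖ := by
    intro χ
    simp_rw [D.triple_term χ s]
    exact Summable.mul_norm (f := fun n => twist D.S D.γ_mul χ s n)
      (g := fun t : ℕ × ℕ => twist D.S D.γ_mul (χ.compAddMonoidHom D.σ) s t.1
        * twist D.Q D.γ_mul χ (2 * s) t.2) (summable_norm_twist _ _ hs)
      (Summable.mul_norm (f := fun n => twist D.S D.γ_mul (χ.compAddMonoidHom D.σ) s n)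
        (g := fun n => twist D.Q D.γ_mul χ (2 * s) n)
        (summable_norm_twist _ _ hs) (summable_norm_twist _ _ hs2))
  have h1 := sum_lseries_fiberCount D.tripleClass D.tripleNorm_ne_zero
    (fun n => (D.finite_triples n).subset fun t ht => ⟨ht.1, ht.2.le⟩) (s := s)
    (by have := (hsum 1).of_norm; simp only [AddChar.one_apply, one_mul] at this; exact this) χ
  unfold Z
  rw [h1]
  simp_rw [D.triple_term χ s]
  unfold U V
  have e2 := tsum_mul_tsum_of_summable_norm
    (f := fun n => twist D.S D.γ_mul (χ.compAddMonoidHom D.σ) s n)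
    (g := fun n => twist D.Q D.γ_mul χ (2 * s) n)
    (summable_norm_twist _ _ hs) (summable_norm_twist _ _ hs2)
  have e1 := tsum_mul_tsum_of_summable_norm (f := fun n => twist D.S D.γ_mul χ s n)
    (g := fun t : ℕ × ℕ => twist D.S D.γ_mul (χ.compAddMonoidHom D.σ) s t.1
        * twist D.Q D.γ_mul χ (2 * s) t.2) (summable_norm_twist _ _ hs)
    (Summable.mul_norm (f := fun n => twist D.S D.γ_mul (χ.compAddMonoidHom D.σ) s n)
      (g := fun n => twist D.Q D.γ_mul χ (2 * s) n)
      (summable_norm_twist _ _ hs) (summable_norm_twist _ _ hs2))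
  rw [mul_assoc, e2, e1]

omit [Finite G] in
lemma pair_term (χ : AddChar G ℂ) (s : ℂ) (t : ℕ × ℕ) :
    D.pairs.indicator (fun t => χ (D.γ t.1 + D.γ t.2) * (pairNorm t : ℂ) ^ (-s)) t =
      twist D.S D.γ_mul χ s t.1 * twist D.Q D.γ_mul χ (2 * s) t.2 := by
  by_cases h1 : SuppOn D.S t.1
  · by_cases h3 : SuppOn D.Q t.2
    · rw [Set.indicator_of_mem (show t ∈ D.pairs from ⟨h1, h3⟩), twist_of_suppOn _ _ h1,
        twist_of_suppOn _ _ h3, pairNorm, AddChar.map_add_eq_mul,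
        Nat.cast_mul, Complex.natCast_mul_natCast_cpow, sq, Nat.cast_mul,
        Complex.natCast_mul_natCast_cpow]
      have h0 : (t.2 : ℂ) ≠ 0 := by exact_mod_cast h3.1
      have : -(2 * s) = -s + -s := by ring
      rw [this, Complex.cpow_add _ _ h0]
      ring
    · rw [Set.indicator_of_notMem fun h => h3 h.2, twist_of_not_suppOn _ _ h3, mul_zero]
  · rw [Set.indicator_of_notMem fun h => h1 h.1, twist_of_not_suppOn _ _ h1, zero_mul]

omit [Finite G] in
/-- The analytic continuation of the Dirichlet series of a class. -/
lemma exists_continuation (g : G) : ∃ h : ℂ → ℂ, DifferentiableOn ℂ h {s | 1 / 2 < s.re} ∧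
      ∀ s : ℂ, 1 < s.re → D.Z g s = h s + D.κ / (s - 1) := by
  refine lseries_continuation (fun n => fiberCount_nonneg _ _ n) (C := D.C) fun x hx => ?_
  have hf : {t ∈ {t ∈ D.triples | D.tripleClass t = g} | tripleNorm t ≤ ⌊x⌋₊}.Finite :=
    (D.finite_triples ⌊x⌋₊).subset fun t ht => ⟨ht.1.1, ht.2⟩
  rw [sum_fiberCount (fun t ht => D.tripleNorm_ne_zero t ht.1) hf]
  convert D.count g x hx using 5
  ext t
  simp [triples, tripleClass, tripleNorm, and_assoc]

end ClassData

end ClassData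

namespace ClassData
variable {G : Type*} [AddCommGroup G] (D : ClassData G)

/-- The subgroup of elements `σ g - g`. -/
def H : AddSubgroup G := (D.σ - AddMonoidHom.id G).range

/-- The genus of a pair. -/
def genus (t : ℕ × ℕ) : G ⧸ D.H := ((D.γ t.1 + D.γ t.2 : G) : G ⧸ D.H)

/-- The number of pairs in `A` with norm up to `x`. -/
noncomputable def cnt (A : Set (ℕ × ℕ)) (x : ℝ) : ℝ := ({t ∈ A | pairNorm t ≤ ⌊x⌋₊}.ncard : ℝ)

/-- The number of elements of `A` of norm up to `x` is asymptotic to `F x / √(log x)`. -/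
def HasDens (A : Set (ℕ × ℕ)) (F : ℝ) : Prop :=
  Tendsto (fun x : ℝ => cnt A x * √(log x) / x) atTop (nhds F)

variable [Finite G]

/-- The Dirichlet series of pairs in a genus. -/
noncomputable def W (h : G ⧸ D.H) (s : ℂ) : ℂ :=
  LSeries (fun n => (fiberCount {t ∈ D.pairs | D.genus t = h} pairNorm n : ℂ)) s

/-- The character of the class group induced by a genus character. -/
def lift (ψ : AddChar (G ⧸ D.H) ℂ) : AddChar G ℂ := ψ.compAddMonoidHom (QuotientAddGroup.mk' D.H)

omit [Finite G] in
lemma lift_comp_σ (ψ : AddChar (G ⧸ D.H) ℂ) : (D.lift ψ).compAddMonoidHom D.σ = D.lift ψ := by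
  ext g
  simp only [lift, AddChar.compAddMonoidHom_apply, QuotientAddGroup.mk'_apply]
  congr 1
  rw [QuotientAddGroup.eq_iff_sub_mem]
  exact ⟨g, rfl⟩

lemma sum_W (ψ : AddChar (G ⧸ D.H) ℂ) {s : ℂ} (hs : 1 < s.re) [Fintype (G ⧸ D.H)] :
    ∑ h, ψ h * D.W h s = D.U (D.lift ψ) s * D.V (D.lift ψ) s := by
  have hs2 : 1 < (2 * s).re := by simp; linarith
  have hsum : ∀ χ : AddChar G ℂ, Summable fun t => ‖D.pairs.indicator
      (fun t => χ (D.γ t.1 + D.γ t.2) * (pairNorm t : ℂ) ^ (-s)) t‖ := by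
    intro χ
    simp_rw [D.pair_term χ s]
    exact Summable.mul_norm (f := fun n => twist D.S D.γ_mul χ s n)
      (g := fun n => twist D.Q D.γ_mul χ (2 * s) n)
      (summable_norm_twist _ _ hs) (summable_norm_twist _ _ hs2)
  have h1 := sum_lseries_fiberCount D.genus D.pairNorm_ne_zero
    (fun n => (D.finite_pairs n).subset fun t ht => ⟨ht.1, ht.2.le⟩) (s := s)
    (by have := (hsum 1).of_norm; simp only [AddChar.one_apply, one_mul] at this; exact this) ψ
  unfold W
  rw [h1]
  have e : ∀ t, ψ (D.genus t) = D.lift ψ (D.γ t.1 + D.γ t.2) := fun t => rfl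
  simp_rw [e, D.pair_term (D.lift ψ) s]
  unfold U V
  rw [tsum_mul_tsum_of_summable_norm (f := fun n => twist D.S D.γ_mul (D.lift ψ) s n)
    (g := fun n => twist D.Q D.γ_mul (D.lift ψ) (2 * s) n)
    (summable_norm_twist _ _ hs) (summable_norm_twist _ _ hs2)]

lemma mildAt_genus_char (ψ : AddChar (G ⧸ D.H) ℂ) : ∃ κ : ℂ, ∀ s₀ : ℂ, s₀.re = 1 →
    MildAt (fun s => -deriv (fun s => D.U (D.lift ψ) s * D.V (D.lift ψ) s) s
      - κ * (s - 1) ^ (-(3 / 2) : ℂ)) s₀ := by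
  have := Fintype.ofFinite G
  set χ := D.lift ψ with hχ
  choose h hd hh using D.exists_continuation
  have hVd : ∀ s : ℂ, 1 / 2 < s.re → AnalyticAt ℂ (D.V χ) s := fun s hs =>
    (D.differentiableOn_V χ).analyticAt
      ((isOpen_lt continuous_const Complex.continuous_re).mem_nhds hs)
  refine mildAt_of_sq (G := fun s => ((s - 1) * (∑ g, χ g * h g s) + ∑ g, χ g * D.κ) * D.V χ s)
    ?_ ?_ ?_ ?_
  · intro s hs
    refine DifferentiableAt.mul ?_ (hVd s (by linarith)).differentiableAt
    exact (differentiable_tsum_twist D.γ_mul χ).differentiableAt (isOpen_one_lt_re.mem_nhds hs)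
  · intro s hs
    have hs1 : s - 1 ≠ 0 := by rw [sub_ne_zero]; rintro rfl; norm_num at hs
    have h1 := D.sum_Z χ hs
    rw [hχ, D.lift_comp_σ, ← hχ] at h1
    have h2 : ∑ g, χ g * D.Z g s = ((s - 1) * (∑ g, χ g * h g s) + ∑ g, χ g * D.κ) / (s - 1) := by
      rw [eq_div_iff hs1, Finset.sum_mul, Finset.mul_sum, ← Finset.sum_add_distrib]
      refine Finset.sum_congr rfl fun g _ => ?_
      rw [hh g s hs]; field_simp
    rw [mul_div_right_comm, ← h2, h1]; ring
  · intro s hs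
    exact mul_ne_zero (D.U_ne_zero _ hs) (D.V_ne_zero _ (by linarith))
  · intro s hs
    have hs' : 1 / 2 < s.re := by rw [hs]; norm_num
    refine AnalyticAt.mul (AnalyticAt.add (AnalyticAt.mul (by fun_prop) ?_) analyticAt_const) (hVd s hs')
    refine Finset.analyticAt_fun_sum _ fun g _ => analyticAt_const.mul ?_
    exact (hd g).analyticAt ((isOpen_lt continuous_const Complex.continuous_re).mem_nhds hs')

/-- The number of norms in a genus up to `x` is asymptotic to a multiple of `x / √(log x)`. -/
theorem exists_hasDens_genus (h : G ⧸ D.H) :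
    ∃ F, HasDens {t ∈ D.pairs | D.genus t = h} F := by
  classical
  have := Fintype.ofFinite (G ⧸ D.H)
  choose κ hκ using D.mildAt_genus_char
  set a : ℕ → ℝ := fiberCount {t ∈ D.pairs | D.genus t = h} pairNorm with ha
  have hfin : ∀ x : ℕ, {t ∈ {t ∈ D.pairs | D.genus t = h} | pairNorm t ≤ x}.Finite := fun x =>
    (D.finite_pairs x).subset fun t ht => ⟨ht.1.1, ht.2⟩
  have ha1 : ∀ n, a n ≤ 1 := by
    intro n
    simp only [ha, fiberCount]
    have : {t ∈ {t ∈ D.pairs | D.genus t = h} | pairNorm t = n}.ncard ≤ 1 := by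
      refine (Set.ncard_le_one ((hfin n).subset fun t ht => ⟨ht.1, ht.2.le⟩)).2 ?_
      intro s hs t ht
      exact D.pairNorm_injOn hs.1.1 ht.1.1 (hs.2.trans ht.2.symm)
    exact_mod_cast this
  have hab : LSeries.abscissaOfAbsConv (fun n => (a n : ℂ)) ≤ 1 := by
    refine LSeries.abscissaOfAbsConv_le_of_le_const ⟨1, fun n _ => ?_⟩
    rw [Complex.norm_real, norm_eq_abs, abs_of_nonneg (fiberCount_nonneg _ _ n)]
    exact ha1 n
  have hW : ∀ s : ℂ, 1 < s.re → D.W h s = (Fintype.card (G ⧸ D.H) : ℂ)⁻¹ *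
      ∑ ψ : AddChar (G ⧸ D.H) ℂ, ψ (-h) * (D.U (D.lift ψ) s * D.V (D.lift ψ) s) := by
    intro s hs
    have hc : (Fintype.card (G ⧸ D.H) : ℂ) ≠ 0 := Nat.cast_ne_zero.2 Fintype.card_ne_zero
    rw [eq_inv_mul_iff_mul_eq₀ hc]
    simp_rw [← D.sum_W _ hs, Finset.mul_sum]
    rw [Finset.sum_comm]
    have : ∀ g : G ⧸ D.H, ∑ ψ : AddChar (G ⧸ D.H) ℂ, ψ (-h) * (ψ g * D.W g s)
        = if g = h then Fintype.card (G ⧸ D.H) * D.W g s else 0 := by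
      intro g
      have e := AddChar.sum_apply_eq_ite (-h + g)
      simp_rw [AddChar.map_add_eq_mul] at e
      simp_rw [← mul_assoc]
      rw [← Finset.sum_mul, e]
      have : -h + g = 0 ↔ g = h := by rw [neg_add_eq_zero, eq_comm]
      simp [this]
    simp_rw [this]
    simp
  have hdiff : ∀ ψ : AddChar (G ⧸ D.H) ℂ, ∀ s : ℂ, 1 < s.re →
      DifferentiableAt ℂ (fun s => D.U (D.lift ψ) s * D.V (D.lift ψ) s) s := by
    intro ψ s hs
    refine DifferentiableAt.mul ?_ ?_
    · exact (differentiable_tsum_twist D.γ_mul _).differentiableAt (isOpen_one_lt_re.mem_nhds hs)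
    · exact (D.differentiableOn_V _).differentiableAt
        ((isOpen_lt continuous_const Complex.continuous_re).mem_nhds
          (show (1 / 2 : ℝ) < s.re by linarith))
  have hder : ∀ s : ℂ, 1 < s.re → LSeries (fun n => ((a n * Real.log n : ℝ) : ℂ)) s =
      ∑ ψ : AddChar (G ⧸ D.H) ℂ, ((Fintype.card (G ⧸ D.H) : ℂ)⁻¹ * ψ (-h)) *
        -deriv (fun s => D.U (D.lift ψ) s * D.V (D.lift ψ) s) s := by
    intro s hs
    have h1 := LSeries_deriv (f := fun n => (a n : ℂ)) (s := s)
      (lt_of_le_of_lt hab (by exact_mod_cast hs))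
    have h2 : LSeries (fun n => ((a n * Real.log n : ℝ) : ℂ)) s = -deriv (D.W h) s := by
      have e : D.W h = LSeries (fun n => (a n : ℂ)) := rfl
      rw [e, h1, neg_neg]
      congr 1
      funext n
      simp only [LSeries.logMul, Complex.ofReal_mul, Complex.natCast_log]
      ring
    rw [h2]
    have h3 : D.W h =ᶠ[nhds s] fun s => (Fintype.card (G ⧸ D.H) : ℂ)⁻¹ *
      ∑ ψ : AddChar (G ⧸ D.H) ℂ, ψ (-h) * (D.U (D.lift ψ) s * D.V (D.lift ψ) s) := by
      filter_upwards [isOpen_one_lt_re.mem_nhds hs] with z hz using hW z hz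
    have h4 := HasDerivAt.const_mul (Fintype.card (G ⧸ D.H) : ℂ)⁻¹ (HasDerivAt.fun_sum
      (u := Finset.univ) fun (ψ : AddChar (G ⧸ D.H) ℂ) _ =>
        ((hdiff ψ s hs).hasDerivAt.const_mul (ψ (-h))))
    rw [h3.deriv_eq, h4.deriv, Finset.mul_sum, ← Finset.sum_neg_distrib]
    refine Finset.sum_congr rfl fun ψ _ => by ring
  have hmild := count_asymptotic (a := a) (fiberCount_nonneg _ _) ha1
    (∑ ψ : AddChar (G ⧸ D.H) ℂ, ((Fintype.card (G ⧸ D.H) : ℂ)⁻¹ * ψ (-h)) * κ ψ) (by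
    intro s₀ hs₀
    have : ∀ t : Finset (AddChar (G ⧸ D.H) ℂ), MildAt (fun s => ∑ ψ ∈ t,
        ((Fintype.card (G ⧸ D.H) : ℂ)⁻¹ * ψ (-h)) *
        (-deriv (fun s => D.U (D.lift ψ) s * D.V (D.lift ψ) s) s
          - κ ψ * (s - 1) ^ (-(3 / 2) : ℂ))) s₀ := by
      intro t
      induction t using Finset.induction_on with
      | empty => simpa using MildAt.of_continuousAt (continuousAt_const (y := (0 : ℂ))) hs₀.le
      | insert ψ t hψ ih =>
        simp_rw [Finset.sum_insert hψ]
        exact ((hκ ψ s₀ hs₀).const_mul _).add ih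
    refine (this Finset.univ).congr fun s hs => ?_
    rw [hder s hs, Finset.sum_mul, ← Finset.sum_sub_distrib]
    exact Finset.sum_congr rfl fun ψ _ => by ring)
  obtain ⟨F, hF⟩ := hmild
  refine ⟨F, ?_⟩
  unfold HasDens
  convert hF using 4 with x
  rw [cnt, ha, sum_fiberCount (fun t ht => D.pairNorm_ne_zero t ht.1) (hfin _)]

end ClassData

namespace ClassData
variable {G : Type*} [AddCommGroup G] (D : ClassData G)

/-- The split primes in the class `g`. -/
def primesOf (g : G) : Set ℕ := {p | p.Prime ∧ p ∈ D.S ∧ D.γ p = g}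

/-- The classes containing many split primes. -/
def Splus : Set G := {g | ¬Summable ((D.primesOf g).indicator fun p : ℕ => 1 / (p : ℝ))}

variable [Finite G]

lemma U_one_le (χ : AddChar G ℂ) (hχ : ∀ g, χ g ≠ 1 → g ∉ D.Splus) :
    ∃ C : ℝ, 0 ≤ C ∧ ∀ s : ℂ, 1 < s.re → ‖D.U 1 s‖ ≤ C * ‖D.U χ s‖ := by
  classical
  have := Fintype.ofFinite G
  set B : ℕ → ℝ := fun p => 3 * ∑ g ∈ Finset.univ.filter (fun g : G => χ g ≠ 1),
    (D.primesOf g).indicator (fun p : ℕ => 1 / (p : ℝ)) p with hB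
  have hB0 : ∀ p, 0 ≤ B p := fun p => mul_nonneg (by norm_num) (Finset.sum_nonneg fun g _ =>
    Set.indicator_nonneg (fun p _ => by positivity) p)
  have hBs : Summable B := by
    refine Summable.mul_left _ (summable_sum fun g hg => ?_)
    simpa [Splus] using hχ g (Finset.mem_filter.1 hg).2
  refine ⟨Real.exp (∑' p : Nat.Primes, B p), (Real.exp_pos _).le, fun s hs => ?_⟩
  have e1 := EulerProduct.exp_tsum_primes_log_eq_tsum (summable_norm_twist D.γ_mul (1 : AddChar G ℂ) (P := D.S) hs)
  have e2 := EulerProduct.exp_tsum_primes_log_eq_tsum (summable_norm_twist D.γ_mul χ (P := D.S) hs)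
  have s1 : Summable fun p : Nat.Primes => -Complex.log (1 - twist D.S D.γ_mul (1 : AddChar G ℂ) s p) :=
    (summable_norm_twist D.γ_mul (1 : AddChar G ℂ) (P := D.S) hs).of_norm.clog_one_sub.neg.subtype Nat.Prime
  have s2 : Summable fun p : Nat.Primes => -Complex.log (1 - twist D.S D.γ_mul χ s p) :=
    (summable_norm_twist D.γ_mul χ (P := D.S) hs).of_norm.clog_one_sub.neg.subtype Nat.Prime
  unfold U
  rw [← e1, ← e2]
  have hlog : ∀ (χ : AddChar G ℂ) (p : Nat.Primes),
      ‖Complex.log (1 - twist D.S D.γ_mul χ s p)‖ ≤ 3 / 2 * (1 / (p : ℝ)) := by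
    intro χ p
    have hp2 : (2 : ℝ) ≤ (p : ℕ) := by exact_mod_cast p.2.two_le
    have h1 : ‖twist D.S D.γ_mul χ s p‖ ≤ 1 / (p : ℝ) := by
      refine (norm_twist_le _ _ _).trans ?_
      rw [one_div, ← Real.rpow_neg_one]
      exact Real.rpow_le_rpow_of_exponent_le (by linarith) (by linarith)
    have h2 : (1 : ℝ) / (p : ℕ) ≤ 1 / 2 := one_div_le_one_div_of_le (by norm_num) hp2
    have h3 := Complex.norm_log_one_add_half_le_self (z := -twist D.S D.γ_mul χ s p)
      (by rw [norm_neg]; exact h1.trans h2)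
    rw [norm_neg, ← sub_eq_add_neg] at h3
    linarith
  have hterm : ∀ p : Nat.Primes, ‖(-Complex.log (1 - twist D.S D.γ_mul (1 : AddChar G ℂ) s p))
      - (-Complex.log (1 - twist D.S D.γ_mul χ s p))‖ ≤ B p := by
    intro p
    by_cases hS : SuppOn D.S p
    · by_cases hg : χ (D.γ p) = 1
      · rw [twist_of_suppOn _ _ hS, twist_of_suppOn _ _ hS, hg]
        simpa using hB0 p
      · refine (norm_sub_le _ _).trans ?_
        rw [norm_neg, norm_neg]
        refine (add_le_add (hlog 1 p) (hlog χ p)).trans ?_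
        have hmem : (p : ℕ) ∈ D.primesOf (D.γ p) := ⟨p.2, hS.2 p p.2 dvd_rfl, rfl⟩
        have : 1 / ((p : ℕ) : ℝ) ≤ ∑ g ∈ Finset.univ.filter (fun g : G => χ g ≠ 1),
            (D.primesOf g).indicator (fun p : ℕ => 1 / (p : ℝ)) p := by
          have hm : D.γ p ∈ Finset.univ.filter (fun g : G => χ g ≠ 1) :=
            Finset.mem_filter.2 ⟨Finset.mem_univ _, hg⟩
          have h := Finset.single_le_sum (f := fun g : G =>
            (D.primesOf g).indicator (fun p : ℕ => 1 / (p : ℝ)) p)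
            (fun g _ => Set.indicator_nonneg (fun p _ => by positivity) _)
            hm
          simpa only [Set.indicator_of_mem hmem] using h
        simp only [hB]; linarith
    · rw [twist_of_not_suppOn _ _ hS, twist_of_not_suppOn _ _ hS]
      simpa using hB0 p
  have hsub : ∑' p : Nat.Primes, -Complex.log (1 - twist D.S D.γ_mul (1 : AddChar G ℂ) s p)
      = (∑' p : Nat.Primes, ((-Complex.log (1 - twist D.S D.γ_mul (1 : AddChar G ℂ) s p))
      - (-Complex.log (1 - twist D.S D.γ_mul χ s p))))
      + ∑' p : Nat.Primes, -Complex.log (1 - twist D.S D.γ_mul χ s p) := by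
    rw [s1.tsum_sub s2]; ring
  rw [hsub, Complex.exp_add, norm_mul]
  refine mul_le_mul_of_nonneg_right ?_ (norm_nonneg _)
  refine (Complex.norm_exp_le_exp_norm _).trans (Real.exp_le_exp.2 ?_)
  exact tsum_of_norm_bounded (hBs.subtype _).hasSum hterm

/-- The flips `σ g - g` of classes with many split primes generate `H`. -/
theorem mem_closure_flips {h : G} (hh : h ∈ D.H) :
    h ∈ AddSubgroup.closure ((fun g => D.σ g - g) '' D.Splus) := by
  classical
  have := Fintype.ofFinite G
  set K := AddSubgroup.closure ((fun g => D.σ g - g) '' D.Splus) with hK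
  set G' := K.comap (D.σ - AddMonoidHom.id G) with hG'
  obtain ⟨g, rfl⟩ := hh
  suffices hg : g ∈ G' from hg
  by_contra hg
  obtain ⟨ψ, hψ⟩ := (AddChar.exists_apply_ne_zero (a := (g : G ⧸ G'))).2
    (fun h => hg ((QuotientAddGroup.eq_zero_iff g).1 h))
  set χ : AddChar G ℂ := ψ.compAddMonoidHom (QuotientAddGroup.mk' G') with hχ
  have hχG : ∀ g ∈ G', χ g = 1 := by
    intro g hg
    simp only [hχ, AddChar.compAddMonoidHom_apply, QuotientAddGroup.mk'_apply]
    rw [(QuotientAddGroup.eq_zero_iff g).2 hg, AddChar.map_zero_eq_one]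
  have hS1 : ∀ g ∈ D.Splus, g ∈ G' := fun g hg => AddSubgroup.subset_closure ⟨g, hg, rfl⟩
  have hS2 : ∀ g ∈ D.Splus, D.σ g ∈ G' := by
    intro g hg
    have h1 : D.σ g - g ∈ K := AddSubgroup.subset_closure ⟨g, hg, rfl⟩
    have h2 := K.neg_mem h1
    have : (D.σ - AddMonoidHom.id G) (D.σ g) = -(D.σ g - g) := by simp [D.σσ]
    exact (this ▸ h2 : (D.σ - AddMonoidHom.id G) (D.σ g) ∈ K)
  obtain ⟨C₁, hC₁0, hC₁⟩ := D.U_one_le χ fun g hg h => hg (hχG g (hS1 g h))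
  obtain ⟨C₂, hC₂0, hC₂⟩ := D.U_one_le (χ.compAddMonoidHom D.σ) fun g hg h => hg (hχG _ (hS2 g h))
  choose f hf hf' using D.exists_continuation
  have hmem : {s : ℂ | 1 / 2 < s.re} ∈ nhds (1 : ℂ) :=
    (isOpen_lt continuous_const Complex.continuous_re).mem_nhds
      (show (1 / 2 : ℝ) < (1 : ℂ).re by norm_num)
  have hfc : ∀ g, ContinuousAt (f g) 1 := fun g => ((hf g).differentiableAt hmem).continuousAt
  have hVc : ∀ χ, ContinuousAt (D.V χ) 1 := fun χ =>
    ((D.differentiableOn_V χ).differentiableAt hmem).continuousAt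
  have hV1 : D.V χ 1 ≠ 0 := D.V_ne_zero χ (by norm_num)
  set R : ℂ → ℝ := fun s => C₁ * C₂ * ‖D.V 1 s / D.V χ s‖ * ‖∑ g, χ g * f g s‖ + ‖∑ g, f g s‖ with hR
  have hRc : ContinuousAt R 1 := by
    have h1 : ContinuousAt (fun s => ∑ g, χ g * f g s) 1 :=
      tendsto_finsetSum _ fun g _ => continuousAt_const.mul (hfc g)
    have h2 : ContinuousAt (fun s => ∑ g, f g s) 1 := tendsto_finsetSum _ fun g _ => hfc g
    have h3 : ContinuousAt (fun s => D.V 1 s / D.V χ s) 1 := (hVc 1).div (hVc χ) hV1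
    exact ((continuousAt_const.mul h3.norm).mul h1.norm).add h2.norm
  have hχs : ∑ g, χ g = 0 := by
    rw [AddChar.sum_eq_zero_iff_ne_zero]
    intro h
    exact hψ (by simpa [hχ] using DFunLike.congr_fun h g)
  have hLχ : ∀ s : ℂ, 1 < s.re → ∑ g, χ g * D.Z g s = ∑ g, χ g * f g s := by
    intro s hs
    simp_rw [fun g => hf' g s hs, mul_add, Finset.sum_add_distrib, ← Finset.sum_mul, hχs]
    ring
  set c : ℝ := Fintype.card G * D.κ with hc
  have hcpos : 0 < c := mul_pos (by exact_mod_cast Fintype.card_pos) D.κ_pos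
  have hL1 : ∀ s : ℂ, 1 < s.re → ∑ g, (1 : AddChar G ℂ) g * D.Z g s = ∑ g, f g s + c / (s - 1) := by
    intro s hs
    simp_rw [fun g => hf' g s hs, AddChar.one_apply, one_mul, Finset.sum_add_distrib]
    simp [hc, mul_div_assoc]
  have hbound : ∀ s : ℂ, 1 < s.re → D.V χ s ≠ 0 → c / ‖s - 1‖ ≤ R s := by
    intro s hs hVs
    have h1 := D.sum_Z 1 hs
    have h2 := D.sum_Z χ hs
    rw [hLχ s hs] at h2
    rw [hL1 s hs] at h1
    have h11 : (1 : AddChar G ℂ).compAddMonoidHom D.σ = 1 := by ext; simp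
    rw [h11] at h1
    have h3 : ‖D.U 1 s * D.U 1 s * D.V 1 s‖ ≤ C₁ * C₂ * ‖D.V 1 s / D.V χ s‖ * ‖∑ g, χ g * f g s‖ := by
      rw [h2]
      simp only [norm_mul, norm_div]
      have hVs' : 0 < ‖D.V χ s‖ := norm_pos_iff.2 hVs
      calc ‖D.U 1 s‖ * ‖D.U 1 s‖ * ‖D.V 1 s‖
          ≤ (C₁ * ‖D.U χ s‖) * (C₂ * ‖D.U (χ.compAddMonoidHom D.σ) s‖) * ‖D.V 1 s‖ := by
            refine mul_le_mul_of_nonneg_right ?_ (norm_nonneg _)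
            exact mul_le_mul (hC₁ s hs) (hC₂ s hs) (norm_nonneg _) (by positivity)
        _ = _ := by field_simp
    have h4 : (c : ℂ) / (s - 1) = D.U 1 s * D.U 1 s * D.V 1 s - ∑ g, f g s := by rw [← h1]; ring
    calc c / ‖s - 1‖ = ‖(c : ℂ) / (s - 1)‖ := by
          rw [norm_div, Complex.norm_real, norm_eq_abs, abs_of_pos hcpos]
      _ ≤ _ := by rw [h4]; exact (norm_sub_le _ _).trans (add_le_add h3 le_rfl)
  have hev : ∀ᶠ s in nhds (1 : ℂ), D.V χ s ≠ 0 ∧ R s < R 1 + 1 ∧ ‖s - 1‖ * (R 1 + 1) < c := by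
    refine ((hVc χ).eventually_ne hV1).and ((hRc.eventually_lt_const (by linarith)).and ?_)
    have : ContinuousAt (fun s : ℂ => ‖s - 1‖ * (R 1 + 1)) 1 := by fun_prop
    exact this.eventually_lt_const (by simpa using hcpos)
  obtain ⟨s, hs, h1, h2, h3⟩ := one_mem_closure_frequently (s₀ := 1) (by simp) hev
  have hpos : 0 < ‖s - 1‖ := by
    rw [norm_pos_iff, sub_ne_zero]; rintro rfl; norm_num at hs
  have h4 := (div_le_iff₀ hpos).1 (hbound s hs h1)
  nlinarith

end ClassData

namespace ClassData
variable {G : Type*} [AddCommGroup G] (D : ClassData G)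

lemma cnt_nonneg (A : Set (ℕ × ℕ)) (x : ℝ) : 0 ≤ cnt A x := Nat.cast_nonneg _

lemma cnt_mono {A B : Set (ℕ × ℕ)} (hAB : A ⊆ B) (hB : B ⊆ D.pairs) (x : ℝ) : cnt A x ≤ cnt B x := by
  unfold cnt
  refine Nat.cast_le.2 (Set.ncard_le_ncard (fun t ht => ⟨hAB ht.1, ht.2⟩)
    ((D.finite_pairs ⌊x⌋₊).subset fun t ht => ⟨hB ht.1, ht.2⟩))

lemma cnt_union {A B : Set (ℕ × ℕ)} (hA : A ⊆ D.pairs) (hB : B ⊆ D.pairs) (hd : Disjoint A B) (x : ℝ) :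
    cnt (A ∪ B) x = cnt A x + cnt B x := by
  unfold cnt
  rw [← Nat.cast_add, ← Set.ncard_union_eq
    (hd.mono (fun t ht => ht.1) (fun t ht => ht.1))
    ((D.finite_pairs ⌊x⌋₊).subset fun t ht => ⟨hA ht.1, ht.2⟩)
    ((D.finite_pairs ⌊x⌋₊).subset fun t ht => ⟨hB ht.1, ht.2⟩)]
  congr 2
  ext t
  simp only [Set.mem_union, Set.mem_ofPred_eq, or_and_right]

lemma cnt_union_le (A B : Set (ℕ × ℕ)) (x : ℝ) : cnt (A ∪ B) x ≤ cnt A x + cnt B x := by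
  unfold cnt
  have : {t ∈ A ∪ B | pairNorm t ≤ ⌊x⌋₊} = {t ∈ A | pairNorm t ≤ ⌊x⌋₊} ∪ {t ∈ B | pairNorm t ≤ ⌊x⌋₊} := by
    ext t
    simp only [Set.mem_union, Set.mem_ofPred_eq, or_and_right]
  rw [this]
  exact_mod_cast Set.ncard_union_le _ _

variable {D}

lemma HasDens.union {A B : Set (ℕ × ℕ)} (hA : A ⊆ D.pairs) (hB : B ⊆ D.pairs) (hd : Disjoint A B)
    {a b : ℝ} (ha : HasDens A a) (hb : HasDens B b) : HasDens (A ∪ B) (a + b) := by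
  unfold HasDens at *
  refine (ha.add hb).congr fun x => ?_
  rw [D.cnt_union hA hB hd]; ring

lemma HasDens.diff {A B : Set (ℕ × ℕ)} (hB : B ⊆ A) (hA : A ⊆ D.pairs)
    {a b : ℝ} (ha : HasDens A a) (hb : HasDens B b) : HasDens (A \ B) (a - b) := by
  unfold HasDens at *
  refine (ha.sub hb).congr fun x => ?_
  have := D.cnt_union (hB.trans hA) (Set.sdiff_subset.trans hA) (Set.disjoint_sdiff_right (s := B) (t := A)) x
  rw [Set.union_sdiff_cancel hB] at this
  rw [this]; ring

lemma HasDens.empty : HasDens ∅ 0 := by simp [HasDens, cnt]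

lemma eventually_sqrt_log_div_nonneg : ∀ᶠ x : ℝ in atTop, 0 ≤ √(log x) / x := by
  filter_upwards [eventually_ge_atTop 0] with x hx
  positivity

lemma HasDens.union_zero {A B : Set (ℕ × ℕ)} (ha : HasDens A 0) (hb : HasDens B 0) :
    HasDens (A ∪ B) 0 := by
  unfold HasDens at *
  refine squeeze_zero' ?_ ?_ (by simpa using ha.add hb)
  · filter_upwards [eventually_sqrt_log_div_nonneg] with x hx
    rw [mul_div_assoc]
    exact mul_nonneg (cnt_nonneg _ _) hx
  · filter_upwards [eventually_sqrt_log_div_nonneg] with x hx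
    have := mul_le_mul_of_nonneg_right (cnt_union_le A B x) hx
    calc _ = cnt (A ∪ B) x * (√(log x) / x) := mul_div_assoc _ _ _
      _ ≤ _ := this
      _ = _ := by ring

lemma HasDens.mono_zero {A B : Set (ℕ × ℕ)} (hAB : A ⊆ B) (hB : B ⊆ D.pairs) (hb : HasDens B 0) :
    HasDens A 0 := by
  unfold HasDens at *
  refine squeeze_zero' ?_ ?_ hb
  · filter_upwards [eventually_sqrt_log_div_nonneg] with x hx
    rw [mul_div_assoc]
    exact mul_nonneg (cnt_nonneg _ _) hx
  · filter_upwards [eventually_sqrt_log_div_nonneg] with x hx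
    rw [mul_div_assoc, mul_div_assoc]
    exact mul_le_mul_of_nonneg_right (D.cnt_mono hAB hB x) hx

lemma HasDens.iUnion_zero {ι : Type*} [Finite ι] {A : ι → Set (ℕ × ℕ)} (h : ∀ i, HasDens (A i) 0) :
    HasDens (⋃ i, A i) 0 := by
  classical
  have := Fintype.ofFinite ι
  have : ∀ s : Finset ι, HasDens (⋃ i ∈ s, A i) 0 := by
    intro s
    induction s using Finset.induction_on with
    | empty => simpa using HasDens.empty
    | insert i s hi ih => rw [Finset.set_biUnion_insert]; exact (h i).union_zero ih
  simpa using this Finset.univ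

lemma exists_hasDens_iUnion {ι : Type*} [Finite ι] {A : ι → Set (ℕ × ℕ)} (hA : ∀ i, A i ⊆ D.pairs)
    (hd : Pairwise (Function.onFun Disjoint A)) (s : Set ι) (h : ∀ i, ∃ F, HasDens (A i) F) :
    ∃ F, HasDens (⋃ i ∈ s, A i) F := by
  classical
  have := Fintype.ofFinite ι
  have : ∀ s : Finset ι, ∃ F, HasDens (⋃ i ∈ s, A i) F := by
    intro s
    induction s using Finset.induction_on with
    | empty => exact ⟨0, by simpa using HasDens.empty⟩
    | insert i s hi ih =>
      obtain ⟨a, ha⟩ := h i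
      obtain ⟨b, hb⟩ := ih
      rw [Finset.set_biUnion_insert]
      refine ⟨a + b, ha.union (hA i) (Set.iUnion₂_subset fun j _ => hA j) ?_ hb⟩
      rw [Set.disjoint_iUnion₂_right]
      exact fun j hj => hd (fun e => hi (e ▸ hj))
  simpa using this s.toFinite.toFinset

lemma tendsto_sqrt_log_div {k : ℝ} (hk : 0 < k) :
    Tendsto (fun x : ℝ => √(log x) / √(log (x / k))) atTop (nhds 1) := by
  have h0 : Tendsto (fun x : ℝ => log k / log (x / k)) atTop (nhds 0) :=
    Tendsto.const_div_atTop (tendsto_log_atTop.comp (tendsto_id.atTop_div_const hk)) _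
  have h1 : Tendsto (fun x : ℝ => √(1 + log k / log (x / k))) atTop (nhds 1) := by
    simpa using (h0.const_add 1).sqrt
  refine h1.congr' ?_
  filter_upwards [eventually_gt_atTop k, eventually_gt_atTop 0] with x hx hx0
  have h2 : 0 < log (x / k) := log_pos ((one_lt_div hk).2 hx)
  rw [← Real.sqrt_div' _ h2.le, log_div hx0.ne' hk.ne']
  rw [log_div hx0.ne' hk.ne'] at h2
  congr 1
  field_simp
  ring

lemma tendsto_scale {f : ℝ → ℝ} {F : ℝ} (h : Tendsto (fun x : ℝ => f x * √(log x) / x) atTop (nhds F))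
    {k : ℝ} (hk : 0 < k) :
    Tendsto (fun x : ℝ => f (x / k) * √(log x) / x) atTop (nhds (F / k)) := by
  have h1 := ((h.comp (tendsto_id.atTop_div_const hk)).mul (tendsto_sqrt_log_div hk)).div_const k
  rw [mul_one] at h1
  refine h1.congr' ?_
  filter_upwards [eventually_gt_atTop k, eventually_gt_atTop 0] with x hx hx0
  have h2 : 0 < √(log (x / k)) := Real.sqrt_pos.2 (log_pos ((one_lt_div hk).2 hx))
  simp only [Function.comp, id]
  field_simp

variable (D)

/-- Pairs whose split part is prime to all the elements of `P`. -/
def avoid (P : Finset ℕ) : Set (ℕ × ℕ) := {t ∈ D.pairs | ∀ p ∈ P, ¬p ∣ t.1}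

lemma cnt_avoid_insert {P : Finset ℕ} (hP : ∀ p ∈ P, Nat.Prime p) {p : ℕ} (hp : p.Prime) (hpS : p ∈ D.S)
    (hpP : p ∉ P) (x : ℝ) :
    cnt (D.avoid P) x = cnt (D.avoid (insert p P)) x + cnt (D.avoid P) (x / p) := by
  have h1 : D.avoid P = D.avoid (insert p P) ∪ {t ∈ D.avoid P | p ∣ t.1} := by
    ext t
    simp only [avoid, Set.mem_union, Set.mem_ofPred_eq, Finset.mem_insert, forall_eq_or_imp]
    tauto
  have h2 : cnt {t ∈ D.avoid P | p ∣ t.1} x = cnt (D.avoid P) (x / p) := by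
    unfold cnt
    congr 1
    symm
    refine Set.ncard_congr (fun t _ => (p * t.1, t.2)) ?_ ?_ ?_
    · rintro ⟨a, c⟩ ⟨⟨⟨ha, hc⟩, hav⟩, hn⟩
      refine ⟨⟨⟨⟨suppOn_mul_iff.2 ⟨⟨hp.ne_zero, fun q hq hqp => ?_⟩, ha⟩, hc⟩, fun q hq hqa => ?_⟩,
        dvd_mul_right _ _⟩, ?_⟩
      · rwa [(Nat.prime_dvd_prime_iff_eq hq hp).1 hqp]
      · rcases (hP q hq).dvd_mul.1 hqa with h | h
        · exact hpP ((Nat.prime_dvd_prime_iff_eq (hP q hq) hp).1 h ▸ hq)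
        · exact hav q hq h
      · simp only [pairNorm] at hn ⊢
        rw [Nat.floor_div_natCast, Nat.le_div_iff_mul_le hp.pos] at hn
        linarith
    · rintro ⟨a, c⟩ ⟨b, d⟩ _ _ h
      simp only [Prod.mk.injEq, mul_eq_mul_left_iff, hp.ne_zero, or_false] at h
      rw [h.1, h.2]
    · rintro ⟨a, c⟩ ⟨⟨⟨⟨ha, hc⟩, hav⟩, b, hb⟩, hn⟩
      simp only at hb ha hc hav
      subst hb
      refine ⟨(b, c), ⟨⟨⟨(suppOn_mul_iff.1 ha).2, hc⟩, fun q hq h => hav q hq (h.mul_left _)⟩, ?_⟩, rfl⟩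
      simp only [pairNorm] at hn ⊢
      rw [Nat.floor_div_natCast, Nat.le_div_iff_mul_le hp.pos]
      linarith
  rw [← h2]
  conv_lhs => rw [h1]
  refine D.cnt_union (fun t ht => ht.1) (fun t ht => ht.1.1) ?_ x
  rw [Set.disjoint_left]
  exact fun t ht h => ht.2 p (Finset.mem_insert_self _ _) h.2

lemma hasDens_avoid {F : ℝ} (hF : HasDens D.pairs F) (P : Finset ℕ)
    (hP : ∀ p ∈ P, Nat.Prime p ∧ p ∈ D.S) :
    HasDens (D.avoid P) (F * ∏ p ∈ P, (1 - 1 / (p : ℝ))) := by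
  induction P using Finset.induction_on with
  | empty => simpa [avoid] using hF
  | insert p P hp ih =>
    have hP' := fun q hq => hP q (Finset.mem_insert_of_mem hq)
    have ih := ih hP'
    obtain ⟨hpp, hpS⟩ := hP p (Finset.mem_insert_self _ _)
    have h1 := Tendsto.sub ih (tendsto_scale ih (k := p) (by exact_mod_cast hpp.pos))
    have e : F * ∏ q ∈ insert p P, (1 - 1 / (q : ℝ)) = F * ∏ q ∈ P, (1 - 1 / (q : ℝ))
        - F * (∏ q ∈ P, (1 - 1 / (q : ℝ))) / p := by
      rw [Finset.prod_insert hp]; ring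
    rw [e]
    refine h1.congr fun x => ?_
    rw [D.cnt_avoid_insert (fun q hq => (hP' q hq).1) hpp hpS hp x]; ring

lemma exists_prod_lt {g : G} (hg : g ∈ D.Splus) (F₀ : Finset ℕ) {ε : ℝ} (hε : 0 < ε) :
    ∃ P : Finset ℕ, (∀ p ∈ P, p ∈ D.primesOf g ∧ p ∉ F₀) ∧ ∏ p ∈ P, (1 - 1 / (p : ℝ)) < ε := by
  classical
  set f : ℕ → ℝ := (D.primesOf g \ F₀).indicator fun p : ℕ => 1 / (p : ℝ) with hf
  have hf0 : ∀ p, 0 ≤ f p := fun p => Set.indicator_nonneg (fun p _ => by positivity) p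
  have hns : ¬Summable f := by
    intro h
    refine hg ?_
    have h2 : Summable ((F₀ : Set ℕ).indicator fun p : ℕ => (D.primesOf g).indicator (fun p : ℕ => 1 / (p : ℝ)) p) :=
      summable_of_hasFiniteSupport (F₀.finite_toSet.subset (by
        intro p hp
        by_contra h
        exact hp (Set.indicator_of_notMem h _)))
    refine (h.add h2).congr fun p => ?_
    by_cases h1 : p ∈ (F₀ : Set ℕ) <;> by_cases h3 : p ∈ D.primesOf g <;>
      simp [hf, Set.indicator, h1, h3]
  have ht := (not_summable_iff_tendsto_nat_atTop_of_nonneg hf0).1 hns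
  obtain ⟨n, hn⟩ := (ht.eventually_gt_atTop (-log ε)).exists
  refine ⟨(Finset.range n).filter (fun p => p ∈ D.primesOf g ∧ p ∉ F₀), fun p hp =>
    (Finset.mem_filter.1 hp).2, ?_⟩
  have h1 : ∑ p ∈ (Finset.range n).filter (fun p => p ∈ D.primesOf g ∧ p ∉ F₀), 1 / (p : ℝ)
      = ∑ p ∈ Finset.range n, f p := by
    rw [Finset.sum_filter]
    refine Finset.sum_congr rfl fun p _ => ?_
    simp only [hf, Set.indicator, Set.mem_sdiff, Finset.mem_coe]
  calc ∏ p ∈ (Finset.range n).filter (fun p => p ∈ D.primesOf g ∧ p ∉ F₀), (1 - 1 / (p : ℝ))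
      ≤ ∏ p ∈ (Finset.range n).filter (fun p => p ∈ D.primesOf g ∧ p ∉ F₀), exp (-(1 / (p : ℝ))) := by
        refine Finset.prod_le_prod (fun p hp => ?_) (fun p hp => ?_)
        · have := (Finset.mem_filter.1 hp).2.1.1.one_le
          have h3 : (1 : ℝ) ≤ p := by exact_mod_cast this
          have := (div_le_one (by linarith)).2 h3
          linarith
        · have := add_one_le_exp (-(1 / (p : ℝ)))
          linarith
    _ = exp (-∑ p ∈ Finset.range n, f p) := by
        rw [← Real.exp_sum, Finset.sum_neg_distrib, h1]
    _ < exp (log ε) := exp_lt_exp.2 (by linarith)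
    _ = ε := exp_log hε

/-- Pairs whose split part has no divisor changing the class by `h`. -/
def stuck (h : G) : Set (ℕ × ℕ) := {t ∈ D.pairs | ¬∃ d, d ∣ t.1 ∧ D.σ (D.γ d) - D.γ d = h}

lemma γ_one : D.γ 1 = 0 := by simpa using D.γ_mul 1 1 one_ne_zero one_ne_zero

variable [Finite G]

lemma exists_hasDens_pairs : ∃ F, HasDens D.pairs F := by
  have := exists_hasDens_iUnion (D := D) (A := fun h : G ⧸ D.H => {t ∈ D.pairs | D.genus t = h})
    (fun h t ht => ht.1) (fun h h' hh => by
      simp only [Function.onFun, Set.disjoint_left]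
      exact fun t ht ht' => hh (ht.2.symm.trans ht'.2)) Set.univ D.exists_hasDens_genus
  convert this using 3
  ext t
  simp

theorem hasDens_stuck {h : G} (hh : h ∈ D.H) : HasDens (D.stuck h) 0 := by
  classical
  obtain ⟨F, hF⟩ := D.exists_hasDens_pairs
  have key : ∀ ε > 0, ∀ F₀ : Finset ℕ, ∃ F₁ : Finset ℕ, ∀ᶠ x : ℝ in atTop,
      cnt {t ∈ D.pairs | ¬∃ d, d ∣ t.1 ∧ D.σ (D.γ d) - D.γ d = h ∧
        ∀ p, p.Prime → p ∣ d → p ∈ F₁ ∧ p ∉ F₀} x * √(log x) / x < ε := by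
    replace hh := D.mem_closure_flips hh
    rw [← AddSubgroup.mem_toAddSubmonoid, AddSubgroup.closure_toAddSubmonoid_of_finite] at hh
    induction hh using AddSubmonoid.closure_induction with
    | mem h hh =>
      obtain ⟨g, hg, rfl⟩ := hh
      intro ε hε F₀
      obtain ⟨P, hP, hPε⟩ := D.exists_prod_lt hg F₀ (ε := ε / (|F| + 1)) (by positivity)
      refine ⟨P, ?_⟩
      have h1 := D.hasDens_avoid hF P fun p hp => ⟨(hP p hp).1.1, (hP p hp).1.2.1⟩
      have h2 : F * ∏ p ∈ P, (1 - 1 / (p : ℝ)) < ε := by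
        have h0 : 0 ≤ ∏ p ∈ P, (1 - 1 / (p : ℝ)) := by
          refine Finset.prod_nonneg fun p hp => ?_
          have := (hP p hp).1.1.one_le
          have h3 : (1 : ℝ) ≤ p := by exact_mod_cast this
          have := (div_le_one (by linarith)).2 h3
          linarith
        rw [lt_div_iff₀ (by positivity)] at hPε
        nlinarith [le_abs_self F, abs_nonneg F]
      filter_upwards [h1.eventually_lt_const h2, eventually_sqrt_log_div_nonneg] with x hx hx0
      refine lt_of_le_of_lt ?_ hx
      rw [mul_div_assoc, mul_div_assoc]
      refine mul_le_mul_of_nonneg_right (D.cnt_mono ?_ (fun t ht => ht.1) x) hx0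
      refine fun t ht => ⟨ht.1, fun p hp hpt => ht.2 ?_⟩
      refine ⟨p, hpt, by rw [(hP p hp).1.2.2], fun q hq hqp => ?_⟩
      rw [(Nat.prime_dvd_prime_iff_eq hq (hP p hp).1.1).1 hqp]
      exact ⟨hp, (hP p hp).2⟩
    | zero =>
      intro ε hε F₀
      refine ⟨∅, Eventually.of_forall fun x => ?_⟩
      have : {t ∈ D.pairs | ¬∃ d, d ∣ t.1 ∧ D.σ (D.γ d) - D.γ d = 0 ∧
        ∀ p, p.Prime → p ∣ d → p ∈ (∅ : Finset ℕ) ∧ p ∉ F₀} = ∅ := by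
        refine Set.eq_empty_of_forall_notMem fun t ht => ht.2 ⟨1, one_dvd _, by simp [D.γ_one], ?_⟩
        exact fun p hp h => absurd (Nat.dvd_one.1 h) hp.ne_one
      rw [this]
      simpa [cnt] using hε
    | add h h' _ _ h1 h2 =>
      intro ε hε F₀
      obtain ⟨F₁, hF₁⟩ := h1 (ε / 2) (half_pos hε) F₀
      obtain ⟨F₂, hF₂⟩ := h2 (ε / 2) (half_pos hε) (F₀ ∪ F₁)
      refine ⟨F₁ ∪ F₂, ?_⟩
      filter_upwards [hF₁, hF₂, eventually_sqrt_log_div_nonneg] with x hx1 hx2 hx0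
      rw [mul_div_assoc] at hx1 hx2 ⊢
      refine lt_of_le_of_lt ?_ (lt_of_lt_of_eq (add_lt_add hx1 hx2) (add_halves ε))
      rw [← add_mul]
      refine mul_le_mul_of_nonneg_right (le_trans (D.cnt_mono ?_ ?_ x) (cnt_union_le _ _ _)) hx0
      · rintro t ⟨ht, hn⟩
        by_contra hcon
        rw [Set.mem_union, not_or] at hcon
        have e1 := not_not.1 fun h => hcon.1 ⟨ht, h⟩
        have e2 := not_not.1 fun h => hcon.2 ⟨ht, h⟩
        obtain ⟨d, hd, hdh, hdF⟩ := e1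
        obtain ⟨e, he, heh, heF⟩ := e2
        have hd0 : d ≠ 0 := fun h => ht.1.1 (Nat.eq_zero_of_zero_dvd (h ▸ hd))
        have he0 : e ≠ 0 := fun h => ht.1.1 (Nat.eq_zero_of_zero_dvd (h ▸ he))
        refine hn ⟨d * e, Nat.Coprime.mul_dvd_of_dvd_of_dvd ?_ hd he, ?_, ?_⟩
        · refine Nat.coprime_of_dvd fun p hp hpd hpe => ?_
          exact (heF p hp hpe).2 (Finset.mem_union_right _ (hdF p hp hpd).1)
        · rw [D.γ_mul d e hd0 he0, map_add, ← hdh, ← heh]; abel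
        · intro p hp hpde
          rcases hp.dvd_mul.1 hpde with h | h
          · exact ⟨Finset.mem_union_left _ (hdF p hp h).1, (hdF p hp h).2⟩
          · exact ⟨Finset.mem_union_right _ (heF p hp h).1,
              fun h' => (heF p hp h).2 (Finset.mem_union_left _ h')⟩
      · exact Set.union_subset (fun t ht => ht.1) (fun t ht => ht.1)
  rw [HasDens, Metric.tendsto_nhds]
  intro ε hε
  obtain ⟨F₁, hF₁⟩ := key ε hε ∅
  filter_upwards [hF₁, eventually_sqrt_log_div_nonneg] with x hx hx0
  rw [Real.dist_0_eq_abs, mul_div_assoc, abs_of_nonneg (mul_nonneg (cnt_nonneg _ _) hx0)]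
  refine lt_of_le_of_lt ?_ hx
  rw [mul_div_assoc]
  refine mul_le_mul_of_nonneg_right (D.cnt_mono ?_ (fun t ht => ht.1) x) hx0
  refine fun t ht => ⟨ht.1, fun h => ht.2 ?_⟩
  obtain ⟨d, h1, h2, h3⟩ := h
  exact ⟨d, h1, h2⟩

/-- Pairs whose norm is the norm of an ideal with class in `T`. -/
def attained (T : Set G) : Set (ℕ × ℕ) :=
  {t ∈ D.pairs | ∃ a b, a * b = t.1 ∧ D.γ a + D.σ (D.γ b) + D.γ t.2 ∈ T}

theorem exists_hasDens_attained (T : Set G) : ∃ F, HasDens (D.attained T) F := by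
  set Y : Set (ℕ × ℕ) := ⋃ h ∈ ((fun g : G => (g : G ⧸ D.H)) '' T), {t ∈ D.pairs | D.genus t = h} with hY
  obtain ⟨F, hF⟩ : ∃ F, HasDens Y F := exists_hasDens_iUnion (D := D)
    (A := fun h : G ⧸ D.H => {t ∈ D.pairs | D.genus t = h})
    (fun h t ht => ht.1) (fun h h' hh => by
      simp only [Function.onFun, Set.disjoint_left]
      exact fun t ht ht' => hh (ht.2.symm.trans ht'.2)) _ D.exists_hasDens_genus
  have hYp : Y ⊆ D.pairs := Set.iUnion₂_subset fun h _ t ht => ht.1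
  have hmem : ∀ t ∈ D.pairs, t ∈ Y ↔ ∃ τ ∈ T, τ - (D.γ t.1 + D.γ t.2) ∈ D.H := by
    intro t ht
    simp only [hY, Set.mem_iUnion, Set.mem_image, Set.mem_ofPred_eq, exists_prop]
    constructor
    · rintro ⟨_, ⟨τ, hτ, rfl⟩, _, h⟩
      exact ⟨τ, hτ, (QuotientAddGroup.eq_iff_sub_mem).1 h.symm⟩
    · rintro ⟨τ, hτ, h⟩
      exact ⟨_, ⟨τ, hτ, rfl⟩, ht, ((QuotientAddGroup.eq_iff_sub_mem).2 h).symm⟩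
  have hsub : D.attained T ⊆ Y := by
    rintro t ⟨ht, a, b, hab, hT⟩
    refine (hmem t ht).2 ⟨_, hT, ⟨D.γ b, ?_⟩⟩
    have hne : a * b ≠ 0 := hab ▸ ht.1.1
    rw [← hab, D.γ_mul a b (left_ne_zero_of_mul hne) (right_ne_zero_of_mul hne)]
    simp only [AddMonoidHom.sub_apply, AddMonoidHom.id_apply]
    abel
  have hdiff : HasDens (Y \ D.attained T) 0 := by
    refine HasDens.mono_zero (D := D) ?_ ?_ (HasDens.iUnion_zero (A := fun h : D.H => D.stuck h)
      fun h => D.hasDens_stuck h.2)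
    · rintro t ⟨htY, hta⟩
      have ht := hYp htY
      obtain ⟨τ, hτ, hH⟩ := (hmem t ht).1 htY
      refine Set.mem_iUnion.2 ⟨⟨_, hH⟩, ht, ?_⟩
      rintro ⟨d, ⟨e, he⟩, hd⟩
      refine hta ⟨ht, e, d, by rw [he, mul_comm], ?_⟩
      have hne : d * e ≠ 0 := he ▸ ht.1.1
      simp only at hd
      have hγ := D.γ_mul d e (left_ne_zero_of_mul hne) (right_ne_zero_of_mul hne)
      rw [← he] at hγ
      rw [hγ] at hd
      have : D.γ e + D.σ (D.γ d) + D.γ t.2 = τ := by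
        rw [sub_eq_iff_eq_add.1 hd]; abel
      rwa [this]
    · exact Set.iUnion_subset fun h t ht => ht.1
  refine ⟨F - 0, ?_⟩
  have := hF.diff (Set.sdiff_subset (s := Y) (t := D.attained T)) hYp hdiff
  rwa [Set.sdiff_sdiff_cancel_left hsub] at this

end ClassData

/-- Reciprocal square roots of numbers with prime factors in a finite set are summable. -/
lemma summable_suppOn_rpow (P : Finset ℕ) :
    Summable ({a : ℕ | SuppOn P a}.indicator fun a : ℕ => (a : ℝ) ^ (-(1 / 2) : ℝ)) := by
  let f : ℕ →* ℝ :=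
    { toFun := fun n => (n : ℝ) ^ (-(1 / 2) : ℝ)
      map_one' := by simp
      map_mul' := fun m n => by
        rw [Nat.cast_mul, Real.mul_rpow (Nat.cast_nonneg _) (Nat.cast_nonneg _)] }
  have h := (EulerProduct.summable_and_hasSum_factoredNumbers_prod_filter_prime_geometric (f := f)
    (fun {p} hp => by
      have : (1 : ℝ) < p := by exact_mod_cast hp.one_lt
      change ‖(p : ℝ) ^ (-(1 / 2) : ℝ)‖ < 1
      rw [norm_of_nonneg (by positivity)]
      exact Real.rpow_lt_one_of_one_lt_of_neg this (by norm_num)) P).1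
  have h2 : {a : ℕ | SuppOn P a} = Nat.factoredNumbers P := by
    ext a
    simp only [SuppOn, Set.mem_ofPred_eq, Nat.factoredNumbers]
    refine and_congr_right fun h0 => ⟨fun h p hp => ?_, fun h p hp hpa => ?_⟩
    · exact h p (Nat.prime_of_mem_primeFactorsList hp) (Nat.dvd_of_mem_primeFactorsList hp)
    · exact h p ((Nat.mem_primeFactorsList h0).2 ⟨hp, hpa⟩)
  rw [h2, ← summable_subtype_iff_indicator]
  exact h.of_norm

namespace ClassData
variable {G : Type*} [AddCommGroup G] (D : ClassData G) [Finite G]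

lemma exists_cnt_le : ∃ K : ℝ, 0 ≤ K ∧ ∀ y : ℝ, 1 ≤ y → cnt D.pairs y ≤ K * y / √(1 + log y) := by
  obtain ⟨F, hF⟩ := D.exists_hasDens_pairs
  obtain ⟨X, hX⟩ := eventually_atTop.1 (hF.eventually_lt_const (lt_add_one F))
  set Y := max X 3 with hY
  refine ⟨max (2 * |F + 1|) (cnt D.pairs Y), le_max_of_le_right (cnt_nonneg _ _), fun y hy => ?_⟩
  have hl : 0 ≤ log y := log_nonneg hy
  have hs : 0 < √(1 + log y) := Real.sqrt_pos.2 (by linarith)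
  rw [le_div_iff₀ hs]
  rcases le_total y Y with h | h
  · have h1 : cnt D.pairs y ≤ cnt D.pairs Y := by
      unfold cnt
      refine Nat.cast_le.2 (Set.ncard_le_ncard (fun t ht => ⟨ht.1, ht.2.trans (Nat.floor_mono h)⟩)
        (D.finite_pairs _))
    have h2 : √(1 + log y) ≤ y := by
      rw [Real.sqrt_le_left (by linarith)]
      nlinarith [log_le_sub_one_of_pos (show 0 < y by linarith)]
    have h3 : cnt D.pairs Y ≤ max (2 * |F + 1|) (cnt D.pairs Y) := le_max_right _ _
    exact mul_le_mul (h1.trans h3) h2 hs.le ((cnt_nonneg _ _).trans h3)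
  · have h1 := hX y ((le_max_left _ _).trans h)
    have h3 : 3 ≤ y := (le_max_right _ _).trans h
    have hl1 : 1 ≤ log y := by
      rw [Real.le_log_iff_exp_le (by linarith)]
      linarith [Real.exp_one_lt_d9]
    rw [div_lt_iff₀ (by linarith)] at h1
    have h2 : √(1 + log y) ≤ 2 * √(log y) := by
      rw [Real.sqrt_le_left (by positivity), mul_pow, Real.sq_sqrt hl]
      linarith
    calc cnt D.pairs y * √(1 + log y) ≤ cnt D.pairs y * (2 * √(log y)) :=
          mul_le_mul_of_nonneg_left h2 (cnt_nonneg _ _)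
      _ ≤ 2 * ((F + 1) * y) := by linarith
      _ ≤ 2 * (|F + 1| * y) := by
          have := mul_le_mul_of_nonneg_right (le_abs_self (F + 1)) (show 0 ≤ y by linarith)
          linarith
      _ ≤ _ := by rw [← mul_assoc]; exact mul_le_mul_of_nonneg_right (le_max_left _ _) (by linarith)

omit [Finite G] in
lemma cnt_eq_zero {A : Set (ℕ × ℕ)} (hA : A ⊆ D.pairs) {x : ℝ} (hx : x < 1) : cnt A x = 0 := by
  unfold cnt
  have : {t ∈ A | pairNorm t ≤ ⌊x⌋₊} = ∅ := by
    refine Set.eq_empty_of_forall_notMem fun t ht => D.pairNorm_ne_zero t (hA ht.1) ?_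
    have := ht.2
    rw [Nat.floor_eq_zero.2 hx] at this
    omega
  simp [this]

/-- Numbers `a N` with `a` supported on `P` and `N` the norm of an ideal with class in `T a`. -/
def values (P : Finset ℕ) (T : ℕ → Set G) : Set ℕ :=
  {n | ∃ a t, SuppOn P a ∧ t ∈ D.attained (T a) ∧ n = a * pairNorm t}

variable {D}

omit [Finite G] in
lemma ncard_values {P : Finset ℕ} (hP : ∀ p ∈ P, p ∉ D.S ∧ p ∉ D.Q) (T : ℕ → Set G) (x : ℝ) :
    ({n ∈ D.values P T | n ≤ ⌊x⌋₊}.ncard : ℝ) = ∑ a ∈ Finset.range (⌊x⌋₊ + 1),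
      {a : ℕ | SuppOn P a}.indicator (fun a : ℕ => cnt (D.attained (T a)) (x / a)) a := by
  classical
  have hfin : ∀ a : ℕ, {t ∈ D.attained (T a) | pairNorm t ≤ ⌊x / a⌋₊}.Finite := fun a =>
    (D.finite_pairs ⌊x / a⌋₊).subset fun t ht => ⟨ht.1.1, ht.2⟩
  have hcop : ∀ a, SuppOn P a → ∀ t ∈ D.pairs, Nat.Coprime a (pairNorm t) := by
    intro a ha t ht
    refine Nat.coprime_of_dvd fun p hp hpa hpt => ?_
    obtain ⟨h1, h2⟩ := hP p (ha.2 p hp hpa)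
    rcases hp.dvd_mul.1 hpt with h | h
    · exact h1 (ht.1.2 p hp h)
    · exact h2 (ht.2.2 p hp (hp.dvd_of_dvd_pow h))
  set B : Finset ℕ := (Finset.range (⌊x⌋₊ + 1)).filter (fun a => SuppOn P a) with hB
  have hset : {n ∈ D.values P T | n ≤ ⌊x⌋₊} =
      (B.biUnion fun a => (hfin a).toFinset.image fun t => a * pairNorm t : Finset ℕ) := by
    ext n
    simp only [Set.mem_ofPred_eq, Finset.coe_biUnion, Set.mem_iUnion, Finset.coe_image,
      Set.Finite.coe_toFinset, Set.mem_image, hB, Finset.mem_coe, Finset.mem_filter,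
      Finset.mem_range, values, exists_prop]
    constructor
    · rintro ⟨⟨a, t, ha, ht, rfl⟩, hn⟩
      have hp := Nat.pos_of_ne_zero (D.pairNorm_ne_zero t ht.1)
      refine ⟨a, ⟨?_, ha⟩, t, ⟨ht, ?_⟩, rfl⟩
      · have := Nat.le_mul_of_pos_right a hp
        omega
      · rw [Nat.floor_div_natCast, Nat.le_div_iff_mul_le (Nat.pos_of_ne_zero ha.1)]
        linarith
    · rintro ⟨a, ⟨_, ha⟩, t, ⟨ht, hn⟩, rfl⟩
      refine ⟨⟨a, t, ha, ht, rfl⟩, ?_⟩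
      rw [Nat.floor_div_natCast, Nat.le_div_iff_mul_le (Nat.pos_of_ne_zero ha.1)] at hn
      linarith
  rw [hset, Set.ncard_coe_finset, Finset.card_biUnion, Nat.cast_sum, hB, Finset.sum_filter]
  · refine Finset.sum_congr rfl fun a _ => ?_
    by_cases ha : SuppOn P a
    · rw [if_pos ha, Set.indicator_of_mem (show a ∈ {a : ℕ | SuppOn P a} from ha), cnt,
        Finset.card_image_of_injOn, Set.ncard_eq_toFinset_card _ (hfin a)]
      intro s hs t ht hst
      rw [Set.Finite.coe_toFinset] at hs ht
      simp only [mul_eq_mul_left_iff, ha.1, or_false] at hst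
      exact D.pairNorm_injOn hs.1.1 ht.1.1 hst
    · rw [if_neg ha, Set.indicator_of_notMem (show a ∉ {a : ℕ | SuppOn P a} from ha)]
  · intro a ha b hb hab
    rw [Function.onFun, Finset.disjoint_left]
    intro n hna hnb
    simp only [Finset.mem_image, Set.Finite.mem_toFinset] at hna hnb
    obtain ⟨s, hs, rfl⟩ := hna
    obtain ⟨t, ht, hst⟩ := hnb
    have ha := (Finset.mem_filter.1 ha).2
    have hb := (Finset.mem_filter.1 hb).2
    refine hab (Nat.dvd_antisymm ?_ ?_)
    · exact (hcop a ha t ht.1.1).dvd_of_dvd_mul_right (hst ▸ dvd_mul_right _ _)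
    · exact (hcop b hb s hs.1.1).dvd_of_dvd_mul_right (hst ▸ dvd_mul_right _ _)

theorem exists_tendsto_values {P : Finset ℕ} (hP : ∀ p ∈ P, p ∉ D.S ∧ p ∉ D.Q) (T : ℕ → Set G) :
    ∃ F, Tendsto (fun x : ℝ => ({n ∈ D.values P T | n ≤ ⌊x⌋₊}.ncard : ℝ) * √(log x) / x) atTop
      (nhds F) := by
  classical
  choose F hF using D.exists_hasDens_attained
  obtain ⟨K, hK0, hK⟩ := D.exists_cnt_le
  have hmain := tendsto_tsum_of_dominated_convergence (𝓕 := atTop)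
    (f := fun (x : ℝ) (a : ℕ) => {a : ℕ | SuppOn P a}.indicator
      (fun a : ℕ => cnt (D.attained (T a)) (x / a) * √(log x) / x) a)
    (g := {a : ℕ | SuppOn P a}.indicator fun a : ℕ => F (T a) / a)
    ((summable_suppOn_rpow P).mul_left K) ?_ ?_
  · refine ⟨_, hmain.congr' ?_⟩
    filter_upwards [eventually_ge_atTop 0] with x hx
    rw [ncard_values hP, tsum_eq_sum (s := Finset.range (⌊x⌋₊ + 1)), mul_div_assoc, Finset.sum_mul]
    · refine Finset.sum_congr rfl fun a _ => ?_
      simp only [Set.indicator]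
      split_ifs
      · ring
      · simp
    · intro a ha
      simp only [Set.indicator]
      split_ifs with h
      · have h1 : x < a := by
          rw [Finset.mem_range, not_lt] at ha
          exact (Nat.floor_lt hx).1 (by omega)
        have ha0 : (0 : ℝ) < a := lt_of_le_of_lt hx h1
        rw [D.cnt_eq_zero (fun t ht => ht.1) ((div_lt_one ha0).2 h1)]
        simp
      · rfl
  · intro a
    by_cases ha : SuppOn P a
    · have ha0 : (0 : ℝ) < a := Nat.cast_pos.2 (Nat.pos_of_ne_zero ha.1)
      simp only [Set.indicator, Set.mem_ofPred_eq, if_pos ha]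
      exact tendsto_scale (hF (T a)) ha0
    · simp only [Set.indicator, Set.mem_ofPred_eq, if_neg ha]
      exact tendsto_const_nhds
  · filter_upwards [eventually_ge_atTop 1] with x hx a
    by_cases ha : SuppOn P a
    · have ha1 : (1 : ℝ) ≤ a := Nat.one_le_cast.2 (Nat.pos_of_ne_zero ha.1)
      simp only [Set.indicator, Set.mem_ofPred_eq, if_pos ha]
      have hx0 : 0 < x := by linarith
      rw [norm_of_nonneg (div_nonneg (mul_nonneg (cnt_nonneg _ _) (Real.sqrt_nonneg _)) hx0.le)]
      rcases lt_or_ge (x / a) 1 with h | h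
      · rw [D.cnt_eq_zero (fun t ht => ht.1) h]
        simp only [zero_mul, zero_div]
        positivity
      · have h1 := (D.cnt_mono (A := D.attained (T a)) (fun t ht => ht.1) subset_rfl (x / a)).trans (hK _ h)
        have hl : 0 ≤ log (x / a) := log_nonneg h
        have hla : 0 ≤ log a := log_nonneg ha1
        have hs : 0 < √(1 + log (x / a)) := Real.sqrt_pos.2 (by linarith)
        have h2 : √(log x) ≤ √a * √(1 + log (x / a)) := by
          rw [← Real.sqrt_mul (by linarith)]
          refine Real.sqrt_le_sqrt ?_
          have e : log x = log (x / a) + log a := by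
            rw [← log_mul (by positivity) (by positivity)]
            congr 1; field_simp
          have := log_le_sub_one_of_pos (show (0 : ℝ) < a by linarith)
          nlinarith
        have h3 : (a : ℝ) ^ (-(1 / 2) : ℝ) = √a / a := by
          rw [Real.rpow_neg (by linarith), ← Real.sqrt_eq_rpow, Real.sqrt_div_self]
        rw [h3, div_le_iff₀ hx0]
        calc _ ≤ K * (x / a) / √(1 + log (x / a)) * (√a * √(1 + log (x / a))) :=
              mul_le_mul h1 h2 (Real.sqrt_nonneg _) (by positivity)
          _ = _ := by field_simp
    · simp only [Set.indicator, Set.mem_ofPred_eq, if_neg ha]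
      simp

end ClassData

section LatticeCount
open MeasureTheory

variable {R : Type*} [CommRing R]

/-- An embedding of a ring as an imaginary quadratic lattice in `ℂ`. -/
structure QuadEmb (R : Type*) [CommRing R] where
  φ : R →+* ℂ
  inj : Function.Injective φ
  σ : R ≃+* R
  φ_σ : ∀ x, φ (σ x) = starRingEnd ℂ (φ x)
  τ : R
  im_τ : (φ τ).im ≠ 0

namespace QuadEmb
variable (E : QuadEmb R) [Module.Free ℤ R] [Module.Finite ℤ R]

lemma exists_basis (hr : Module.finrank ℤ R = 2) : ∃ b : Module.Basis (Fin 2) ℝ ℂ,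
    ∀ z : ℂ, z ∈ Submodule.span ℤ (Set.range b) ↔ ∃ x, E.φ x = z := by
  set e := Module.finBasisOfFinrankEq ℤ R hr with he
  have hsum : ∀ x, E.φ x = ∑ i, ((e.repr x i : ℤ) : ℝ) • E.φ (e i) := by
    intro x
    conv_lhs => rw [← e.sum_repr x]
    rw [map_sum]
    refine Finset.sum_congr rfl fun i _ => ?_
    rw [map_zsmul]; simp
  have hmem : ∀ x, E.φ x ∈ Submodule.span ℝ (Set.range fun i => E.φ (e i)) := by
    intro x
    rw [hsum]
    exact Submodule.sum_mem _ fun i _ => Submodule.smul_mem _ _ (Submodule.subset_span ⟨i, rfl⟩)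
  have hspan : ⊤ ≤ Submodule.span ℝ (Set.range fun i => E.φ (e i)) := by
    intro z _
    have h1 := hmem 1
    have h2 := hmem E.τ
    rw [map_one] at h1
    have hz : z = (z.re - z.im / (E.φ E.τ).im * (E.φ E.τ).re) • (1 : ℂ)
        + (z.im / (E.φ E.τ).im) • E.φ E.τ := by
      have := E.im_τ
      apply Complex.ext
      · simp
      · simp [this]
    rw [hz]
    exact Submodule.add_mem _ (Submodule.smul_mem _ _ h1) (Submodule.smul_mem _ _ h2)
  refine ⟨basisOfTopLeSpanOfCardEqFinrank _ hspan (by simp), fun z => ?_⟩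
  rw [coe_basisOfTopLeSpanOfCardEqFinrank]
  constructor
  · intro hz
    induction hz using Submodule.span_induction with
    | mem x hx => obtain ⟨i, rfl⟩ := hx; exact ⟨_, rfl⟩
    | zero => exact ⟨0, map_zero _⟩
    | add x y _ _ hx hy =>
      obtain ⟨a, rfl⟩ := hx
      obtain ⟨b, rfl⟩ := hy
      exact ⟨a + b, map_add _ _ _⟩
    | smul n x _ hx =>
      obtain ⟨a, rfl⟩ := hx
      exact ⟨n • a, map_zsmul _ _ _⟩
  · rintro ⟨x, rfl⟩
    rw [← e.sum_repr x, map_sum]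
    refine Submodule.sum_mem _ fun i _ => ?_
    rw [map_zsmul]
    exact Submodule.smul_mem _ _ (Submodule.subset_span ⟨i, rfl⟩)

lemma finite_norm_le (hr : Module.finrank ℤ R = 2) (w : ℂ) (r : ℝ) : {x : R | ‖E.φ x - w‖ ≤ r}.Finite := by
  obtain ⟨b, hb⟩ := E.exists_basis hr
  have h := ZSpan.setFinite_inter b (s := Metric.closedBall w r) Metric.isBounded_closedBall
  refine (h.preimage (f := E.φ) E.inj.injOn).subset fun x hx => ⟨?_, (hb _).2 ⟨x, rfl⟩⟩
  simpa [dist_eq_norm] using hx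

theorem lattice_count (hr : Module.finrank ℤ R = 2) : ∃ c C : ℝ, 0 < c ∧ ∀ r : ℝ, 0 ≤ r →
    |({x : R | ‖E.φ x‖ ≤ r}.ncard : ℝ) - c * r ^ 2| ≤ C * (r + 1) := by
  obtain ⟨b, hb⟩ := E.exists_basis hr
  set Fd := ZSpan.fundamentalDomain b with hFd
  have hFm : MeasurableSet Fd := ZSpan.fundamentalDomain_measurableSet b
  obtain ⟨d, hd0, hd⟩ := (ZSpan.fundamentalDomain_isBounded b).exists_pos_norm_le
  have hV0 : volume Fd ≠ 0 := ZSpan.measure_fundamentalDomain_ne_zero b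
  have hVt : volume Fd ≠ ⊤ := (ZSpan.fundamentalDomain_isBounded b).measure_lt_top.ne
  set V : ℝ := (volume Fd).toReal with hV
  have hVpos : 0 < V := ENNReal.toReal_pos hV0 hVt
  have hball : ∀ r : ℝ, 0 ≤ r → (volume (Metric.closedBall (0 : ℂ) r)).toReal = π * r ^ 2 := by
    intro r hr
    rw [Complex.volume_closedBall]
    simp [ENNReal.toReal_ofReal hr, mul_comm]
  have hA : ∀ r : ℝ, {x : R | ‖E.φ x‖ ≤ r}.Finite := fun r => by
    simpa using E.finite_norm_le hr 0 r
  have hmeas : ∀ r : ℝ, (volume (⋃ x ∈ (hA r).toFinset, (fun z => E.φ x + z) '' Fd)).toReal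
      = V * {x : R | ‖E.φ x‖ ≤ r}.ncard := by
    intro r
    rw [measure_biUnion_finset]
    · have : ∀ x : R, volume ((fun z => E.φ x + z) '' Fd) = volume Fd := fun x => by
        rw [Set.image_add_left, measure_preimage_add]
      simp_rw [this]
      rw [Finset.sum_const, ← Set.ncard_eq_toFinset_card _ (hA r)]
      simp [hV, mul_comm]
    · intro x _ y _ hxy
      rw [Function.onFun, Set.disjoint_left]
      rintro _ ⟨u, hu, rfl⟩ ⟨v, hv, huv⟩
      refine hxy (E.inj ?_)
      have h1 := ZSpan.fract_eq_fract b u v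
      rw [ZSpan.fract_eq_self.2 hu, ZSpan.fract_eq_self.2 hv] at h1
      have h2 : u = v := h1.2 ((hb _).2 ⟨x - y, by
        rw [map_sub]
        linear_combination -huv⟩)
      subst h2
      exact (add_right_cancel huv).symm
    · intro x _
      rw [Set.image_add_left]
      exact (measurable_const_add _) hFm
  have hup : ∀ r : ℝ, 0 ≤ r → V * {x : R | ‖E.φ x‖ ≤ r}.ncard ≤ π * (r + d) ^ 2 := by
    intro r hr
    rw [← hmeas, ← hball _ (by linarith)]
    refine ENNReal.toReal_mono (measure_closedBall_lt_top).ne (measure_mono ?_)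
    refine Set.iUnion₂_subset fun x hx => ?_
    rintro _ ⟨u, hu, rfl⟩
    have hx : ‖E.φ x‖ ≤ r := by simpa using hx
    rw [mem_closedBall_zero_iff]
    exact (norm_add_le _ _).trans (add_le_add hx (hd u hu))
  have hlow : ∀ r : ℝ, d ≤ r → π * (r - d) ^ 2 ≤ V * {x : R | ‖E.φ x‖ ≤ r}.ncard := by
    intro r hr
    rw [← hmeas, ← hball _ (by linarith)]
    refine ENNReal.toReal_mono ?_ (measure_mono fun z hz => ?_)
    · refine ((measure_mono (Set.iUnion₂_subset (t := Metric.closedBall 0 (r + d)) fun x hx => ?_)).trans_lt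
        measure_closedBall_lt_top).ne
      rintro _ ⟨u, hu, rfl⟩
      have hx : ‖E.φ x‖ ≤ r := by simpa using hx
      rw [mem_closedBall_zero_iff]
      exact (norm_add_le _ _).trans (add_le_add hx (hd u hu))
    · rw [mem_closedBall_zero_iff] at hz
      obtain ⟨x, hx⟩ := (hb _).1 (ZSpan.floor b z).2
      have hf := ZSpan.fract_mem_fundamentalDomain b z
      refine Set.mem_iUnion₂.2 ⟨x, ?_, ZSpan.fract b z, hf, ?_⟩
      · have h1 : E.φ x = z - ZSpan.fract b z := by rw [ZSpan.fract_apply, hx]; ring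
        have h2 := norm_sub_le z (ZSpan.fract b z)
        have h3 := hd _ hf
        simp only [Set.Finite.mem_toFinset, Set.mem_ofPred_eq]
        rw [h1]; linarith
      · simp only [ZSpan.fract_apply, hx]; ring
  refine ⟨π / V, π * (2 * d + d ^ 2) / V, by positivity, fun r hr => ?_⟩
  have key : |V * {x : R | ‖E.φ x‖ ≤ r}.ncard - π * r ^ 2| ≤ π * (2 * d + d ^ 2) * (r + 1) := by
    have h1 := hup r hr
    have hp := Real.pi_pos
    have hr' : 0 ≤ d * r ∧ 0 ≤ d ^ 2 * r ∧ 0 ≤ d ^ 2 := ⟨by positivity, by positivity, by positivity⟩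
    rw [abs_le]
    constructor
    · rcases le_total d r with h | h
      · have h2 := hlow r h
        nlinarith [mul_nonneg hp.le hr'.1, mul_nonneg hp.le hr'.2.1, mul_nonneg hp.le hr'.2.2,
          mul_nonneg hp.le hd0.le]
      · have h3 : (0 : ℝ) ≤ V * {x : R | ‖E.φ x‖ ≤ r}.ncard := by positivity
        have h4 : r ^ 2 ≤ d ^ 2 := by nlinarith
        nlinarith [mul_nonneg hp.le hr'.1, mul_nonneg hp.le hr'.2.1, mul_le_mul_of_nonneg_left h4 hp.le,
          mul_nonneg hp.le hd0.le]
    · nlinarith [mul_nonneg hp.le hr'.1, mul_nonneg hp.le hr'.2.1, mul_nonneg hp.le hr'.2.2,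
          mul_nonneg hp.le hd0.le]
  have e : ({x : R | ‖E.φ x‖ ≤ r}.ncard : ℝ) - π / V * r ^ 2
      = (V * {x : R | ‖E.φ x‖ ≤ r}.ncard - π * r ^ 2) / V := by field_simp
  rw [e, abs_div, abs_of_pos hVpos, div_le_iff₀ hVpos]
  calc _ ≤ _ := key
    _ = _ := by field_simp

end QuadEmb
end LatticeCount

namespace QuadEmb
variable {R : Type*} [CommRing R] (E : QuadEmb R) [Module.Free ℤ R] [Module.Finite ℤ R]

theorem coset_count (hr : Module.finrank ℤ R = 2) {c C : ℝ} (hc : 0 < c)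
    (h : ∀ r : ℝ, 0 ≤ r → |({x : R | ‖E.φ x‖ ≤ r}.ncard : ℝ) - c * r ^ 2| ≤ C * (r + 1))
    (J : Ideal R) [Finite (R ⧸ J)] (γ : R) : ∃ C' : ℝ, ∀ r : ℝ, 0 ≤ r →
    |(Nat.card (R ⧸ J) : ℝ) * ({x : R | x - γ ∈ J ∧ ‖E.φ x‖ ≤ r}.ncard : ℝ) - c * r ^ 2| ≤ C' * (r + 1) := by
  classical
  have := Fintype.ofFinite (R ⧸ J)
  have hA : ∀ r : ℝ, {x : R | ‖E.φ x‖ ≤ r}.Finite := fun r => by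
    simpa using E.finite_norm_le hr 0 r
  set f : R → ℝ → ℕ := fun g r => {x : R | x - g ∈ J ∧ ‖E.φ x‖ ≤ r}.ncard with hf
  have hfin : ∀ g r, {x : R | x - g ∈ J ∧ ‖E.φ x‖ ≤ r}.Finite := fun g r =>
    (hA r).subset fun x hx => hx.2
  have htr : ∀ g g' r, f g r ≤ f g' (r + ‖E.φ (g' - g)‖) := by
    intro g g' r
    refine Set.ncard_le_ncard_of_injOn (fun x => x + (g' - g)) ?_ (add_left_injective _).injOn (hfin _ _)
    rintro x ⟨h1, h2⟩
    refine ⟨?_, ?_⟩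
    · have : x + (g' - g) - g' = x - g := by ring
      rw [this]
      exact h1
    rw [map_add]
    exact (norm_add_le _ _).trans (add_le_add h2 le_rfl)
  have hmono : ∀ g {r r' : ℝ}, r ≤ r' → f g r ≤ f g r' := fun g r r' hrr =>
    Set.ncard_le_ncard (fun x hx => ⟨hx.1, hx.2.trans hrr⟩) (hfin _ _)
  have hsum : ∀ r, {x : R | ‖E.φ x‖ ≤ r}.ncard = ∑ q : R ⧸ J, f (Quotient.out q) r := by
    intro r
    rw [Set.ncard_eq_toFinset_card _ (hA r),
      Finset.card_eq_sum_card_fiberwise (f := fun x : R => (Ideal.Quotient.mk J x)) (t := Finset.univ)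
        (fun _ _ => Finset.mem_univ _)]
    refine Finset.sum_congr rfl fun q _ => ?_
    rw [hf, ← Set.ncard_coe_finset]
    congr 1
    ext x
    have : Ideal.Quotient.mk J x = q ↔ x - Quotient.out q ∈ J := by
      rw [← Ideal.Quotient.eq]
      have : Ideal.Quotient.mk J (Quotient.out q) = q := Quotient.out_eq q
      rw [this]
    simp [this, and_comm]
  set d : ℝ := ∑ q : R ⧸ J, (‖E.φ (Quotient.out q - γ)‖) with hd
  have hd0 : 0 ≤ d := Finset.sum_nonneg fun q _ => norm_nonneg _
  have hdq : ∀ q : R ⧸ J, ‖E.φ (Quotient.out q - γ)‖ ≤ d := fun q =>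
    Finset.single_le_sum (f := fun q : R ⧸ J => ‖E.φ (Quotient.out q - γ)‖) (fun q _ => norm_nonneg _) (Finset.mem_univ q)
  have hN : Nat.card (R ⧸ J) = (Finset.univ : Finset (R ⧸ J)).card := by
    rw [Nat.card_eq_fintype_card, Finset.card_univ]
  have h1 : ∀ r, Nat.card (R ⧸ J) * f γ r ≤ {x : R | ‖E.φ x‖ ≤ r + d}.ncard := by
    intro r
    rw [hsum, hN, ← smul_eq_mul, ← Finset.sum_const]
    exact Finset.sum_le_sum fun q _ => (htr γ (Quotient.out q) r).trans (hmono _ (by linarith [hdq q]))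
  have h2 : ∀ r, {x : R | ‖E.φ x‖ ≤ r - d}.ncard ≤ Nat.card (R ⧸ J) * f γ r := by
    intro r
    rw [hsum, hN, ← smul_eq_mul, ← Finset.sum_const]
    refine Finset.sum_le_sum fun q _ => (htr (Quotient.out q) γ _).trans (hmono _ ?_)
    have := hdq q
    rw [← norm_neg, ← map_neg, neg_sub] at this
    linarith
  have hC0 : 0 ≤ C := by
    have := (abs_nonneg _).trans (h 0 le_rfl)
    linarith
  refine ⟨C * (1 + d) + c * (2 * d + d ^ 2), fun r hr0 => ?_⟩
  have h1' : (Nat.card (R ⧸ J) : ℝ) * f γ r ≤ {x : R | ‖E.φ x‖ ≤ r + d}.ncard := by exact_mod_cast h1 r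
  have h3 := (abs_le.1 (h (r + d) (by linarith))).2
  have p1 : 0 ≤ C * d * r := by positivity
  have p2 : 0 ≤ c * d ^ 2 * r := by positivity
  have p3 : 0 ≤ c * d := by positivity
  have p4 : 0 ≤ c * d * r := by positivity
  have p5 : 0 ≤ c * d ^ 2 := by positivity
  have p6 : 0 ≤ C * d := by positivity
  have p7 : 0 ≤ C * r := by positivity
  rw [abs_le]
  constructor
  · rcases le_total d r with hdr | hdr
    · have h2' : ({x : R | ‖E.φ x‖ ≤ r - d}.ncard : ℝ) ≤ (Nat.card (R ⧸ J) : ℝ) * f γ r := by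
        exact_mod_cast h2 r
      have h4 := (abs_le.1 (h (r - d) (by linarith))).1
      nlinarith
    · have h5 : (0 : ℝ) ≤ (Nat.card (R ⧸ J) : ℝ) * f γ r := by positivity
      have h6 : c * r ^ 2 ≤ c * d ^ 2 := by
        refine mul_le_mul_of_nonneg_left ?_ hc.le
        nlinarith
      nlinarith
  · nlinarith

end QuadEmb

section
variable {R : Type*} [CommRing R] [IsDedekindDomain R] [Finite (ClassGroup R)]
theorem exists_pow_principal' :
    ∃ h : ℕ, 0 < h ∧ ∀ J : Ideal R, ∃ x, J ^ h = Ideal.span {x} := by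
  refine ⟨Nat.card (ClassGroup R), Nat.card_pos, fun J => ?_⟩
  by_cases hJ : J = ⊥
  · refine ⟨0, ?_⟩
    rw [hJ, ← Ideal.zero_eq_bot, zero_pow Nat.card_pos.ne']
    simp
  have hJ' : J ∈ nonZeroDivisors (Ideal R) := mem_nonZeroDivisors_of_ne_zero hJ
  have h1 : ClassGroup.mk0 (⟨J, hJ'⟩ ^ Nat.card (ClassGroup R)) = 1 := by
    rw [map_pow, pow_card_eq_one']
  rw [ClassGroup.mk0_eq_one_iff] at h1
  obtain ⟨x, hx⟩ := h1.principal
  exact ⟨x, hx⟩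

end

namespace QuadEmb
set_option linter.unusedSectionVars false
variable {R : Type*} [CommRing R] (E : QuadEmb R)

lemma σσ (x : R) : E.σ (E.σ x) = x := E.inj (by rw [E.φ_σ, E.φ_σ, Complex.conj_conj])

lemma charZero (E : QuadEmb R) : CharZero R := by
  refine ⟨fun m n h => ?_⟩
  have := congrArg E.φ h
  rw [map_natCast, map_natCast] at this
  exact_mod_cast this

variable [Module.Free ℤ R] [Module.Finite ℤ R]

lemma exists_int_of_fixed (hr : Module.finrank ℤ R = 2) {y : R} (hy : E.σ y = y) :
    ∃ n : ℤ, y = n := by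
  have hyim : (E.φ y).im = 0 := by
    have := E.φ_σ y
    rw [hy] at this
    exact Complex.conj_eq_iff_im.1 this.symm
  have hdep : ¬LinearIndependent ℤ ![1, y, E.τ] := fun h => by
    have := h.fintype_card_le_finrank
    rw [hr] at this
    simp at this
  rw [Fintype.not_linearIndependent_iff] at hdep
  obtain ⟨g, hg, i, hi⟩ := hdep
  have hg' : E.φ (∑ i, g i • ![1, y, E.τ] i) = 0 := by rw [hg, map_zero]
  simp only [Fin.sum_univ_three, Matrix.cons_val_zero, Matrix.cons_val_one, Matrix.cons_val,
    map_add, zsmul_eq_mul, map_mul, map_intCast, mul_one] at hg'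
  have h2 : g 2 = 0 := by
    have := congrArg Complex.im hg'
    simpa [hyim, E.im_τ] using this
  rw [h2] at hg'
  have h1 : g 1 ≠ 0 := by
    intro h1
    rw [h1] at hg'
    have h0 : g 0 = 0 := by simpa using hg'
    fin_cases i <;> simp_all
  have hq : E.φ y = algebraMap ℚ ℂ (-(g 0) / (g 1)) := by
    have : (g 1 : ℂ) ≠ 0 := by exact_mod_cast h1
    simp only [map_div₀, map_neg, map_intCast]
    field_simp
    simp only [Int.cast_zero, zero_mul, add_zero] at hg'
    linear_combination hg'
  have hint : IsIntegral ℤ (E.φ y) := by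
    have : IsIntegral ℤ y := Algebra.IsIntegral.isIntegral y
    exact this.map E.φ.toIntAlgHom
  rw [hq, isIntegral_algebraMap_iff (algebraMap ℚ ℂ).injective, IsIntegrallyClosed.isIntegral_iff] at hint
  obtain ⟨n, hn⟩ := hint
  refine ⟨n, E.inj ?_⟩
  rw [hq, ← hn]
  simp

variable [IsDedekindDomain R]

lemma absNorm_map_σ (J : Ideal R) : Ideal.absNorm (J.map E.σ) = Ideal.absNorm J := by
  have e := Ideal.quotientEquiv J (J.map E.σ) E.σ rfl
  rw [Ideal.absNorm_apply, Ideal.absNorm_apply, Submodule.cardQuot_apply, Submodule.cardQuot_apply]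
  exact (Nat.card_congr e.toEquiv).symm

lemma map_σ_σ (J : Ideal R) : (J.map E.σ).map E.σ = J := by
  change Ideal.map (E.σ : R →+* R) (Ideal.map (E.σ : R →+* R) J) = J
  rw [Ideal.map_map]
  have : (E.σ : R →+* R).comp (E.σ : R →+* R) = RingHom.id R := by
    ext x; exact E.σσ x
  rw [this, Ideal.map_id]

lemma map_σ_span (x : R) : (Ideal.span {x}).map E.σ = Ideal.span {E.σ x} := by
  rw [Ideal.map_span, Set.image_singleton]

lemma mul_σ (hr : Module.finrank ℤ R = 2) (x : R) :
    x * E.σ x = (Ideal.absNorm (Ideal.span {x}) : R) := by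
  have hc := E.charZero
  obtain ⟨n, hn⟩ := E.exists_int_of_fixed hr (y := x * E.σ x) (by rw [map_mul, E.σσ, mul_comm])
  have h0 : 0 ≤ n := by
    have h1 := congrArg E.φ hn
    rw [map_mul, E.φ_σ, Complex.mul_conj, map_intCast] at h1
    have h2 : (Complex.normSq (E.φ x) : ℝ) = n := by exact_mod_cast h1
    have := Complex.normSq_nonneg (E.φ x)
    rw [h2] at this
    exact_mod_cast this
  lift n to ℕ using h0
  rw [hn]
  have h1 : Ideal.absNorm (Ideal.span {x}) * Ideal.absNorm (Ideal.span {x}) = n * n := by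
    conv_lhs => arg 2; rw [← E.absNorm_map_σ, map_σ_span]
    rw [← map_mul, Ideal.span_singleton_mul_span_singleton, hn, Int.cast_natCast,
      Ideal.absNorm_span_natCast, hr, sq]
  rw [Nat.mul_self_inj.1 h1, Int.cast_natCast]

lemma norm_sq (hr : Module.finrank ℤ R = 2) (x : R) :
    ‖E.φ x‖ ^ 2 = (Ideal.absNorm (Ideal.span {x}) : ℝ) := by
  have h := congrArg E.φ (E.mul_σ hr x)
  rw [map_mul, E.φ_σ, Complex.mul_conj, map_natCast] at h
  rw [← Complex.normSq_eq_norm_sq]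
  exact_mod_cast h

lemma map_σ_pow (J : Ideal R) (n : ℕ) : (J ^ n).map E.σ = (J.map E.σ) ^ n := Ideal.map_pow _ _ _

lemma ideal_pow_inj {I J : Ideal R} {h : ℕ} (hh : h ≠ 0) (H : I ^ h = J ^ h) : I = J := by
  refine le_antisymm ?_ ?_
  · rw [← Ideal.dvd_iff_le]
    exact (UniqueFactorizationMonoid.pow_dvd_pow_iff_dvd hh).1 H.symm.dvd
  · rw [← Ideal.dvd_iff_le]
    exact (UniqueFactorizationMonoid.pow_dvd_pow_iff_dvd hh).1 H.dvd

lemma mul_map_σ [Finite (ClassGroup R)] (hr : Module.finrank ℤ R = 2) (J : Ideal R) :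
    J * J.map E.σ = Ideal.span {(Ideal.absNorm J : R)} := by
  obtain ⟨h, hh, H⟩ := exists_pow_principal' (R := R)
  obtain ⟨x, hx⟩ := H J
  refine ideal_pow_inj hh.ne' ?_
  rw [mul_pow, ← map_σ_pow, hx, map_σ_span, Ideal.span_singleton_mul_span_singleton, E.mul_σ hr,
    ← hx, Ideal.span_singleton_pow, map_pow, Nat.cast_pow]

end QuadEmb

section Ray
set_option linter.unusedSectionVars false
variable {R : Type*} [CommRing R]

/-- The relation `(a) J = (b) J'` with `a ≡ b ≡ 1` modulo `M`. -/
def RayRel (M J J' : Ideal R) : Prop :=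
  ∃ a b : R, a - 1 ∈ M ∧ b - 1 ∈ M ∧ Ideal.span {a} * J = Ideal.span {b} * J'

lemma mul_sub_one_mem {M : Ideal R} {a b : R} (ha : a - 1 ∈ M) (hb : b - 1 ∈ M) : a * b - 1 ∈ M := by
  have : a * b - 1 = b * (a - 1) + (b - 1) := by ring
  rw [this]
  exact M.add_mem (M.mul_mem_left _ ha) hb

lemma RayRel.refl (M J : Ideal R) : RayRel M J J := ⟨1, 1, by simp, by simp, rfl⟩

lemma RayRel.symm {M J J' : Ideal R} : RayRel M J J' → RayRel M J' J :=
  fun ⟨a, b, ha, hb, h⟩ => ⟨b, a, hb, ha, h.symm⟩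

lemma RayRel.trans {M J J' J'' : Ideal R} : RayRel M J J' → RayRel M J' J'' → RayRel M J J'' := by
  rintro ⟨a, b, ha, hb, h⟩ ⟨a', b', ha', hb', h'⟩
  refine ⟨a' * a, b * b', mul_sub_one_mem ha' ha, mul_sub_one_mem hb hb', ?_⟩
  rw [← Ideal.span_singleton_mul_span_singleton, ← Ideal.span_singleton_mul_span_singleton, mul_assoc, h,
    mul_left_comm, h', mul_assoc]

lemma RayRel.mul {M J J' K K' : Ideal R} : RayRel M J J' → RayRel M K K' → RayRel M (J * K) (J' * K') := by
  rintro ⟨a, b, ha, hb, h⟩ ⟨a', b', ha', hb', h'⟩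
  refine ⟨a * a', b * b', mul_sub_one_mem ha ha', mul_sub_one_mem hb hb', ?_⟩
  rw [← Ideal.span_singleton_mul_span_singleton, ← Ideal.span_singleton_mul_span_singleton,
    mul_mul_mul_comm, h, h', mul_mul_mul_comm]

/-- The monoid of ideals coprime to `M`. -/
def coprimeIdeals (M : Ideal R) : Submonoid (Ideal R) where
  carrier := {J | IsCoprime J M}
  one_mem' := isCoprime_one_left
  mul_mem' := IsCoprime.mul_left

/-- Ray equivalence as a congruence. -/
def rayCon (M : Ideal R) : Con (coprimeIdeals M) where
  r J J' := RayRel M J J'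
  iseqv := ⟨fun J => RayRel.refl M J, RayRel.symm, RayRel.trans⟩
  mul' := RayRel.mul

/-- A presentation of a group as the ray class group modulo `M`. -/
structure RayGroup (M : Ideal R) (G : Type*) [AddCommGroup G] where
  ray : Ideal R → G
  ray_mul : ∀ J J', IsCoprime J M → IsCoprime J' M → ray (J * J') = ray J + ray J'
  ray_iff : ∀ J J', IsCoprime J M → IsCoprime J' M → (ray J = ray J' ↔ RayRel M J J')
  ray_surj : ∀ g, ∃ J, IsCoprime J M ∧ ray J = g

lemma IsCoprime.span_mul_sub_one {M : Ideal R} {x : R} (h : IsCoprime (Ideal.span {x}) M) :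
    ∃ c, c * x - 1 ∈ M := by
  obtain ⟨i, hi, j, hj, hij⟩ := h.exists
  obtain ⟨c, rfl⟩ := Ideal.mem_span_singleton'.1 hi
  refine ⟨c, ?_⟩
  have : c * x - 1 = -j := by linear_combination hij
  rw [this]
  exact M.neg_mem hj

lemma RayRel.of_sub_mem {M : Ideal R} {x y : R} (h : IsCoprime (Ideal.span {x}) M) (hxy : x - y ∈ M) :
    RayRel M (Ideal.span {x}) (Ideal.span {y}) := by
  obtain ⟨c, hc⟩ := h.span_mul_sub_one
  refine ⟨c * y, c * x, ?_, hc, ?_⟩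
  · have : c * y - 1 = (c * x - 1) - c * (x - y) := by ring
    rw [this]
    exact M.sub_mem hc (M.mul_mem_left _ hxy)
  · rw [Ideal.span_singleton_mul_span_singleton, Ideal.span_singleton_mul_span_singleton]
    congr 2
    ring

lemma exists_pow_sub_one_mem {M : Ideal R} [Finite (R ⧸ M)] {x : R} (h : IsCoprime (Ideal.span {x}) M) :
    ∃ e : ℕ, 0 < e ∧ x ^ e - 1 ∈ M := by
  obtain ⟨c, hc⟩ := h.span_mul_sub_one
  have hu : IsUnit (Ideal.Quotient.mk M x) := by
    refine IsUnit.of_mul_eq_one (Ideal.Quotient.mk M c) ?_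
    rw [← map_mul, mul_comm, ← map_one (Ideal.Quotient.mk M), Ideal.Quotient.eq]
    exact hc
  obtain ⟨u, hu⟩ := hu
  refine ⟨orderOf u, orderOf_pos u, ?_⟩
  rw [← Ideal.Quotient.eq, map_pow, ← hu, ← Units.val_pow_eq_pow_val, pow_orderOf_eq_one]
  simp

variable [IsDedekindDomain R] [Finite (ClassGroup R)]

lemma isUnit_ray (M : Ideal R) [Finite (R ⧸ M)] (g : (rayCon M).Quotient) : IsUnit g := by
  obtain ⟨J, rfl⟩ := (rayCon M).mk'_surjective g
  obtain ⟨h, hh, H⟩ := exists_pow_principal' (R := R)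
  obtain ⟨x, hx⟩ := H J
  have hcop : IsCoprime (Ideal.span {x}) M := hx ▸ J.2.pow_left
  obtain ⟨e, he, hxe⟩ := exists_pow_sub_one_mem hcop
  refine IsUnit.of_pow_eq_one (n := h * e) ?_ (mul_pos hh he).ne'
  rw [← map_pow, ← map_one (rayCon M).mk']
  refine (rayCon M).eq.2 ⟨1, x ^ e, by simp, hxe, ?_⟩
  simp [pow_mul, hx, Ideal.span_singleton_pow]

noncomputable instance (M : Ideal R) [Finite (R ⧸ M)] : CommGroup (rayCon M).Quotient :=
  commGroupOfIsUnit (isUnit_ray M)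

open Classical in
/-- The class of an ideal in the ray class group. -/
noncomputable def rayGroup (M : Ideal R) [Finite (R ⧸ M)] :
    RayGroup M (Additive (rayCon M).Quotient) where
  ray J := if h : IsCoprime J M then Additive.ofMul ((rayCon M).mk' ⟨J, h⟩) else 0
  ray_mul J J' h h' := by
    rw [dif_pos (h.mul_left h'), dif_pos h, dif_pos h', ← ofMul_mul, ← map_mul]
    rfl
  ray_iff J J' h h' := by
    rw [dif_pos h, dif_pos h', Additive.ofMul.injective.eq_iff]
    exact (rayCon M).eq
  ray_surj g := by
    obtain ⟨J, hJ⟩ := (rayCon M).mk'_surjective g.toMul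
    refine ⟨J, J.2, ?_⟩
    have : IsCoprime (J : Ideal R) M := J.2
    rw [dif_pos this]
    exact hJ

namespace RayGroup
variable {M : Ideal R} {G : Type*} [AddCommGroup G] (D : RayGroup M G)

lemma ray_one : D.ray 1 = 0 := by
  have := D.ray_mul 1 1 isCoprime_one_left isCoprime_one_left
  simpa using this

lemma ne_bot_of_coprime (hM : M ≠ ⊤) {J : Ideal R} (h : IsCoprime J M) : J ≠ ⊥ := by
  rintro rfl
  rw [Ideal.isCoprime_iff_sup_eq, bot_sup_eq] at h
  exact hM h

theorem finite (D : RayGroup M G) [Finite (R ⧸ M)] (hM : M ≠ ⊤) : Finite G := by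
  classical
  set K : ClassGroup R → Ideal R := fun C =>
    if h : ∃ K : nonZeroDivisors (Ideal R), IsCoprime (K : Ideal R) M ∧ ClassGroup.mk0 K = C⁻¹ then h.choose else 1
  set f : ClassGroup R × (R ⧸ M) → G := fun p => D.ray (Ideal.span {Quotient.out p.2}) - D.ray (K p.1)
  refine Finite.of_surjective f fun g => ?_
  obtain ⟨J, hJ, rfl⟩ := D.ray_surj g
  have hJ0 := ne_bot_of_coprime hM hJ
  have hJ' : J ∈ nonZeroDivisors (Ideal R) := mem_nonZeroDivisors_of_ne_zero hJ0
  set C := ClassGroup.mk0 ⟨J, hJ'⟩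
  have hex : ∃ K : nonZeroDivisors (Ideal R), IsCoprime (K : Ideal R) M ∧ ClassGroup.mk0 K = C⁻¹ := by
    refine ⟨⟨J, hJ'⟩ ^ (Nat.card (ClassGroup R) - 1), ?_, ?_⟩
    · exact hJ.pow_left
    · rw [map_pow, eq_inv_iff_mul_eq_one, ← pow_succ, Nat.sub_add_cancel Nat.card_pos, pow_card_eq_one']
  have hK : K C = hex.choose := dif_pos hex
  obtain ⟨hK1, hK2⟩ := hex.choose_spec
  have h1 : ClassGroup.mk0 (⟨J, hJ'⟩ * hex.choose) = 1 := by
    rw [map_mul, hK2, mul_inv_cancel]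
  rw [ClassGroup.mk0_eq_one_iff] at h1
  obtain ⟨x, hx⟩ := h1.principal
  have hx : J * hex.choose = Ideal.span {x} := hx
  have hcx : IsCoprime (Ideal.span {x}) M := hx ▸ hJ.mul_left hK1
  refine ⟨(C, Ideal.Quotient.mk M x), ?_⟩
  have h2 : x - Quotient.out (Ideal.Quotient.mk M x) ∈ M := by
    rw [← Ideal.Quotient.eq]
    exact (Quotient.out_eq (Ideal.Quotient.mk M x)).symm
  have hco : IsCoprime (Ideal.span {Quotient.out (Ideal.Quotient.mk M x)}) M := by
    obtain ⟨c, hc⟩ := hcx.span_mul_sub_one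
    rw [Ideal.isCoprime_iff_exists]
    set y := Quotient.out (Ideal.Quotient.mk M x)
    refine ⟨c * y, Ideal.mem_span_singleton'.2 ⟨c, rfl⟩, 1 - c * y, ?_, by ring⟩
    have : 1 - c * y = c * (x - y) - (c * x - 1) := by ring
    rw [this]
    exact M.sub_mem (M.mul_mem_left _ h2) hc
  change D.ray _ - D.ray (K C) = _
  rw [hK, sub_eq_iff_eq_add, ← D.ray_mul _ _ hJ hK1, hx, eq_comm]
  exact (D.ray_iff _ _ hcx hco).2 (RayRel.of_sub_mem hcx h2)

end RayGroup
end Ray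

section Primes
set_option linter.unusedSectionVars false
variable {R : Type*} [CommRing R] [IsDedekindDomain R] [Module.Free ℤ R] [Module.Finite ℤ R] [Finite (ClassGroup R)]

lemma ideal_mul_left_cancel {I J K : Ideal R} (hI : I ≠ ⊥) (h : I * J = I * K) : J = K :=
  mul_left_cancel₀ hI h

lemma isCoprime_span_natCast_iff {J : Ideal R} {m : ℕ} :
    IsCoprime J (Ideal.span {(m : R)}) ↔ (Ideal.absNorm J).Coprime m := by
  constructor
  · intro h
    rw [Nat.coprime_iff_gcd_eq_one]
    by_contra hg
    obtain ⟨p, hp, hpg⟩ := Nat.exists_prime_and_dvd hg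
    obtain ⟨P, hP, hPp, hPJ⟩ := Ideal.exists_isMaximal_dvd_of_dvd_absNorm' hp J
      (hpg.trans (Nat.gcd_dvd_left _ _))
    have h1 : ((p : ℤ) : R) ∈ P := by
      have : (p : ℤ) ∈ P.under ℤ := by rw [hPp]; exact Ideal.mem_span_singleton_self _
      exact this
    have h2 : (m : R) ∈ P := by
      obtain ⟨k, hk⟩ := hpg.trans (Nat.gcd_dvd_right _ _)
      rw [hk, Nat.cast_mul]
      exact P.mul_mem_right _ (by exact_mod_cast h1)
    have h3 := Ideal.isCoprime_iff_sup_eq.1 h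
    refine hP.ne_top (top_le_iff.1 (h3 ▸ sup_le (Ideal.dvd_iff_le.1 hPJ) ?_))
    rwa [Ideal.span_singleton_le_iff_mem]
  · intro h
    rw [Ideal.isCoprime_iff_exists]
    have := Nat.isCoprime_iff_coprime.2 h
    obtain ⟨u, v, huv⟩ := this
    refine ⟨u * (Ideal.absNorm J : R), J.mul_mem_left _ (Ideal.absNorm_mem J), v * m,
      Ideal.mem_span_singleton'.2 ⟨v, rfl⟩, ?_⟩
    exact_mod_cast congrArg (Int.cast : ℤ → R) huv

namespace QuadEmb
variable (E : QuadEmb R)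

lemma absNorm_span_nat (hr : Module.finrank ℤ R = 2) (n : ℕ) :
    Ideal.absNorm (Ideal.span {(n : R)}) = n ^ 2 := by
  rw [Ideal.absNorm_span_natCast, hr]

lemma mul_σ_eq_of_prime {p : ℕ} (hr : Module.finrank ℤ R = 2) {P : Ideal R}
    (hP : Ideal.absNorm P = p) : P * P.map E.σ = Ideal.span {(p : R)} := by
  rw [E.mul_map_σ hr, hP]

lemma prime_of_absNorm {p : ℕ} (hp : p.Prime) {P : Ideal R} (hP : Ideal.absNorm P = p) : Prime P := by
  refine Ideal.prime_of_isPrime ?_ (Ideal.isPrime_of_irreducible_absNorm (hP ▸ hp))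
  rintro rfl
  rw [Ideal.absNorm_bot] at hP
  exact hp.ne_zero hP.symm

lemma prime_map_σ {P : Ideal R} (hP : Prime P) : Prime (P.map E.σ) := by
  have h1 := Ideal.isPrime_of_prime hP
  refine Ideal.prime_of_isPrime ?_ (Ideal.map_isPrime_of_equiv E.σ)
  intro h
  refine hP.ne_zero ?_
  rw [← E.map_σ_σ P, h, Ideal.map_bot]
  rfl

lemma map_σ_ne {p : ℕ} (hp : p.Prime) {m : ℕ} (hτ : Ideal.absNorm (Ideal.span {E.τ - E.σ E.τ}) ∣ m)
    (hpm : ¬p ∣ m) {P : Ideal R} (hP : Ideal.absNorm P = p) : P.map E.σ ≠ P := by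
  intro h
  have := Fact.mk hp
  have hcard : Nat.card (R ⧸ P) = p := by
    rw [← hP, Ideal.absNorm_apply, Submodule.cardQuot_apply]
  have hP1 : (1 : R ⧸ P) ≠ 0 := by
    have : Nontrivial (R ⧸ P) := by
      have : Finite (R ⧸ P) := Nat.finite_of_card_ne_zero (hcard ▸ hp.ne_zero)
      rw [← Finite.one_lt_card_iff_nontrivial, hcard]
      exact hp.one_lt
    exact one_ne_zero
  obtain ⟨k, hk⟩ := mem_zmultiples_of_prime_card hcard hP1 (g' := Ideal.Quotient.mk P E.τ)
  have h1 : E.τ - k ∈ P := by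
    rw [← Ideal.Quotient.eq, ← hk]
    simp
  have h2 : E.σ (E.τ - k) ∈ P := h ▸ Ideal.mem_map_of_mem E.σ h1
  have h3 : E.τ - E.σ E.τ ∈ P := by
    rw [map_sub, map_intCast] at h2
    have := P.sub_mem h1 h2
    rwa [sub_sub_sub_cancel_right] at this
  refine hpm (Dvd.dvd.trans ?_ hτ)
  rw [← hP]
  exact Ideal.absNorm_dvd_absNorm_of_le ((Ideal.span_singleton_le_iff_mem _).2 h3)

end QuadEmb

variable (R) in
/-- Primes not dividing `m` which are norms of ideals. -/
def splitPrimes (m : ℕ) : Set ℕ := {p | p.Prime ∧ ¬p ∣ m ∧ ∃ P : Ideal R, Ideal.absNorm P = p}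

variable (R) in
/-- Primes not dividing `m` which stay prime. -/
def inertPrimes (m : ℕ) : Set ℕ := {p | p.Prime ∧ ¬p ∣ m ∧ Prime (Ideal.span {(p : R)})}

open Classical in
variable (R) in
/-- A chosen ideal of norm `p`, or `(p)` if there is none. -/
noncomputable def primeOver (p : ℕ) : Ideal R :=
  if h : ∃ P : Ideal R, Ideal.absNorm P = p then h.choose else Ideal.span {(p : R)}

lemma absNorm_primeOver_split {m p : ℕ} (h : p ∈ splitPrimes R m) : Ideal.absNorm (primeOver R p) = p := by
  rw [primeOver, dif_pos h.2.2]
  exact h.2.2.choose_spec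

lemma not_norm_of_inert (hr : Module.finrank ℤ R = 2) {m p : ℕ} (h : p ∈ inertPrimes R m) :
    ¬∃ P : Ideal R, Ideal.absNorm P = p := by
  rintro ⟨P, hP⟩
  have h1 := QuadEmb.prime_of_absNorm h.1 hP
  have h2 : P ∣ Ideal.span {(p : R)} := by
    rw [Ideal.dvd_iff_le, Ideal.span_singleton_le_iff_mem, ← hP]
    exact Ideal.absNorm_mem P
  have h3 : P = Ideal.span {(p : R)} := associated_iff_eq.1 ((Prime.dvd_prime_iff_associated h1 h.2.2).1 h2)
  have h4 := Ideal.absNorm_span_natCast (S := R) p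
  rw [← h3, hP, hr, sq] at h4
  have := h.1.one_lt
  nlinarith

lemma primeOver_inert (hr : Module.finrank ℤ R = 2) {m p : ℕ} (h : p ∈ inertPrimes R m) :
    primeOver R p = Ideal.span {(p : R)} := by
  rw [primeOver, dif_neg (not_norm_of_inert hr h)]

lemma disjoint_split_inert (hr : Module.finrank ℤ R = 2) (m : ℕ) :
    Disjoint (splitPrimes R m) (inertPrimes R m) :=
  Set.disjoint_left.2 fun _ h1 h2 => not_norm_of_inert hr h2 h1.2.2

lemma prime_primeOver_split {m p : ℕ} (h : p ∈ splitPrimes R m) : Prime (primeOver R p) :=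
  QuadEmb.prime_of_absNorm h.1 (absNorm_primeOver_split h)

lemma prime_primeOver_inert (hr : Module.finrank ℤ R = 2) {m p : ℕ} (h : p ∈ inertPrimes R m) :
    Prime (primeOver R p) := by
  rw [primeOver_inert hr h]
  exact h.2.2

/-- A prime ideal coprime to `m` lies over a split or an inert prime. -/
lemma QuadEmb.prime_cases (E : QuadEmb R) (hr : Module.finrank ℤ R = 2) {m : ℕ} {P : Ideal R}
    (hP : Prime P) (hc : (Ideal.absNorm P).Coprime m) :
    (∃ p ∈ splitPrimes R m, P = primeOver R p ∨ P = (primeOver R p).map E.σ) ∨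
    (∃ p ∈ inertPrimes R m, P = primeOver R p) := by
  have hPm := (Ideal.isPrime_of_prime hP).isMaximal hP.ne_zero
  obtain ⟨p, n, hn, hpP, hp, hN⟩ := Ideal.exists_prime_and_absNorm_eq_pow P
  have hpm : ¬p ∣ m := fun h => by
    rw [hN] at hc
    have := Nat.Coprime.eq_one_of_dvd (Nat.Coprime.coprime_dvd_left (dvd_pow_self p hn.ne') hc) h
    exact hp.ne_one this
  have hdvd : P ∣ Ideal.span {(p : R)} := by
    rwa [Ideal.dvd_iff_le, Ideal.span_singleton_le_iff_mem]
  have hn2 : n ≤ 2 := by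
    have := Ideal.absNorm_dvd_absNorm_of_le (Ideal.dvd_iff_le.1 hdvd)
    rw [hN, QuadEmb.absNorm_span_nat hr] at this
    exact (Nat.pow_dvd_pow_iff_le_right hp.one_lt).1 this
  interval_cases n
  · left
    rw [pow_one] at hN
    have hs : p ∈ splitPrimes R m := ⟨hp, hpm, P, hN⟩
    refine ⟨p, hs, ?_⟩
    rw [← E.mul_σ_eq_of_prime hr (absNorm_primeOver_split hs)] at hdvd
    rcases hP.dvd_or_dvd hdvd with h | h
    · exact Or.inl (associated_iff_eq.1 ((Prime.dvd_prime_iff_associated hP (prime_primeOver_split hs)).1 h))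
    · exact Or.inr (associated_iff_eq.1 ((Prime.dvd_prime_iff_associated hP
        (E.prime_map_σ (prime_primeOver_split hs))).1 h))
  · right
    obtain ⟨K, hK⟩ := hdvd
    have h1 := congrArg Ideal.absNorm hK
    rw [QuadEmb.absNorm_span_nat hr, map_mul, hN] at h1
    have hK1 : Ideal.absNorm K = 1 := by
      have : 0 < p ^ 2 := pow_pos hp.pos _
      exact (Nat.eq_of_mul_eq_mul_left this (by rw [mul_one]; exact h1)).symm
    rw [Ideal.absNorm_eq_one_iff] at hK1
    rw [hK1, Ideal.mul_top] at hK
    have hi : p ∈ inertPrimes R m := ⟨hp, hpm, hK ▸ hP⟩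
    exact ⟨p, hi, by rw [primeOver_inert hr hi, hK]⟩

end Primes

section Triples
set_option linter.unusedSectionVars false
variable {R : Type*} [CommRing R] [IsDedekindDomain R] [Module.Free ℤ R] [Module.Finite ℤ R] [Finite (ClassGroup R)]

variable (R) in
/-- The product of the chosen primes over the prime factors of `n`. -/
noncomputable def idealOver (n : ℕ) : Ideal R := ((n.primeFactorsList : Multiset ℕ).map (primeOver R)).prod

lemma idealOver_one : idealOver R 1 = 1 := by simp [idealOver]

lemma coe_primeFactorsList_mul {m n : ℕ} (hm : m ≠ 0) (hn : n ≠ 0) :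
    ((m * n).primeFactorsList : Multiset ℕ) = (m.primeFactorsList : Multiset ℕ) + n.primeFactorsList := by
  rw [Multiset.coe_add, Multiset.coe_eq_coe]
  exact Nat.perm_primeFactorsList_mul hm hn

lemma idealOver_mul {m n : ℕ} (hm : m ≠ 0) (hn : n ≠ 0) :
    idealOver R (m * n) = idealOver R m * idealOver R n := by
  rw [idealOver, coe_primeFactorsList_mul hm hn, Multiset.map_add, Multiset.prod_add]
  rfl

lemma idealOver_prime {p : ℕ} (hp : p.Prime) : idealOver R p = primeOver R p := by
  simp [idealOver, Nat.primeFactorsList_prime hp]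

namespace QuadEmb
variable (E : QuadEmb R)

/-- The ideal attached to a triple. -/
noncomputable def tripleIdeal (t : ℕ × ℕ × ℕ) : Ideal R :=
  idealOver R t.1 * (idealOver R t.2.1).map E.σ * idealOver R t.2.2

variable (R) in
/-- Triples whose prime factors are split, split and inert. -/
def triples (m : ℕ) : Set (ℕ × ℕ × ℕ) :=
  {t | SuppOn (splitPrimes R m) t.1 ∧ SuppOn (splitPrimes R m) t.2.1 ∧ SuppOn (inertPrimes R m) t.2.2}

lemma suppOn_induction {P : Set ℕ} {Q : ℕ → Prop} (h1 : Q 1) (h2 : ∀ p ∈ P, ∀ n, SuppOn P n → Q n → Q (p * n)) {n : ℕ}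
    (h : SuppOn P n) : Q n := by
  induction n using induction_on_primes with
  | zero => exact absurd rfl h.1
  | one => exact h1
  | prime_mul p n hp ih =>
    have h' := suppOn_mul_iff.1 h
    exact h2 p (h.2 p hp (dvd_mul_right _ _)) n h'.2 (ih h'.2)

lemma map_σ_mul (I J : Ideal R) : (I * J).map E.σ = I.map E.σ * J.map E.σ := Ideal.map_mul _ _ _

lemma map_σ_one : (1 : Ideal R).map E.σ = 1 := by
  rw [Ideal.one_eq_top]; exact Ideal.map_top _

lemma absNorm_idealOver_split {m n : ℕ} (h : SuppOn (splitPrimes R m) n) :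
    Ideal.absNorm (idealOver R n) = n := by
  refine suppOn_induction (Q := fun n => Ideal.absNorm (idealOver R n) = n) ?_ ?_ h
  · rw [idealOver_one, map_one]
  · intro p hp n hn ih
    rw [idealOver_mul hp.1.ne_zero hn.1, map_mul, ih, idealOver_prime hp.1, absNorm_primeOver_split hp]

lemma idealOver_inert (hr : Module.finrank ℤ R = 2) {m n : ℕ} (h : SuppOn (inertPrimes R m) n) :
    idealOver R n = Ideal.span {(n : R)} := by
  refine suppOn_induction (Q := fun n => idealOver R n = Ideal.span {(n : R)}) ?_ ?_ h
  · rw [idealOver_one, Nat.cast_one, Ideal.span_singleton_one, Ideal.one_eq_top]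
  · intro p hp n hn ih
    rw [idealOver_mul hp.1.ne_zero hn.1, ih, idealOver_prime hp.1, primeOver_inert hr hp,
      Ideal.span_singleton_mul_span_singleton, Nat.cast_mul]

lemma absNorm_tripleIdeal (hr : Module.finrank ℤ R = 2) {m : ℕ} {t : ℕ × ℕ × ℕ} (ht : t ∈ triples R m) :
    Ideal.absNorm (E.tripleIdeal t) = t.1 * t.2.1 * t.2.2 ^ 2 := by
  rw [tripleIdeal, map_mul, map_mul, E.absNorm_map_σ, absNorm_idealOver_split ht.1,
    absNorm_idealOver_split ht.2.1, idealOver_inert hr ht.2.2, absNorm_span_nat hr]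

lemma suppOn_prime_mul {P : Set ℕ} {p n : ℕ} (hp : p.Prime) (h : p ∈ P) (hn : SuppOn P n) : SuppOn P (p * n) :=
  suppOn_mul_iff.2 ⟨⟨hp.ne_zero, fun _ hq hqp => (Nat.prime_dvd_prime_iff_eq hq hp).1 hqp ▸ h⟩, hn⟩

lemma exists_triple (hr : Module.finrank ℤ R = 2) {m : ℕ} {J : Ideal R} (hJ0 : J ≠ ⊥)
    (hJ : (Ideal.absNorm J).Coprime m) : ∃ t ∈ triples R m, E.tripleIdeal t = J := by
  induction J using UniqueFactorizationMonoid.induction_on_prime with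
  | h₁ => exact absurd rfl hJ0
  | h₂ I hI =>
    refine ⟨(1, 1, 1), ⟨suppOn_one _, suppOn_one _, suppOn_one _⟩, ?_⟩
    rw [isUnit_iff_eq_one.1 hI]
    simp only [tripleIdeal, idealOver_one, E.map_σ_one, one_mul]
  | h₃ I P hI hP ih =>
    rw [map_mul] at hJ
    obtain ⟨⟨a, b, c⟩, ⟨ha, hb, hc⟩, rfl⟩ := ih hI (Nat.Coprime.coprime_mul_left hJ)
    dsimp only at ha hb hc
    rcases E.prime_cases hr hP (Nat.Coprime.coprime_mul_right hJ) with ⟨p, hp, rfl | rfl⟩ | ⟨p, hp, rfl⟩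
    · refine ⟨(p * a, b, c), ⟨suppOn_prime_mul hp.1 hp ha, hb, hc⟩, ?_⟩
      simp only [tripleIdeal]
      rw [idealOver_mul hp.1.ne_zero ha.1, idealOver_prime hp.1]
      ring
    · refine ⟨(a, p * b, c), ⟨ha, suppOn_prime_mul hp.1 hp hb, hc⟩, ?_⟩
      simp only [tripleIdeal]
      rw [idealOver_mul hp.1.ne_zero hb.1, idealOver_prime hp.1, E.map_σ_mul]
      ring
    · refine ⟨(a, b, p * c), ⟨ha, hb, suppOn_prime_mul hp.1 hp hc⟩, ?_⟩
      simp only [tripleIdeal]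
      rw [idealOver_mul hp.1.ne_zero hc.1, idealOver_prime hp.1]
      ring

lemma prod_map_σ (s : Multiset (Ideal R)) : s.prod.map E.σ = (s.map (fun J => J.map E.σ)).prod := by
  induction s using Multiset.induction with
  | empty => simpa using E.map_σ_one
  | cons a s ih => simp only [Multiset.prod_cons, Multiset.map_cons, E.map_σ_mul, ih]

lemma σ_primeOver_ne {m : ℕ}
    (hτ : Ideal.absNorm (Ideal.span {E.τ - E.σ E.τ}) ∣ m) {p q : ℕ} (hp : p ∈ splitPrimes R m)
    (hq : q ∈ splitPrimes R m) : primeOver R p ≠ (primeOver R q).map E.σ := by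
  intro h
  have h1 := congrArg Ideal.absNorm h
  rw [E.absNorm_map_σ, absNorm_primeOver_split hp, absNorm_primeOver_split hq] at h1
  subst h1
  exact E.map_σ_ne hp.1 hτ hp.2.1 (absNorm_primeOver_split hp) h.symm

open Classical in
lemma tripleIdeal_injOn (hr : Module.finrank ℤ R = 2) {m : ℕ}
    (hτ : Ideal.absNorm (Ideal.span {E.τ - E.σ E.τ}) ∣ m) :
    Set.InjOn E.tripleIdeal (triples R m) := by
  set F : ℕ × ℕ × ℕ → Multiset (Ideal R) := fun t =>
    (t.1.primeFactorsList : Multiset ℕ).map (primeOver R) +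
    (t.2.1.primeFactorsList : Multiset ℕ).map (fun p => (primeOver R p).map E.σ) +
    (t.2.2.primeFactorsList : Multiset ℕ).map (primeOver R) with hF
  have hmem : ∀ {P : Set ℕ} {n : ℕ}, SuppOn P n → ∀ p ∈ (n.primeFactorsList : Multiset ℕ), p ∈ P := by
    intro P n h p hp
    rw [Multiset.mem_coe, Nat.mem_primeFactorsList h.1] at hp
    exact h.2 p hp.1 hp.2
  have hnf : ∀ t ∈ triples R m, UniqueFactorizationMonoid.normalizedFactors (E.tripleIdeal t) = F t := by
    rintro ⟨a, b, c⟩ ⟨ha, hb, hc⟩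
    dsimp only at ha hb hc
    have : E.tripleIdeal (a, b, c) = (F (a, b, c)).prod := by
      simp only [tripleIdeal, hF, Multiset.prod_add]
      congr 2
      rw [idealOver, E.prod_map_σ, Multiset.map_map]
      rfl
    rw [this]
    refine UniqueFactorizationMonoid.normalizedFactors_prod_of_prime fun P hP => ?_
    simp only [hF, Multiset.mem_add, Multiset.mem_map] at hP
    rcases hP with (⟨p, hp, rfl⟩ | ⟨p, hp, rfl⟩) | ⟨p, hp, rfl⟩
    · exact prime_primeOver_split (hmem ha p hp)
    · exact E.prime_map_σ (prime_primeOver_split (hmem hb p hp))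
    · exact prime_primeOver_inert hr (hmem hc p hp)
  have hSS := fun (p q : ℕ) (hp : p ∈ splitPrimes R m) (hq : q ∈ splitPrimes R m) => E.σ_primeOver_ne hτ hp hq
  have hNI : ∀ q ∈ inertPrimes R m, Ideal.absNorm (primeOver R q) = q ^ 2 := fun q hq => by
    rw [primeOver_inert hr hq, absNorm_span_nat hr]
  have hpq : ∀ p q : ℕ, p ∈ splitPrimes R m → p ≠ q ^ 2 := fun p q hp h =>
    Nat.Prime.not_prime_pow (le_refl 2) (h ▸ hp.1)
  have hSI : ∀ p q : ℕ, p ∈ splitPrimes R m → q ∈ inertPrimes R m → primeOver R p ≠ primeOver R q :=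
    fun p q hp hq h => hpq p q hp (by rw [← hNI q hq, ← h, absNorm_primeOver_split hp])
  have hTI : ∀ p q : ℕ, p ∈ splitPrimes R m → q ∈ inertPrimes R m →
      (primeOver R p).map E.σ ≠ primeOver R q :=
    fun p q hp hq h => hpq p q hp (by rw [← hNI q hq, ← h, E.absNorm_map_σ, absNorm_primeOver_split hp])
  have hret : ∀ {A : Multiset ℕ} {f : ℕ → Ideal R} {g : Ideal R → ℕ}, (∀ x ∈ A, g (f x) = x) →
      (A.map f).map g = A := by
    intro A f g h
    rw [Multiset.map_map]
    exact (Multiset.map_congr rfl h).trans (Multiset.map_id' A)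
  have key : ∀ t ∈ triples R m,
      ((F t).filter (fun P => ∃ p ∈ splitPrimes R m, P = primeOver R p)).map (fun P => Ideal.absNorm P) =
        (t.1.primeFactorsList : Multiset ℕ) ∧
      ((F t).filter (fun P => ∃ p ∈ splitPrimes R m, P = (primeOver R p).map E.σ)).map (fun P => Ideal.absNorm P) =
        (t.2.1.primeFactorsList : Multiset ℕ) ∧
      ((F t).filter (fun P => ∃ p ∈ inertPrimes R m, P = primeOver R p)).map (fun P => Nat.sqrt (Ideal.absNorm P)) =
        (t.2.2.primeFactorsList : Multiset ℕ) := by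
    rintro ⟨a, b, c⟩ ⟨ha, hb, hc⟩
    dsimp only at ha hb hc
    have ha := hmem ha
    have hb := hmem hb
    have hc := hmem hc
    simp only [hF, Multiset.filter_add]
    refine ⟨?_, ?_, ?_⟩
    · rw [Multiset.filter_eq_self.2, Multiset.filter_eq_nil.2, Multiset.filter_eq_nil.2, add_zero, add_zero, hret]
      · exact fun x hx => absNorm_primeOver_split (ha x hx)
      · intro P hP
        obtain ⟨q, hq, rfl⟩ := Multiset.mem_map.1 hP
        rintro ⟨p, hp, h⟩
        exact hSI p q hp (hc q hq) h.symm
      · intro P hP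
        obtain ⟨q, hq, rfl⟩ := Multiset.mem_map.1 hP
        rintro ⟨p, hp, h⟩
        exact hSS p q hp (hb q hq) h.symm
      · intro P hP
        obtain ⟨q, hq, rfl⟩ := Multiset.mem_map.1 hP
        exact ⟨q, ha q hq, rfl⟩
    · rw [Multiset.filter_eq_nil.2, Multiset.filter_eq_self.2, Multiset.filter_eq_nil.2, add_zero, zero_add, hret]
      · exact fun x hx => by rw [E.absNorm_map_σ, absNorm_primeOver_split (hb x hx)]
      · intro P hP
        obtain ⟨q, hq, rfl⟩ := Multiset.mem_map.1 hP
        rintro ⟨p, hp, h⟩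
        exact hTI p q hp (hc q hq) h.symm
      · intro P hP
        obtain ⟨q, hq, rfl⟩ := Multiset.mem_map.1 hP
        exact ⟨q, hb q hq, rfl⟩
      · intro P hP
        obtain ⟨q, hq, rfl⟩ := Multiset.mem_map.1 hP
        rintro ⟨p, hp, h⟩
        exact hSS q p (ha q hq) hp h
    · rw [Multiset.filter_eq_nil.2, Multiset.filter_eq_nil.2, Multiset.filter_eq_self.2, zero_add, zero_add, hret]
      · exact fun x hx => by rw [hNI x (hc x hx), sq, Nat.sqrt_eq]
      · intro P hP
        obtain ⟨q, hq, rfl⟩ := Multiset.mem_map.1 hP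
        exact ⟨q, hc q hq, rfl⟩
      · intro P hP
        obtain ⟨q, hq, rfl⟩ := Multiset.mem_map.1 hP
        rintro ⟨p, hp, h⟩
        exact hTI q p (hb q hq) hp h
      · intro P hP
        obtain ⟨q, hq, rfl⟩ := Multiset.mem_map.1 hP
        rintro ⟨p, hp, h⟩
        exact hSI q p (ha q hq) hp h
  have hprod : ∀ {m n : ℕ}, m ≠ 0 → n ≠ 0 → (m.primeFactorsList : Multiset ℕ) = n.primeFactorsList → m = n := by
    intro m n hm hn h
    have := congrArg Multiset.prod h
    rwa [Multiset.prod_coe, Multiset.prod_coe, Nat.prod_primeFactorsList hm, Nat.prod_primeFactorsList hn] at this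
  intro t ht t' ht' h
  have hFF : F t = F t' := by rw [← hnf t ht, ← hnf t' ht', h]
  obtain ⟨a1, a2, a3⟩ := key t ht
  obtain ⟨b1, b2, b3⟩ := key t' ht'
  rw [hFF] at a1 a2 a3
  exact Prod.ext (hprod ht.1.1 ht'.1.1 (a1.symm.trans b1))
    (Prod.ext (hprod ht.2.1.1 ht'.2.1.1 (a2.symm.trans b2)) (hprod ht.2.2.1 ht'.2.2.1 (a3.symm.trans b3)))

end QuadEmb
end Triples

section ClassCount
set_option linter.unusedSectionVars false
variable {R : Type*} [CommRing R] [IsDedekindDomain R] [Module.Free ℤ R] [Module.Finite ℤ R] [Finite (ClassGroup R)]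

namespace QuadEmb
variable (E : QuadEmb R) {G : Type*} [AddCommGroup G] {m : ℕ} (D : RayGroup (Ideal.span {(m : R)}) G)

lemma one_le_norm (hr : Module.finrank ℤ R = 2) {z : R} (hz : z ≠ 0) : 1 ≤ ‖E.φ z‖ := by
  have h := E.norm_sq hr z
  have h1 : 1 ≤ Ideal.absNorm (Ideal.span {z}) := by
    refine Nat.one_le_iff_ne_zero.2 fun h0 => hz ?_
    have := E.charZero
    rwa [Ideal.absNorm_eq_zero_iff, Ideal.span_singleton_eq_bot] at h0
  have h2 : (1 : ℝ) ≤ ‖E.φ z‖ ^ 2 := by rw [h]; exact_mod_cast h1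
  nlinarith [norm_nonneg (E.φ z)]

lemma eq_of_span_eq (E : QuadEmb R) (hr : Module.finrank ℤ R = 2) (hm : 3 ≤ m) {x y : R} (hx : x - 1 ∈ Ideal.span {(m : R)})
    (hy : y - 1 ∈ Ideal.span {(m : R)}) (h : Ideal.span {x} = Ideal.span {y}) : x = y := by
  obtain ⟨u, hu⟩ := Ideal.span_singleton_eq_span_singleton.1 h
  have h1 : (u : R) - 1 ∈ Ideal.span {(m : R)} := by
    have : (u : R) - 1 = (y - 1) - u * (x - 1) := by rw [← hu]; ring
    rw [this]
    exact Ideal.sub_mem _ hy (Ideal.mul_mem_left _ _ hx)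
  obtain ⟨z, hz⟩ := Ideal.mem_span_singleton'.1 h1
  have hu1 : ‖E.φ (u : R)‖ = 1 := by
    have := E.norm_sq hr (u : R)
    rw [Ideal.span_singleton_eq_top.2 u.isUnit, Ideal.absNorm_top, Nat.cast_one] at this
    nlinarith [norm_nonneg (E.φ (u : R))]
  have hz0 : z = 0 := by
    by_contra hz0
    have h2 := E.one_le_norm hr hz0
    have h3 := congrArg (fun w => ‖E.φ w‖) hz
    simp only [map_mul, map_sub, norm_mul, map_natCast, Complex.norm_natCast, map_one] at h3
    have h4 := norm_sub_le (E.φ (u : R)) 1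
    rw [hu1, norm_one, ← h3] at h4
    have : (3 : ℝ) ≤ m := by exact_mod_cast hm
    nlinarith
  rw [hz0, zero_mul, eq_comm, sub_eq_zero] at hz
  rw [← hu, hz, mul_one]

lemma ray_span {β : R} (h : β - 1 ∈ Ideal.span {(m : R)}) :
    IsCoprime (Ideal.span {β}) (Ideal.span {(m : R)}) ∧ D.ray (Ideal.span {β}) = 0 := by
  have hc : IsCoprime (Ideal.span {β}) (Ideal.span {(m : R)}) := by
    rw [Ideal.isCoprime_iff_exists]
    exact ⟨β, Ideal.mem_span_singleton_self _, 1 - β, by rw [← neg_sub]; exact (Ideal.span {(m : R)}).neg_mem h, by ring⟩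
  refine ⟨hc, ?_⟩
  rw [← D.ray_one]
  refine (D.ray_iff _ _ hc isCoprime_one_left).2 ⟨1, β, by simp, h, ?_⟩
  simp

lemma span_ne_top (hr : Module.finrank ℤ R = 2) (hm : 3 ≤ m) : Ideal.span {(m : R)} ≠ ⊤ := by
  intro h
  have := absNorm_span_nat (R := R) hr m
  rw [h, Ideal.absNorm_top] at this
  nlinarith

lemma exists_gen (hr : Module.finrank ℤ R = 2) (hm : 3 ≤ m) {J : Ideal R}
    (hJ : IsCoprime J (Ideal.span {(m : R)})) (h : D.ray J = 0) :
    ∃ β, β - 1 ∈ Ideal.span {(m : R)} ∧ J = Ideal.span {β} := by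
  rw [← D.ray_one] at h
  obtain ⟨a, b, ha, hb, hab⟩ := (D.ray_iff _ _ hJ isCoprime_one_left).1 h
  rw [mul_one] at hab
  have hbm : b ∈ Ideal.span {a} * J := hab ▸ Ideal.mem_span_singleton_self b
  obtain ⟨β, hβ, rfl⟩ := Ideal.mem_span_singleton_mul.1 hbm
  refine ⟨β, ?_, ?_⟩
  · have : β - 1 = (a * β - 1) - β * (a - 1) := by ring
    rw [this]
    exact Ideal.sub_mem _ hb (Ideal.mul_mem_left _ _ ha)
  · rw [← Ideal.span_singleton_mul_span_singleton] at hab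
    refine ideal_mul_left_cancel ?_ hab
    intro h0
    rw [Ideal.span_singleton_eq_bot] at h0
    rw [h0, zero_sub] at ha
    refine span_ne_top hr hm ((Ideal.eq_top_iff_one _).2 ?_)
    simpa using (Ideal.span {(m : R)}).neg_mem ha

theorem class_count (hr : Module.finrank ℤ R = 2) (hm : 3 ≤ m) {c C : ℝ} (hc : 0 < c)
    (h : ∀ r : ℝ, 0 ≤ r → |({x : R | ‖E.φ x‖ ≤ r}.ncard : ℝ) - c * r ^ 2| ≤ C * (r + 1)) (g : G) :
    ∃ C' : ℝ, ∀ x : ℝ, 1 ≤ x →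
      |({J : Ideal R | IsCoprime J (Ideal.span {(m : R)}) ∧ D.ray J = g ∧ Ideal.absNorm J ≤ ⌊x⌋₊}.ncard : ℝ) -
        c / m ^ 2 * x| ≤ C' * √x := by
  obtain ⟨K, hK, hKg⟩ := D.ray_surj (-g)
  have hcz := E.charZero
  have hMt : (Ideal.span {(m : R)}) ≠ ⊤ := span_ne_top hr hm
  have hK0 : K ≠ ⊥ := RayGroup.ne_bot_of_coprime hMt hK
  obtain ⟨β₀, hβ₀, j, hj, hij⟩ := hK.exists
  have hβ₁ : β₀ - 1 ∈ (Ideal.span {(m : R)}) := by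
    have : β₀ - 1 = -j := by linear_combination hij
    rw [this]; exact (Ideal.span {(m : R)}).neg_mem hj
  have hMN : Ideal.absNorm (Ideal.span {(m : R)}) = m ^ 2 := absNorm_span_nat hr m
  have hNK : Ideal.absNorm K ≠ 0 := fun h0 => hK0 (Ideal.absNorm_eq_zero_iff.1 h0)
  have hmk : Ideal.absNorm ((Ideal.span {(m : R)}) * K) = m ^ 2 * Ideal.absNorm K := by rw [map_mul, hMN]
  have hcard : Nat.card (R ⧸ (Ideal.span {(m : R)}) * K) = m ^ 2 * Ideal.absNorm K := by
    rw [← hmk, Ideal.absNorm_apply, Submodule.cardQuot_apply]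
  have hfin : Finite (R ⧸ (Ideal.span {(m : R)}) * K) := by
    refine Nat.finite_of_card_ne_zero ?_
    rw [hcard]
    exact mul_ne_zero (pow_ne_zero _ (by omega)) hNK
  obtain ⟨C', hC'⟩ := E.coset_count hr hc h ((Ideal.span {(m : R)}) * K) β₀
  have hmem : ∀ β, β - β₀ ∈ (Ideal.span {(m : R)}) * K ↔ β ∈ K ∧ β - 1 ∈ (Ideal.span {(m : R)}) := by
    intro β
    rw [Ideal.mul_eq_inf_of_coprime (Ideal.isCoprime_iff_sup_eq.1 hK.symm), Submodule.mem_inf]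
    constructor
    · rintro ⟨h1, h2⟩
      exact ⟨by simpa using K.add_mem h2 hβ₀, by simpa using (Ideal.span {(m : R)}).add_mem h1 hβ₁⟩
    · rintro ⟨h1, h2⟩
      exact ⟨by simpa using (Ideal.span {(m : R)}).sub_mem h2 hβ₁, K.sub_mem h1 hβ₀⟩
  set N : ℝ := (Ideal.absNorm K : ℝ) with hN
  have hN1 : 1 ≤ N := by
    rw [hN]; exact_mod_cast Nat.one_le_iff_ne_zero.2 hNK
  have hncard : ∀ x : ℝ, 1 ≤ x →
      {J : Ideal R | IsCoprime J (Ideal.span {(m : R)}) ∧ D.ray J = g ∧ Ideal.absNorm J ≤ ⌊x⌋₊}.ncard =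
      {β : R | β - β₀ ∈ (Ideal.span {(m : R)}) * K ∧ ‖E.φ β‖ ≤ √(x * N)}.ncard := by
    intro x hx
    have hle : ∀ {J : Ideal R} {β : R}, J * K = Ideal.span {β} →
        (Ideal.absNorm J ≤ ⌊x⌋₊ ↔ ‖E.φ β‖ ≤ √(x * N)) := by
      intro J β hJβ
      have hxN : 0 ≤ x * N := by nlinarith
      rw [Nat.le_floor_iff (by linarith), Real.le_sqrt (norm_nonneg _) hxN, E.norm_sq hr, ← hJβ, map_mul,
        Nat.cast_mul]
      exact (mul_le_mul_iff_left₀ (by linarith)).symm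
    have h1 : Set.InjOn (fun J : Ideal R => J * K)
        {J : Ideal R | IsCoprime J (Ideal.span {(m : R)}) ∧ D.ray J = g ∧ Ideal.absNorm J ≤ ⌊x⌋₊} := by
      intro J _ J' _ hJJ
      refine ideal_mul_left_cancel hK0 ?_
      rw [mul_comm K, mul_comm K]
      exact hJJ
    have h2 : Set.InjOn (fun β : R => Ideal.span {β}) {β : R | β - β₀ ∈ (Ideal.span {(m : R)}) * K ∧ ‖E.φ β‖ ≤ √(x * N)} := by
      intro β hβ β' hβ' hbb
      exact E.eq_of_span_eq hr hm ((hmem _).1 hβ.1).2 ((hmem _).1 hβ'.1).2 hbb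
    rw [← h1.ncard_image, ← h2.ncard_image]
    congr 1
    ext I
    constructor
    · rintro ⟨J, ⟨hJ1, hJ2, hJ3⟩, rfl⟩
      have : D.ray (J * K) = 0 := by rw [D.ray_mul _ _ hJ1 hK, hJ2, hKg, add_neg_cancel]
      obtain ⟨β, hβ, hβJ⟩ := exists_gen D hr hm (hJ1.mul_left hK) this
      refine ⟨β, ⟨(hmem _).2 ⟨?_, hβ⟩, (hle hβJ).1 hJ3⟩, hβJ.symm⟩
      exact Ideal.mul_le_right (I := J) (hβJ ▸ Ideal.mem_span_singleton_self β)
    · rintro ⟨β, ⟨hβ1, hβ2⟩, rfl⟩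
      obtain ⟨hβK, hβM⟩ := (hmem _).1 hβ1
      obtain ⟨hco, hray⟩ := ray_span D hβM
      have : K ∣ Ideal.span {β} := by rwa [Ideal.dvd_iff_le, Ideal.span_singleton_le_iff_mem]
      obtain ⟨J, hJ⟩ := this
      rw [hJ] at hco hray
      have hJc : IsCoprime J (Ideal.span {(m : R)}) := hco.of_mul_left_right
      rw [D.ray_mul _ _ hK hJc, hKg, neg_add_eq_zero] at hray
      rw [mul_comm] at hJ
      exact ⟨J, ⟨hJc, hray.symm, (hle hJ.symm).2 hβ2⟩, hJ.symm⟩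
  have hC'0 : 0 ≤ C' := by
    have := (abs_nonneg _).trans (hC' 0 le_rfl)
    linarith
  have hm0 : (0 : ℝ) < m := by
    have : 0 < m := by omega
    exact_mod_cast this
  refine ⟨C' * (√N + 1) / (m ^ 2 * N), fun x hx => ?_⟩
  rw [hncard x hx]
  have h3 := hC' (√(x * N)) (Real.sqrt_nonneg _)
  rw [hcard, Real.sq_sqrt (mul_nonneg (by linarith) (by linarith))] at h3
  push_cast at h3
  rw [← hN] at h3
  set n : ℝ := ({β : R | β - β₀ ∈ (Ideal.span {(m : R)}) * K ∧ ‖E.φ β‖ ≤ √(x * N)}.ncard : ℝ)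
  have hpos : 0 < (m : ℝ) ^ 2 * N := by positivity
  have h4 : n - c / m ^ 2 * x = ((m : ℝ) ^ 2 * N * n - c * (x * N)) / (m ^ 2 * N) := by
    field_simp
  rw [h4, abs_div, abs_of_pos hpos, div_mul_eq_mul_div]
  refine div_le_div_of_nonneg_right (h3.trans ?_) hpos.le
  rw [mul_assoc]
  refine mul_le_mul_of_nonneg_left ?_ hC'0
  rw [Real.sqrt_mul (by linarith)]
  have : 1 ≤ √x := by rw [Real.one_le_sqrt]; exact hx
  nlinarith

end QuadEmb
end ClassCount

section RayClassData
set_option linter.unusedSectionVars false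
variable {R : Type*} [CommRing R] [IsDedekindDomain R] [Module.Free ℤ R] [Module.Finite ℤ R] [Finite (ClassGroup R)]

namespace QuadEmb
variable (E : QuadEmb R) {G : Type*} [AddCommGroup G] {m : ℕ} (D : RayGroup (Ideal.span {(m : R)}) G)

lemma isCoprime_map_σ {J : Ideal R} (h : IsCoprime J (Ideal.span {(m : R)})) :
    IsCoprime (J.map E.σ) (Ideal.span {(m : R)}) := by
  have := E.charZero
  rw [isCoprime_span_natCast_iff] at h ⊢
  rwa [E.absNorm_map_σ]

lemma rayRel_map_σ {J J' : Ideal R} (h : RayRel (Ideal.span {(m : R)}) J J') :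
    RayRel (Ideal.span {(m : R)}) (J.map E.σ) (J'.map E.σ) := by
  have key : ∀ a : R, a - 1 ∈ Ideal.span {(m : R)} → E.σ a - 1 ∈ Ideal.span {(m : R)} := by
    intro a ha
    obtain ⟨c, hc⟩ := Ideal.mem_span_singleton'.1 ha
    refine Ideal.mem_span_singleton'.2 ⟨E.σ c, ?_⟩
    rw [← map_natCast E.σ m, ← map_mul, hc, map_sub, map_one]
  obtain ⟨a, b, ha, hb, hab⟩ := h
  refine ⟨_, _, key a ha, key b hb, ?_⟩
  have := congrArg (fun I : Ideal R => I.map E.σ) hab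
  simpa [E.map_σ_mul, E.map_σ_span] using this

lemma ray_map_σ_congr {J J' : Ideal R} (h : IsCoprime J (Ideal.span {(m : R)})) (h' : IsCoprime J' (Ideal.span {(m : R)}))
    (hJ : D.ray J = D.ray J') : D.ray (J.map E.σ) = D.ray (J'.map E.σ) :=
  (D.ray_iff _ _ (E.isCoprime_map_σ h) (E.isCoprime_map_σ h')).2
    (E.rayRel_map_σ ((D.ray_iff _ _ h h').1 hJ))

/-- Conjugation on the ray class group. -/
noncomputable def raySigma : G →+ G :=
  AddMonoidHom.mk' (fun g => D.ray ((D.ray_surj g).choose.map E.σ)) fun g g' => by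
    obtain ⟨h1, h2⟩ := (D.ray_surj g).choose_spec
    obtain ⟨h3, h4⟩ := (D.ray_surj g').choose_spec
    obtain ⟨h5, h6⟩ := (D.ray_surj (g + g')).choose_spec
    rw [← D.ray_mul _ _ (E.isCoprime_map_σ h1) (E.isCoprime_map_σ h3), ← E.map_σ_mul]
    refine E.ray_map_σ_congr D h5 (h1.mul_left h3) ?_
    rw [h6, D.ray_mul _ _ h1 h3, h2, h4]

lemma raySigma_ray {J : Ideal R} (h : IsCoprime J (Ideal.span {(m : R)})) :
    E.raySigma D (D.ray J) = D.ray (J.map E.σ) :=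
  E.ray_map_σ_congr D (D.ray_surj (D.ray J)).choose_spec.1 h (D.ray_surj (D.ray J)).choose_spec.2

/-- The class of `idealOver R n`, extended additively. -/
noncomputable def rayGamma (n : ℕ) : G := ((n.primeFactorsList : Multiset ℕ).map (fun p => D.ray (primeOver R p))).sum

lemma rayGamma_mul {a b : ℕ} (ha : a ≠ 0) (hb : b ≠ 0) : rayGamma D (a * b) = rayGamma D a + rayGamma D b := by
  rw [rayGamma, coe_primeFactorsList_mul ha hb, Multiset.map_add, Multiset.sum_add]
  rfl

lemma rayGamma_eq {P : Set ℕ} (hP : ∀ p ∈ P, p.Prime ∧ IsCoprime (primeOver R p) (Ideal.span {(m : R)})) {n : ℕ}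
    (hn : SuppOn P n) :
    IsCoprime (idealOver R n) (Ideal.span {(m : R)}) ∧ rayGamma D n = D.ray (idealOver R n) := by
  refine suppOn_induction (P := P) (Q := fun n => IsCoprime (idealOver R n) (Ideal.span {(m : R)}) ∧
    rayGamma D n = D.ray (idealOver R n)) ?_ ?_ hn
  · rw [idealOver_one]
    rw [D.ray_one]
    exact ⟨isCoprime_one_left, by simp [rayGamma]⟩
  · rintro p hp n hn ⟨h1, h2⟩
    obtain ⟨h3, h4⟩ := hP p hp
    have h5 : rayGamma D p = D.ray (primeOver R p) := by simp [rayGamma, Nat.primeFactorsList_prime h3]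
    rw [idealOver_mul h3.ne_zero hn.1, idealOver_prime h3, rayGamma_mul D h3.ne_zero hn.1, h2, h5,
      D.ray_mul _ _ h4 h1]
    exact ⟨h4.mul_left h1, rfl⟩

lemma rayGamma_split {n : ℕ} (hn : SuppOn (splitPrimes R m) n) :
    IsCoprime (idealOver R n) (Ideal.span {(m : R)}) ∧ rayGamma D n = D.ray (idealOver R n) := by
  refine rayGamma_eq D (fun p hp => ⟨hp.1, ?_⟩) hn
  rw [isCoprime_span_natCast_iff, absNorm_primeOver_split hp]
  exact (Nat.Prime.coprime_iff_not_dvd hp.1).2 hp.2.1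

lemma rayGamma_inert (hr : Module.finrank ℤ R = 2) {n : ℕ} (hn : SuppOn (inertPrimes R m) n) :
    IsCoprime (idealOver R n) (Ideal.span {(m : R)}) ∧ rayGamma D n = D.ray (idealOver R n) := by
  refine rayGamma_eq D (fun p hp => ⟨hp.1, ?_⟩) hn
  rw [isCoprime_span_natCast_iff, primeOver_inert hr hp, absNorm_span_nat hr]
  exact Nat.Coprime.pow_left _ ((Nat.Prime.coprime_iff_not_dvd hp.1).2 hp.2.1)

lemma ray_tripleIdeal (hr : Module.finrank ℤ R = 2) {t : ℕ × ℕ × ℕ} (ht : t ∈ triples R m) :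
    IsCoprime (E.tripleIdeal t) (Ideal.span {(m : R)}) ∧
      D.ray (E.tripleIdeal t) = rayGamma D t.1 + E.raySigma D (rayGamma D t.2.1) + rayGamma D t.2.2 := by
  obtain ⟨h1, h2⟩ := rayGamma_split D ht.1
  obtain ⟨h3, h4⟩ := rayGamma_split D ht.2.1
  obtain ⟨h5, h6⟩ := rayGamma_inert D hr ht.2.2
  have h7 := E.isCoprime_map_σ h3
  refine ⟨(h1.mul_left h7).mul_left h5, ?_⟩
  rw [tripleIdeal, D.ray_mul _ _ (h1.mul_left h7) h5, D.ray_mul _ _ h1 h7, h2, h4, h6, E.raySigma_ray D h3]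

/-- The class data of the ray class group modulo `m`. -/
theorem exists_classData (hr : Module.finrank ℤ R = 2) (hm : 3 ≤ m) [Finite G]
    (hτ : Ideal.absNorm (Ideal.span {E.τ - E.σ E.τ}) ∣ m) :
    ∃ A : ClassData G, A.S = splitPrimes R m ∧ A.Q = inertPrimes R m ∧ A.γ = rayGamma D ∧ A.σ = E.raySigma D := by
  have := Fintype.ofFinite G
  obtain ⟨c, C, hc, h⟩ := E.lattice_count hr
  choose C' hC' using E.class_count D hr hm hc h
  have hm0 : (0 : ℝ) < m := by
    have : 0 < m := by omega
    exact_mod_cast this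
  refine ⟨{
    σ := E.raySigma D
    σσ := ?_
    S := splitPrimes R m
    Q := inertPrimes R m
    disj := disjoint_split_inert hr m
    γ := rayGamma D
    γ_mul := fun a b ha hb => rayGamma_mul D ha hb
    κ := c / m ^ 2
    κ_pos := by positivity
    C := ∑ g, |C' g|
    count := ?_ }, rfl, rfl, rfl, rfl⟩
  · intro g
    obtain ⟨J, hJ, rfl⟩ := D.ray_surj g
    rw [E.raySigma_ray D hJ, E.raySigma_ray D (E.isCoprime_map_σ hJ), E.map_σ_σ]
  · intro g x hx
    have h1 : {t : ℕ × ℕ × ℕ | (SuppOn (splitPrimes R m) t.1 ∧ SuppOn (splitPrimes R m) t.2.1 ∧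
        SuppOn (inertPrimes R m) t.2.2) ∧
        rayGamma D t.1 + E.raySigma D (rayGamma D t.2.1) + rayGamma D t.2.2 = g ∧
        t.1 * t.2.1 * t.2.2 ^ 2 ≤ ⌊x⌋₊}.ncard =
        {J : Ideal R | IsCoprime J (Ideal.span {(m : R)}) ∧ D.ray J = g ∧ Ideal.absNorm J ≤ ⌊x⌋₊}.ncard := by
      rw [← Set.InjOn.ncard_image (f := E.tripleIdeal)]
      · congr 1
        ext J
        constructor
        · rintro ⟨t, ⟨ht, h2, h3⟩, rfl⟩
          obtain ⟨h4, h5⟩ := E.ray_tripleIdeal D hr ht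
          exact ⟨h4, h5.trans h2, by rwa [E.absNorm_tripleIdeal hr ht]⟩
        · rintro ⟨h2, h3, h4⟩
          have hJ0 := RayGroup.ne_bot_of_coprime (span_ne_top hr hm) h2
          obtain ⟨t, ht, rfl⟩ := E.exists_triple hr hJ0 (isCoprime_span_natCast_iff.1 h2)
          obtain ⟨h5, h6⟩ := E.ray_tripleIdeal D hr ht
          exact ⟨t, ⟨ht, h6.symm.trans h3, by rwa [← E.absNorm_tripleIdeal hr ht]⟩, rfl⟩
      · exact (E.tripleIdeal_injOn hr hτ).mono fun t ht => ht.1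
    rw [h1]
    refine (hC' g x hx).trans (mul_le_mul_of_nonneg_right ?_ (Real.sqrt_nonneg _))
    exact (le_abs_self _).trans (Finset.single_le_sum (f := fun g => |C' g|) (fun _ _ => abs_nonneg _) (Finset.mem_univ g))

end QuadEmb
end RayClassData

section NormValues
set_option linter.unusedSectionVars false
variable {R : Type*} [CommRing R] [IsDedekindDomain R] [Module.Free ℤ R] [Module.Finite ℤ R] [Finite (ClassGroup R)]

namespace QuadEmb
variable (E : QuadEmb R) {G : Type*} [AddCommGroup G] {m : ℕ} (D : RayGroup (Ideal.span {(m : R)}) G)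

include E in
lemma exists_factor (hm : m ≠ 0) {J : Ideal R} (hJ0 : J ≠ ⊥) :
    ∃ A B : Ideal R, SuppOn (m.primeFactors : Set ℕ) (Ideal.absNorm A) ∧ IsCoprime B (Ideal.span {(m : R)}) ∧
      A * B = J := by
  have hz := E.charZero
  induction J using UniqueFactorizationMonoid.induction_on_prime with
  | h₁ => exact absurd rfl hJ0
  | h₂ I hI =>
    refine ⟨1, 1, ?_, isCoprime_one_left, by rw [isUnit_iff_eq_one.1 hI, one_mul]⟩
    rw [map_one]
    exact suppOn_one _
  | h₃ I P hI hP ih =>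
    obtain ⟨A, B, hA, hB, rfl⟩ := ih hI
    by_cases h : IsCoprime P (Ideal.span {(m : R)})
    · exact ⟨A, P * B, hA, h.mul_left hB, by rw [mul_left_comm]⟩
    · refine ⟨P * A, B, ?_, hB, by rw [mul_assoc]⟩
      have hA0 := hA.1
      have hP0 : Ideal.absNorm P ≠ 0 := fun h0 => hP.ne_zero (Ideal.absNorm_eq_zero_iff.1 h0)
      rw [map_mul]
      refine ⟨mul_ne_zero hP0 hA0, fun q hq hqd => ?_⟩
      rcases hq.dvd_mul.1 hqd with hqd | hqd
      · have hPm := (Ideal.isPrime_of_prime hP).isMaximal hP.ne_zero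
        obtain ⟨p, k, -, -, hp, hN⟩ := Ideal.exists_prime_and_absNorm_eq_pow P
        rw [hN] at hqd
        rw [isCoprime_span_natCast_iff, Nat.Prime.not_coprime_iff_dvd] at h
        obtain ⟨l, hl, hl1, hl2⟩ := h
        have h1 : q = p := (Nat.prime_dvd_prime_iff_eq hq hp).1 (hq.dvd_of_dvd_pow hqd)
        have h2 : l = p := (Nat.prime_dvd_prime_iff_eq hl hp).1 (hl.dvd_of_dvd_pow (hN ▸ hl1))
        rw [h1, ← h2]
        exact Nat.mem_primeFactors.2 ⟨hl, hl2, hm⟩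
      · exact hA.2 q hq hqd

/-- The classes completing an ideal of norm `a` to a principal ideal with generator in `I`. -/
def completing (I : AddSubgroup R) (a : ℕ) : Set G :=
  {g | ∃ B : Ideal R, IsCoprime B (Ideal.span {(m : R)}) ∧ D.ray B = g ∧
    ∃ A : Ideal R, Ideal.absNorm A = a ∧ ∃ α ∈ I, A * B = Ideal.span {α}}

theorem norms_eq_values (hr : Module.finrank ℤ R = 2) (hm : 3 ≤ m)
    {I : AddSubgroup R} (hI : ∀ r : R, (m : R) * r ∈ I) {A : ClassData G} (hS : A.S = splitPrimes R m)
    (hQ : A.Q = inertPrimes R m) (hγ : A.γ = rayGamma D) (hσ : A.σ = E.raySigma D) :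
    {n : ℕ | ∃ α ∈ I, α ≠ 0 ∧ Ideal.absNorm (Ideal.span {α}) = n} = A.values m.primeFactors (completing D I) := by
  have hz := E.charZero
  ext n
  constructor
  · rintro ⟨α, hα, hα0, rfl⟩
    obtain ⟨J, B, hJ, hB, hJB⟩ := E.exists_factor (m := m) (by omega)
      (J := Ideal.span {α}) (by rwa [Ne, Ideal.span_singleton_eq_bot])
    obtain ⟨t, ht, rfl⟩ := E.exists_triple hr (RayGroup.ne_bot_of_coprime (span_ne_top hr hm) hB)
      (isCoprime_span_natCast_iff.1 hB)
    refine ⟨Ideal.absNorm J, (t.1 * t.2.1, t.2.2), hJ, ⟨⟨?_, ?_⟩, t.1, t.2.1, rfl, ?_⟩, ?_⟩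
    · rw [hS]; exact suppOn_mul_iff.2 ⟨ht.1, ht.2.1⟩
    · rw [hQ]; exact ht.2.2
    · rw [hγ, hσ, ← (E.ray_tripleIdeal D hr ht).2]
      exact ⟨_, hB, rfl, J, rfl, α, hα, hJB⟩
    · rw [← hJB, map_mul, E.absNorm_tripleIdeal hr ht]
      rfl
  · rintro ⟨a, t, ha, ⟨⟨ht1, ht2⟩, b, c, hbc, B, hB, hBg, J, rfl, α, hα, hJB⟩, rfl⟩
    rw [hS, ← hbc] at ht1
    rw [hQ] at ht2
    obtain ⟨hb, hc⟩ := suppOn_mul_iff.1 ht1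
    have ht : (b, c, t.2) ∈ triples R m := ⟨hb, hc, ht2⟩
    obtain ⟨h1, h2⟩ := E.ray_tripleIdeal D hr ht
    have hN := E.absNorm_tripleIdeal hr ht
    rw [hγ, hσ, ← h2] at hBg
    obtain ⟨u, v, hu, hv, huv⟩ := (D.ray_iff _ _ hB h1).1 hBg
    have h3 : Ideal.span {v} * (J * E.tripleIdeal (b, c, t.2)) = Ideal.span {u * α} := by
      rw [mul_left_comm, ← huv, mul_left_comm, hJB, Ideal.span_singleton_mul_span_singleton]
    have h4 : u * α ∈ Ideal.span {v} * (J * E.tripleIdeal (b, c, t.2)) := h3 ▸ Ideal.mem_span_singleton_self _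
    obtain ⟨β, hβ, hvβ⟩ := Ideal.mem_span_singleton_mul.1 h4
    have hv0 : Ideal.span {v} ≠ ⊥ := RayGroup.ne_bot_of_coprime (span_ne_top hr hm) (ray_span D hv).1
    have h5 : J * E.tripleIdeal (b, c, t.2) = Ideal.span {β} := by
      refine ideal_mul_left_cancel hv0 ?_
      rw [h3, ← hvβ, Ideal.span_singleton_mul_span_singleton]
    have h6 : β - α ∈ Ideal.span {(m : R)} := by
      have : β - α = α * (u - 1) - β * (v - 1) := by linear_combination hvβ
      rw [this]
      exact Ideal.sub_mem _ (Ideal.mul_mem_left _ _ hu) (Ideal.mul_mem_left _ _ hv)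
    obtain ⟨r, hr'⟩ := Ideal.mem_span_singleton.1 h6
    have hval : Ideal.absNorm (Ideal.span {β}) = Ideal.absNorm J * ClassData.pairNorm t := by
      rw [← h5, map_mul, hN, hbc]
      rfl
    refine ⟨β, ?_, ?_, hval⟩
    · rw [← sub_add_cancel β α, hr']
      exact I.add_mem (hI r) hα
    · rintro rfl
      rw [Ideal.span_singleton_zero, Ideal.absNorm_bot] at hval
      refine mul_ne_zero ha.1 ?_ hval.symm
      rw [ClassData.pairNorm]
      exact mul_ne_zero (hbc ▸ ht1.1) (pow_ne_zero _ ht2.1)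

theorem exists_tendsto_norms (hr : Module.finrank ℤ R = 2) (hm : 3 ≤ m)
    (hτ : Ideal.absNorm (Ideal.span {E.τ - E.σ E.τ}) ∣ m) {I : AddSubgroup R} (hI : ∀ r : R, (m : R) * r ∈ I) :
    ∃ F, Tendsto (fun x : ℝ => ({n : ℕ | (∃ α ∈ I, α ≠ 0 ∧ Ideal.absNorm (Ideal.span {α}) = n) ∧ n ≤ ⌊x⌋₊}.ncard : ℝ)
      * √(log x) / x) atTop (nhds F) := by
  have hz := E.charZero
  have hfq : Finite (R ⧸ Ideal.span {(m : R)}) := by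
    refine Nat.finite_of_card_ne_zero ?_
    rw [← Submodule.cardQuot_apply, ← Ideal.absNorm_apply, absNorm_span_nat hr]
    exact pow_ne_zero _ (by omega)
  let D := rayGroup (Ideal.span {(m : R)})
  have hG := D.finite (span_ne_top hr hm)
  obtain ⟨A, hS, hQ, hγ, hσ⟩ := E.exists_classData D hr hm hτ
  have hP : ∀ p ∈ m.primeFactors, p ∉ A.S ∧ p ∉ A.Q := by
    intro p hp
    rw [hS, hQ]
    exact ⟨fun h => h.2.1 (Nat.dvd_of_mem_primeFactors hp), fun h => h.2.1 (Nat.dvd_of_mem_primeFactors hp)⟩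
  obtain ⟨F, hF⟩ := A.exists_tendsto_values hP (completing D I)
  refine ⟨F, ?_⟩
  rw [← E.norms_eq_values D hr hm hI hS hQ hγ hσ] at hF
  exact hF

end QuadEmb
end NormValues

section BinaryForm
set_option linter.unusedSectionVars false

namespace QuadEmb

theorem exists_tendsto_form {R : Type*} [CommRing R] [IsDedekindDomain R] [Module.Free ℤ R] [Module.Finite ℤ R]
    [Finite (ClassGroup R)] (E : QuadEmb R) (hr : Module.finrank ℤ R = 2) {A : ℕ} {B C : ℤ} (hA : 0 < A)
    (hB : E.τ + E.σ E.τ = (B : R)) (hC : E.τ * E.σ E.τ = (A : R) * (C : R)) :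
    ∃ F, Tendsto (fun x : ℝ => ({n : ℕ | (n ≠ 0 ∧ ∃ i j : ℤ, (A : ℤ) * (A * i ^ 2 + B * (i * j) + C * j ^ 2) = n) ∧
      n ≤ ⌊x⌋₊}.ncard : ℝ) * √(log x) / x) atTop (nhds F) := by
  have hz := E.charZero
  set N := Ideal.absNorm (Ideal.span {E.τ - E.σ E.τ}) with hN
  have hNR : (E.τ - E.σ E.τ) * (E.σ E.τ - E.τ) = (N : R) := by
    have := E.mul_σ hr (E.τ - E.σ E.τ)
    rwa [map_sub, E.σσ] at this
  have hN0 : N ≠ 0 := by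
    intro h0
    rw [h0, Nat.cast_zero] at hNR
    have h1 : E.τ = E.σ E.τ := by
      rcases mul_eq_zero.1 hNR with h | h
      · exact sub_eq_zero.1 h
      · exact (sub_eq_zero.1 h).symm
    have h2 := congrArg (fun x => (E.φ x).im) h1
    simp only [E.φ_σ, Complex.conj_im] at h2
    exact E.im_τ (by linarith)
  let I : AddSubgroup R :=
    { carrier := {α | ∃ i j : ℤ, α = A * i + j * E.τ}
      zero_mem' := ⟨0, 0, by simp⟩
      add_mem' := by
        rintro _ _ ⟨i, j, rfl⟩ ⟨i', j', rfl⟩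
        exact ⟨i + i', j + j', by push_cast; ring⟩
      neg_mem' := by
        rintro _ ⟨i, j, rfl⟩
        exact ⟨-i, -j, by push_cast; ring⟩ }
  have hI : ∀ r : R, ((6 * A * N : ℕ) : R) * r ∈ I := by
    intro r
    obtain ⟨s, hs⟩ := E.exists_int_of_fixed hr (y := r + E.σ r) (by rw [map_add, E.σσ, add_comm])
    obtain ⟨u, hu⟩ := E.exists_int_of_fixed hr (y := (r - E.σ r) * (E.τ - E.σ E.τ)) (by
      simp only [map_mul, map_sub, E.σσ]; ring)
    refine ⟨3 * (N * s + u * B), -(6 * A * u), ?_⟩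
    push_cast
    linear_combination 3 * A * N * hs - 3 * A * (r - E.σ r) * hNR + 3 * A * (E.σ E.τ - E.τ) * hu + 3 * A * u * hB
  have hm : 3 ≤ 6 * A * N := by
    have := Nat.mul_pos hA (Nat.pos_of_ne_zero hN0)
    nlinarith
  obtain ⟨F, hF⟩ := E.exists_tendsto_norms hr hm (Dvd.intro_left _ rfl) hI
  refine ⟨F, ?_⟩
  have key : ∀ i j : ℤ, ((Ideal.absNorm (Ideal.span {(A * i + j * E.τ : R)}) : ℕ) : ℤ) =
      (A : ℤ) * (A * i ^ 2 + B * (i * j) + C * j ^ 2) := by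
    intro i j
    have h := E.mul_σ hr (A * i + j * E.τ : R)
    refine Int.cast_injective (α := R) ?_
    rw [Int.cast_natCast, ← h]
    simp only [map_add, map_mul, map_natCast, map_intCast]
    push_cast
    linear_combination (A * i * j : R) * hB + (j : R) ^ 2 * hC
  have hset : ∀ n : ℕ, (n ≠ 0 ∧ ∃ i j : ℤ, (A : ℤ) * (A * i ^ 2 + B * (i * j) + C * j ^ 2) = n) ↔
      ∃ α ∈ I, α ≠ 0 ∧ Ideal.absNorm (Ideal.span {α}) = n := fun n => by
    constructor
    · rintro ⟨hn0, i, j, h⟩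
      have h1 : Ideal.absNorm (Ideal.span {(A * i + j * E.τ : R)}) = n := by
        have := key i j
        rw [h] at this
        exact_mod_cast this
      refine ⟨_, ⟨i, j, rfl⟩, ?_, h1⟩
      intro h0
      rw [h0, Ideal.span_singleton_zero, Ideal.absNorm_bot] at h1
      exact hn0 h1.symm
    · rintro ⟨_, ⟨i, j, rfl⟩, h0, rfl⟩
      refine ⟨?_, i, j, (key i j).symm⟩
      rwa [Ne, Ideal.absNorm_eq_zero_iff, Ideal.span_singleton_eq_bot]
  simpa only [hset] using hF

end QuadEmb

open NumberField in
theorem exists_tendsto_binary_form {A : ℕ} {B C : ℤ} (hA : 0 < A) (hd : B ^ 2 < 4 * A * C) :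
    ∃ F, Tendsto (fun x : ℝ => ({n : ℕ | (n ≠ 0 ∧ ∃ i j : ℤ, (A : ℤ) * (A * i ^ 2 + B * (i * j) + C * j ^ 2) = n) ∧
      n ≤ ⌊x⌋₊}.ncard : ℝ) * √(log x) / x) atTop (nhds F) := by
  have hd' : (0 : ℝ) < 4 * A * C - B ^ 2 := by
    have : (B : ℝ) ^ 2 < 4 * A * C := by exact_mod_cast hd
    linarith
  set t : ℂ := ⟨(B : ℝ) / 2, √(4 * A * C - B ^ 2) / 2⟩ with ht
  have him : t.im ≠ 0 := by
    have := Real.sqrt_pos.2 hd'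
    simp only [ht]
    positivity
  have hsum : t + starRingEnd ℂ t = (B : ℂ) := by
    apply Complex.ext <;> simp [ht]
  have hprod : t * starRingEnd ℂ t = (A : ℂ) * (C : ℂ) := by
    have := Real.mul_self_sqrt hd'.le
    apply Complex.ext
    · simp [ht]
      nlinarith
    · simp [ht]
      ring
  have hroot : t ^ 2 - B * t + A * C = 0 := by rw [← hsum, ← hprod]; ring
  have hint : IsIntegral ℤ t := by
    refine ⟨Polynomial.X ^ 2 + (Polynomial.C (-B) * Polynomial.X + Polynomial.C (A * C)), ?_, ?_⟩
    · monicity!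
    · simp only [Polynomial.eval₂_add, Polynomial.eval₂_mul, Polynomial.eval₂_pow, Polynomial.eval₂_X,
        Polynomial.eval₂_C]
      simp only [eq_intCast]
      push_cast
      linear_combination hroot
  have hintQ : IsIntegral ℚ t := hint.tower_top
  have hdeg : (minpoly ℚ t).natDegree = 2 := by
    refine le_antisymm ?_ ((minpoly.two_le_natDegree_iff hintQ).2 ?_)
    · have hp : (Polynomial.X ^ 2 + (Polynomial.C (-B : ℚ) * Polynomial.X + Polynomial.C (A * C : ℚ))).Monic := by monicity!
      refine (Polynomial.natDegree_le_natDegree (minpoly.min ℚ t hp ?_)).trans ?_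
      · simp
        linear_combination hroot
      · compute_degree
    · rintro ⟨q, hq⟩
      refine him ?_
      rw [← hq]
      simp
  let K := IntermediateField.adjoin ℚ {t}
  have hfd : FiniteDimensional ℚ K := IntermediateField.adjoin.finiteDimensional hintQ
  have hNF : NumberField K := { to_charZero := inferInstance, to_finiteDimensional := hfd }
  have hrank : Module.finrank ℚ K = 2 := (IntermediateField.adjoin.finrank hintQ).trans hdeg
  have hquad : Algebra.IsQuadraticExtension ℚ K := ⟨hrank⟩
  have hnormal : Normal ℚ K := inferInstance
  let σK : K ≃ₐ[ℚ] K := (Complex.conjAe.restrictScalars ℚ).restrictNormal K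
  have hσK : ∀ x : K, ((σK x : K) : ℂ) = starRingEnd ℂ (x : ℂ) := fun x =>
    AlgEquiv.restrictNormal_commutes (Complex.conjAe.restrictScalars ℚ) K x
  have hr : Module.finrank ℤ (𝓞 K) = 2 := (RingOfIntegers.rank K).trans hrank
  let tK : K := ⟨t, IntermediateField.mem_adjoin_simple_self ℚ t⟩
  have htK : IsIntegral ℤ tK := (isIntegral_algHom_iff (K.val.restrictScalars ℤ) K.val.injective).1 hint
  let E : QuadEmb (𝓞 K) :=
    { φ := (algebraMap K ℂ).comp (algebraMap (𝓞 K) K)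
      inj := (algebraMap K ℂ).injective.comp RingOfIntegers.coe_injective
      σ := RingOfIntegers.mapRingEquiv σK.toRingEquiv
      φ_σ := fun x => hσK x
      τ := ⟨tK, htK⟩
      im_τ := him }
  refine E.exists_tendsto_form hr hA ?_ ?_
  · apply E.inj
    rw [map_add, E.φ_σ, map_intCast]
    exact hsum
  · apply E.inj
    rw [map_mul, E.φ_σ, map_mul, map_intCast, map_natCast]
    exact hprod

end BinaryForm

section Lattice
variable {v₁ v₂ : EuclideanSpace ℝ (Fin 2)}

lemma norm_sq_zsmul_add (v₁ v₂ : EuclideanSpace ℝ (Fin 2)) (i j : ℤ) : ‖i • v₁ + j • v₂‖ ^ 2 =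
    ⟪v₁, v₁⟫ * i ^ 2 + 2 * ⟪v₁, v₂⟫ * (i * j) + ⟪v₂, v₂⟫ * j ^ 2 := by
  rw [← Int.cast_smul_eq_zsmul ℝ, ← Int.cast_smul_eq_zsmul ℝ, ← real_inner_self_eq_norm_sq]
  simp only [inner_add_left, inner_add_right, real_inner_smul_left, real_inner_smul_right, real_inner_comm v₁ v₂]
  ring

lemma inner_self_pos_of_linearIndependent (h : LinearIndependent ℝ ![v₁, v₂]) : 0 < ⟪v₁, v₁⟫ :=
  real_inner_self_pos.2 (h.ne_zero 0)

lemma inner_sq_lt_of_linearIndependent (h : LinearIndependent ℝ ![v₁, v₂]) :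
    ⟪v₁, v₂⟫ ^ 2 < ⟪v₁, v₁⟫ * ⟪v₂, v₂⟫ := by
  have ha := inner_self_pos_of_linearIndependent h
  have hne : (-⟪v₁, v₂⟫) • v₁ + ⟪v₁, v₁⟫ • v₂ ≠ 0 := fun h0 =>
    ha.ne' (LinearIndependent.pair_iff.1 h _ _ h0).2
  have h1 := real_inner_self_pos.2 hne
  simp only [inner_add_left, inner_add_right, real_inner_smul_left, real_inner_smul_right, real_inner_comm v₁ v₂] at h1
  have h2 : 0 < ⟪v₁, v₁⟫ * (⟪v₁, v₁⟫ * ⟪v₂, v₂⟫ - ⟪v₁, v₂⟫ ^ 2) := by nlinarith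
  have := (mul_pos_iff_of_pos_left ha).1 h2
  linarith

lemma finite_form_le {a b c : ℝ} (ha : 0 < a) (hd : b ^ 2 < a * c) (x : ℝ) :
    {p : ℤ × ℤ | a * p.1 ^ 2 + 2 * b * (p.1 * p.2) + c * p.2 ^ 2 ≤ x}.Finite := by
  have hc : 0 < c := by
    have : 0 < a * c := (sq_nonneg b).trans_lt hd
    exact (mul_pos_iff_of_pos_left ha).1 this
  have hD : 0 < a * c - b ^ 2 := by linarith
  have key : ∀ (y : ℝ) (n : ℤ), (n : ℝ) ^ 2 ≤ y → n ∈ Set.Icc (-⌈y⌉) ⌈y⌉ := by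
    intro y n h
    have h1 : n ^ 2 ≤ ⌈y⌉ := by
      have := h.trans (Int.le_ceil y)
      exact_mod_cast this
    constructor <;> nlinarith [sq_nonneg (n - 1), sq_nonneg (n + 1), sq_abs n, abs_nonneg n, Int.le_self_sq n, Int.le_self_sq (-n)]
  refine ((Set.finite_Icc (-⌈c * x / (a * c - b ^ 2)⌉) ⌈c * x / (a * c - b ^ 2)⌉).prod
    (Set.finite_Icc (-⌈a * x / (a * c - b ^ 2)⌉) ⌈a * x / (a * c - b ^ 2)⌉)).subset ?_
  rintro ⟨i, j⟩ h
  simp only [Set.mem_ofPred_eq] at h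
  refine ⟨key _ _ ?_, key _ _ ?_⟩
  · rw [le_div_iff₀ hD]
    nlinarith [sq_nonneg (b * (i : ℝ) + c * j), mul_le_mul_of_nonneg_left h hc.le]
  · rw [le_div_iff₀ hD]
    nlinarith [sq_nonneg (a * (i : ℝ) + b * j), mul_le_mul_of_nonneg_left h ha.le]

lemma finite_values (h : LinearIndependent ℝ ![v₁, v₂]) (x : ℝ) :
    {r : ℝ | 0 < r ∧ r ≤ x ∧ ∃ v ∈ latticeOf v₁ v₂, ‖v‖ ^ 2 = r}.Finite := by
  refine ((finite_form_le (inner_self_pos_of_linearIndependent h) (inner_sq_lt_of_linearIndependent h) x).image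
    (fun p : ℤ × ℤ => ‖p.1 • v₁ + p.2 • v₂‖ ^ 2)).subset ?_
  rintro r ⟨-, hr, v, ⟨i, j, rfl⟩, rfl⟩
  refine ⟨(i, j), ?_, rfl⟩
  rw [norm_sq_zsmul_add] at hr
  exact hr

theorem not_tendsto_NL (h : LinearIndependent ℝ ![v₁, v₂])
    (hn : ¬∃ lam : ℝ, 0 < lam ∧ (∃ q : ℚ, lam * ⟪v₁, v₁⟫ = q) ∧ (∃ q : ℚ, lam * ⟪v₁, v₂⟫ = q) ∧
      ∃ q : ℚ, lam * ⟪v₂, v₂⟫ = q) (F : ℝ) :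
    ¬Tendsto (fun x => (NL (latticeOf v₁ v₂) x : ℝ) * √(log x) / x) atTop (nhds F) := by
  have ha := inner_self_pos_of_linearIndependent h
  refine not_tendsto_of_not_rational ha (inner_sq_lt_of_linearIndependent h) hn _ (fun x => ?_) F
  refine ⟨(finite_values h x).toFinset, (Set.ncard_eq_toFinset_card _ _).symm, fun i j hi hj hx => ?_⟩
  rw [Set.Finite.mem_toFinset]
  have h1 := norm_sq_zsmul_add v₁ v₂ i j
  simp only [Int.cast_natCast] at h1
  rw [← h1] at hx ⊢
  refine ⟨?_, hx, _, ⟨i, j, rfl⟩, rfl⟩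
  have h2 : (i : ℤ) • v₁ + (j : ℤ) • v₂ ≠ 0 := by
    intro h0
    rw [← Int.cast_smul_eq_zsmul ℝ, ← Int.cast_smul_eq_zsmul ℝ] at h0
    have := (LinearIndependent.pair_iff.1 h _ _ h0).1
    simp only [Int.cast_natCast, Nat.cast_eq_zero] at this
    omega
  have := norm_pos_iff.2 h2
  positivity

theorem exists_tendsto_NL (h : LinearIndependent ℝ ![v₁, v₂]) {lam : ℝ} (hlam : 0 < lam)
    (h1 : ∃ q : ℚ, lam * ⟪v₁, v₁⟫ = q) (h2 : ∃ q : ℚ, lam * ⟪v₁, v₂⟫ = q) (h3 : ∃ q : ℚ, lam * ⟪v₂, v₂⟫ = q) :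
    ∃ F, Tendsto (fun x => (NL (latticeOf v₁ v₂) x : ℝ) * √(log x) / x) atTop (nhds F) := by
  obtain ⟨q₁, h1⟩ := h1
  obtain ⟨q₂, h2⟩ := h2
  obtain ⟨q₃, h3⟩ := h3
  have ha := inner_self_pos_of_linearIndependent h
  have hd := inner_sq_lt_of_linearIndependent h
  obtain ⟨d, hd0, A, B, C, hA, hB, hC⟩ : ∃ d : ℕ, 0 < d ∧ ∃ A B C : ℤ, (d : ℝ) * q₁ = A ∧ (d : ℝ) * q₂ = B ∧ (d : ℝ) * q₃ = C := by
    refine ⟨q₁.den * q₂.den * q₃.den, by have := q₁.pos; have := q₂.pos; have := q₃.pos; positivity,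
      q₁.num * q₂.den * q₃.den, q₂.num * q₁.den * q₃.den, q₃.num * q₁.den * q₂.den, ?_, ?_, ?_⟩
    all_goals
      have e₁ : (q₁ : ℝ) * q₁.den = q₁.num := by exact_mod_cast Rat.mul_den_eq_num q₁
      have e₂ : (q₂ : ℝ) * q₂.den = q₂.num := by exact_mod_cast Rat.mul_den_eq_num q₂
      have e₃ : (q₃ : ℝ) * q₃.den = q₃.num := by exact_mod_cast Rat.mul_den_eq_num q₃
      push_cast
      simp only [← e₁, ← e₂, ← e₃]
      ring
  have hd0' : (0 : ℝ) < d := by exact_mod_cast hd0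
  set k : ℝ := d * lam with hk
  have hk0 : 0 < k := by positivity
  replace hA : k * ⟪v₁, v₁⟫ = A := by rw [← hA, ← h1, hk, mul_assoc]
  replace hB : k * ⟪v₁, v₂⟫ = B := by rw [← hB, ← h2, hk, mul_assoc]
  replace hC : k * ⟪v₂, v₂⟫ = C := by rw [← hC, ← h3, hk, mul_assoc]
  have hA0 : (0 : ℝ) < A := hA ▸ mul_pos hk0 ha
  have hA1 : 0 < A := by exact_mod_cast hA0
  lift A to ℕ using hA1.le
  rw [Int.cast_natCast] at hA hA0
  have hdisc : (2 * B) ^ 2 < 4 * A * C := by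
    have h5 : (2 * B : ℝ) ^ 2 < 4 * A * C := by
      rw [← hA, ← hB, ← hC]
      nlinarith [mul_pos hk0 hk0]
    exact_mod_cast h5
  obtain ⟨F, hF⟩ := exists_tendsto_binary_form (by exact_mod_cast hA1) hdisc
  have hs : 0 < (A : ℝ) * k := by positivity
  refine ⟨_, (ClassData.tendsto_scale hF (inv_pos.2 hs)).congr fun x => ?_⟩
  rw [div_inv_eq_mul]
  congr 3
  rw [NL, ← Set.InjOn.ncard_image (f := fun r : ℝ => (A : ℝ) * k * r)
    (fun a _ b _ hab => mul_left_cancel₀ hs.ne' hab),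
    ← Set.InjOn.ncard_image (f := fun n : ℕ => (n : ℝ)) (fun a _ b _ hab => Nat.cast_injective hab)]
  congr 1
  have hform : ∀ i j : ℤ, (A : ℝ) * k * ‖i • v₁ + j • v₂‖ ^ 2 =
      (((A : ℤ) * (A * i ^ 2 + 2 * B * (i * j) + C * j ^ 2) : ℤ) : ℝ) := by
    intro i j
    rw [norm_sq_zsmul_add]
    push_cast
    rw [← hA, ← hB, ← hC]
    ring
  ext y
  constructor
  · rintro ⟨n, ⟨⟨hn0, i, j, hij⟩, hnx⟩, rfl⟩
    have h4 := hform i j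
    rw [hij, Int.cast_natCast] at h4
    have hn : (0 : ℝ) < n := by exact_mod_cast Nat.pos_of_ne_zero hn0
    refine ⟨_, ⟨?_, ?_, _, ⟨i, j, rfl⟩, rfl⟩, h4⟩
    · rw [← h4] at hn
      exact (mul_pos_iff_of_pos_left hs).1 hn
    · rw [Nat.le_floor_iff' hn0, ← h4, mul_comm x] at hnx
      exact (mul_le_mul_iff_right₀ hs).1 hnx
  · rintro ⟨_, ⟨hr0, hrx, _, ⟨i, j, rfl⟩, rfl⟩, rfl⟩
    dsimp only
    have h4 : (0 : ℝ) < (A : ℝ) * k * ‖i • v₁ + j • v₂‖ ^ 2 := mul_pos hs hr0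
    have h5 := mul_le_mul_of_nonneg_left hrx hs.le
    rw [hform] at h4 h5 ⊢
    obtain ⟨n, hn⟩ := Int.eq_ofNat_of_zero_le (by exact_mod_cast h4.le :
      0 ≤ (A : ℤ) * (A * i ^ 2 + 2 * B * (i * j) + C * j ^ 2))
    rw [hn, Int.cast_natCast] at h4 h5 ⊢
    have hn0 : n ≠ 0 := by
      rintro rfl
      simp at h4
    refine ⟨n, ⟨⟨hn0, i, j, hn⟩, ?_⟩, rfl⟩
    rwa [Nat.le_floor_iff' hn0, mul_comm x]

end Lattice

theorem stmt4 (v₁ v₂ : EuclideanSpace ℝ (Fin 2))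
    (hind : LinearIndependent ℝ ![v₁, v₂]) :
    (∃ F : ℝ, Tendsto (fun x : ℝ => (NL (latticeOf v₁ v₂) x : ℝ) * Real.sqrt (Real.log x) / x)
        atTop (nhds F)) ↔
      ∃ (w₁ w₂ : EuclideanSpace ℝ (Fin 2)) (lam : ℝ), 0 < lam ∧
        LinearIndependent ℝ ![w₁, w₂] ∧ latticeOf w₁ w₂ = latticeOf v₁ v₂ ∧
        (∃ q : ℚ, lam * ⟪w₁, w₁⟫ = (q : ℝ)) ∧ (∃ q : ℚ, lam * ⟪w₁, w₂⟫ = (q : ℝ)) ∧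
        (∃ q : ℚ, lam * ⟪w₂, w₂⟫ = (q : ℝ)) := by
  constructor
  · rintro ⟨F, hF⟩
    by_contra hn
    refine not_tendsto_NL hind (fun ⟨lam, h0, h1, h2, h3⟩ => hn ?_) F hF
    exact ⟨v₁, v₂, lam, h0, hind, rfl, h1, h2, h3⟩
  · rintro ⟨w₁, w₂, lam, h0, hw, hΛ, h1, h2, h3⟩
    rw [← hΛ]
    exact exists_tendsto_NL hw h0 h1 h2 h3
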